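/- Let D ⊂ ℂⁿ be a bounded α-regular domain, K ⊂ D a compact set, and ψ ∈ C(K) with sup_K ψ < 0. Assume ψ admits a negative strictly α-subharmonic extension to a neighborhood D⁺ of D̄, i.e., there exists ψ̃ strictly α-subharmonic on D⁺ with ψ̃ = ψ on K and ψ̃ < 0 on D. Then a point z₀ ∈ K is locally (α,ψ)-regular if and only if it is (α,ψ)-regular. -/

import Mathlib

open MeasureTheory Filter Topology Complex Metric

noncomputable section

/-- Complex `n`-space. -/
abbrev Cn (n : ℕ) := Fin n → ℂ

/-- The Wirtinger derivative `∂f/∂z_j` of a (real-differentiable) function `f : ℂⁿ → ℂ`. -/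
noncomputable def wdz {n : ℕ} (j : Fin n) (f : Cn n → ℂ) (z : Cn n) : ℂ :=
  (fderiv ℝ f z (Pi.single j 1) - Complex.I * fderiv ℝ f z (Pi.single j Complex.I)) / 2

/-- The Wirtinger derivative `∂f/∂z̄_j` of a (real-differentiable) function `f : ℂⁿ → ℂ`. -/
noncomputable def wdzbar {n : ℕ} (j : Fin n) (f : Cn n → ℂ) (z : Cn n) : ℂ :=
  (fderiv ℝ f z (Pi.single j 1) + Complex.I * fderiv ℝ f z (Pi.single j Complex.I)) / 2

/-- The square of the Euclidean norm `|z|² = ∑ |z_i|²` on `ℂⁿ`. -/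
noncomputable def sqNorm {n : ℕ} (z : Cn n) : ℝ := ∑ i, Complex.normSq (z i)

/-- A closed, strictly positive differential form `α` of bidegree `(n-1, n-1)` with `C¹`
coefficients on `ℂⁿ`, recorded through its normalized coefficient matrix:  `coeff j k` is
the Hermitian positive-definite matrix `A_{jk}` such that
`dd^c u ∧ α = (∑_{j,k} A_{jk} ∂²u/∂z_j∂z̄_k) dV`.  In these terms closedness of `α`
reads `∑_j ∂A_{jk}/∂z_j = 0` for every `k` (the conjugate identity follows by
Hermitian symmetry). -/
structure AlphaForm (n : ℕ) where
  coeff : Fin n → Fin n → Cn n → ℂ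
  contDiff : ∀ j k, ContDiff ℝ 1 (coeff j k)
  hermitian : ∀ j k z, coeff k j z = starRingEnd ℂ (coeff j k z)
  strictlyPositive : ∀ z : Cn n, ∀ ξ : Fin n → ℂ, ξ ≠ 0 →
    0 < (∑ j, ∑ k, coeff j k z * ξ j * starRingEnd ℂ (ξ k)).re
  closed : ∀ k, ∀ z : Cn n, (∑ j, wdz j (coeff j k) z) = 0

/-- The second order operator `f ↦ ∑_{j,k} A_{jk} ∂²f/∂z_j∂z̄_k` representing the
top-degree form `dd^c f ∧ α` (with respect to Lebesgue measure). -/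
noncomputable def alphaOp {n : ℕ} (A : AlphaForm n) (f : Cn n → ℂ) (z : Cn n) : ℂ :=
  ∑ j, ∑ k, A.coeff j k z * wdzbar k (wdz j f) z

/-- The operator `alphaOp` applied to a real-valued function, returning the real part. -/
noncomputable def alphaOpR {n : ℕ} (A : AlphaForm n) (ω : Cn n → ℝ) (z : Cn n) : ℝ :=
  (alphaOp A (fun w => (ω w : ℂ)) z).re

/-- `u : ℂⁿ → EReal` is `α`-subharmonic on `D`: it is finite-or-`-∞`, strongly upper
semicontinuous on `D`, locally integrable on `D`, and the current `dd^c u ∧ α` is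
positive, i.e. `∫_D u · (α ∧ dd^c ω) ≥ 0` for every nonnegative test function `ω` on `D`. -/
def IsAlphaSubharmonicE {n : ℕ} (A : AlphaForm n) (D : Set (Cn n)) (u : Cn n → EReal) : Prop :=
  (∀ z ∈ D, u z ≠ ⊤) ∧
  UpperSemicontinuousOn u D ∧
  (∀ z₀ ∈ D, ∀ S : Set (Cn n),
      (∃ N ∈ 𝓝 z₀, volume (N \ S) = 0) → Filter.limsup u (𝓝[S] z₀) = u z₀) ∧
  LocallyIntegrableOn (fun z => (u z).toReal) D volume ∧
  ∀ ω : Cn n → ℝ, ContDiff ℝ (⊤ : ℕ∞) ω → HasCompactSupport ω → tsupport ω ⊆ D →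
    (∀ z, 0 ≤ ω z) → 0 ≤ ∫ z in D, (u z).toReal * alphaOpR A ω z

/-- A real-valued function is `α`-subharmonic on `D` if it is so as an `EReal`-valued
function. -/
def IsAlphaSubharmonic {n : ℕ} (A : AlphaForm n) (D : Set (Cn n)) (u : Cn n → ℝ) : Prop :=
  IsAlphaSubharmonicE A D (fun z => (u z : EReal))

/-- `h` is `α`-harmonic on the open set `U`: `dd^c h ∧ α = 0` there, in the sense of
currents. -/
def IsAlphaHarmonicOn {n : ℕ} (A : AlphaForm n) (U : Set (Cn n)) (h : Cn n → ℝ) : Prop :=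
  LocallyIntegrableOn h U volume ∧
  ∀ ω : Cn n → ℝ, ContDiff ℝ (⊤ : ℕ∞) ω → HasCompactSupport ω → tsupport ω ⊆ U →
    (∫ z in U, h z * alphaOpR A ω z) = 0

/-- `u` is strictly `α`-subharmonic on `G`: for every compact subdomain `G' ⋐ G` there is
`ε > 0` with `u - ε|z|²` `α`-subharmonic on `G'`. -/
def IsStrictlyAlphaSubharmonic {n : ℕ} (A : AlphaForm n) (G : Set (Cn n)) (u : Cn n → ℝ) :
    Prop :=
  ∀ G' : Set (Cn n), IsOpen G' → IsCompact (closure G') → closure G' ⊆ G →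
    ∃ ε > (0 : ℝ), IsAlphaSubharmonic A G' (fun z => u z - ε * sqNorm z)

/-- `D` is a bounded `α`-regular domain: a bounded domain carrying a negative
`α`-subharmonic exhaustion `ρ` with boundary limit `0`. -/
def IsAlphaRegularDomain {n : ℕ} (A : AlphaForm n) (D : Set (Cn n)) : Prop :=
  IsOpen D ∧ IsConnected D ∧ Bornology.IsBounded D ∧
  ∃ ρ : Cn n → ℝ, IsAlphaSubharmonic A D ρ ∧ (∀ z ∈ D, ρ z < 0) ∧
    ∀ ζ ∈ frontier D, Filter.Tendsto ρ (𝓝[D] ζ) (𝓝 0)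

/-- `D` is a strongly `α`-regular domain: `D = {ρ < 0}` for some `ρ` which is `C²` and
strictly `α`-subharmonic on a neighborhood `D⁺` of `closure D`. -/
def IsStronglyAlphaRegularDomain {n : ℕ} (A : AlphaForm n) (D : Set (Cn n)) : Prop :=
  IsOpen D ∧ IsConnected D ∧ Bornology.IsBounded D ∧
  ∃ Dp : Set (Cn n), IsOpen Dp ∧ closure D ⊆ Dp ∧
    ∃ ρ : Cn n → ℝ, ContDiffOn ℝ 2 ρ Dp ∧ IsStrictlyAlphaSubharmonic A Dp ρ ∧
      D = {z ∈ Dp | ρ z < 0}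

/-- The class `U(E, D, ψ)` of `α`-subharmonic functions `u` on `D` with `u ≤ ψ` on `E`
and `u < 0` on `D`. -/
def Uclass {n : ℕ} (A : AlphaForm n) (E D : Set (Cn n)) (ψ : Cn n → ℝ) :
    Set (Cn n → ℝ) :=
  {u | IsAlphaSubharmonic A D u ∧ (∀ z ∈ E, u z ≤ ψ z) ∧ ∀ z ∈ D, u z < 0}

/-- The weighted extremal function `ω_α(z, E, D, ψ)`. -/
noncomputable def omegaW {n : ℕ} (A : AlphaForm n) (E D : Set (Cn n)) (ψ : Cn n → ℝ)
    (z : Cn n) : ℝ :=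
  sSup ((fun u : Cn n → ℝ => u z) '' Uclass A E D ψ)

/-- The weighted `α`-subharmonic measure `ω*_α(z, E, D, ψ)`: the upper semicontinuous
regularization of `ω_α(·, E, D, ψ)`. -/
noncomputable def omegaWStar {n : ℕ} (A : AlphaForm n) (E D : Set (Cn n)) (ψ : Cn n → ℝ)
    (z : Cn n) : ℝ :=
  Filter.limsup (omegaW A E D ψ) (𝓝 z)

/-- The (unweighted) extremal function `ω_α(z, E, D)`. -/
noncomputable def omega0 {n : ℕ} (A : AlphaForm n) (E D : Set (Cn n)) : Cn n → ℝ :=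
  omegaW A E D (fun _ => (-1 : ℝ))

/-- The (unweighted) `α`-subharmonic measure `ω*_α(z, E, D)`. -/
noncomputable def omega0Star {n : ℕ} (A : AlphaForm n) (E D : Set (Cn n)) : Cn n → ℝ :=
  omegaWStar A E D (fun _ => (-1 : ℝ))

/-- `S` is `α`-polar in `D`: there is an `α`-subharmonic `ρ` on `D`, not identically
`-∞`, with `ρ = -∞` on `S`. -/
def IsAlphaPolar {n : ℕ} (A : AlphaForm n) (D S : Set (Cn n)) : Prop :=
  ∃ ρ : Cn n → EReal, IsAlphaSubharmonicE A D ρ ∧ (∃ z ∈ D, ρ z ≠ ⊥) ∧ ∀ z ∈ S, ρ z = ⊥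

/-- `u` is plurisubharmonic on `D`: upper semicontinuous, locally integrable, and with
positive semidefinite complex Hessian in the sense of distributions. -/
def IsPlurisubharmonic {n : ℕ} (D : Set (Cn n)) (u : Cn n → ℝ) : Prop :=
  UpperSemicontinuousOn u D ∧ LocallyIntegrableOn u D volume ∧
  ∀ ξ : Fin n → ℂ, ∀ ω : Cn n → ℝ, ContDiff ℝ (⊤ : ℕ∞) ω → HasCompactSupport ω →
    tsupport ω ⊆ D → (∀ z, 0 ≤ ω z) →
    0 ≤ ∫ z in D, u z *
      (∑ j, ∑ k, ξ j * starRingEnd ℂ (ξ k) * wdzbar k (wdz j (fun w => (ω w : ℂ))) z).re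

/-- The class `U(E,D)` for the plurisubharmonic measure. -/
def UclassPsh {n : ℕ} (E D : Set (Cn n)) : Set (Cn n → ℝ) :=
  {u | IsPlurisubharmonic D u ∧ (∀ z ∈ E, u z ≤ -1) ∧ ∀ z ∈ D, u z < 0}

/-- The plurisubharmonic extremal function `ω(z, E, D)`. -/
noncomputable def omegaPsh {n : ℕ} (E D : Set (Cn n)) (z : Cn n) : ℝ :=
  sSup ((fun u : Cn n → ℝ => u z) '' UclassPsh E D)

/-- The plurisubharmonic measure `ω*(z, E, D)`. -/
noncomputable def omegaPshStar {n : ℕ} (E D : Set (Cn n)) (z : Cn n) : ℝ :=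
  Filter.limsup (omegaPsh E D) (𝓝 z)

end




noncomputable section

namespace ASub

set_option linter.unusedSectionVars false

lemma two_le_infty : (2 : WithTop ℕ∞) ≤ ((⊤ : ℕ∞) : WithTop ℕ∞) := by
  have : ((2 : ℕ∞) : WithTop ℕ∞) ≤ ((⊤ : ℕ∞) : WithTop ℕ∞) := WithTop.coe_le_coe.2 le_top
  simpa using this

lemma one_le_infty : (1 : WithTop ℕ∞) ≤ ((⊤ : ℕ∞) : WithTop ℕ∞) := by
  have : ((1 : ℕ∞) : WithTop ℕ∞) ≤ ((⊤ : ℕ∞) : WithTop ℕ∞) := WithTop.coe_le_coe.2 le_top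
  simpa using this

section Basic

variable {ι : Type*} [Fintype ι] {E : Type*} [NormedAddCommGroup E] [NormedSpace ℝ E]

/-- Directional derivative. -/
def pd (v : E) (f : E → ℝ) (x : E) : ℝ := fderiv ℝ f x v

/-- A divergence free elliptic coefficient matrix with `C¹` entries. -/
structure Ell (e : ι → E) where
  a : ι → ι → E → ℝ
  smooth : ∀ i j, ContDiff ℝ 1 (a i j)
  symm : ∀ i j x, a i j x = a j i x
  pos : ∀ x (ξ : ι → ℝ), ξ ≠ 0 → 0 < ∑ i, ∑ j, a i j x * ξ i * ξ j
  divfree : ∀ j x, ∑ i, pd (e i) (a i j) x = 0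

/-- The operator associated with the coefficients. -/
def Ell.L {e : ι → E} (A : Ell e) (f : E → ℝ) (x : E) : ℝ :=
  ∑ i, ∑ j, A.a i j x * pd (e i) (pd (e j) f) x

lemma pd_contDiff {m n : WithTop ℕ∞} {f : E → ℝ} (hf : ContDiff ℝ n f) (hmn : m + 1 ≤ n) (v : E) :
    ContDiff ℝ m (pd v f) :=
  (hf.fderiv_right hmn).clm_apply contDiff_const

lemma pd_contDiff_inf {f : E → ℝ} (hf : ContDiff ℝ (⊤ : ℕ∞) f) (v : E) : ContDiff ℝ (⊤ : ℕ∞) (pd v f) :=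
  pd_contDiff hf (by simp) v

lemma pd_continuous {f : E → ℝ} (hf : ContDiff ℝ 1 f) (v : E) : Continuous (pd v f) :=
  (pd_contDiff (m := 0) hf (by simp) v).continuous

lemma pd_add {f g : E → ℝ} {x : E} (hf : DifferentiableAt ℝ f x) (hg : DifferentiableAt ℝ g x)
    (v : E) : pd v (fun y => f y + g y) x = pd v f x + pd v g x := by
  simp [pd, fderiv_fun_add hf hg]

lemma pd_sub {f g : E → ℝ} {x : E} (hf : DifferentiableAt ℝ f x) (hg : DifferentiableAt ℝ g x)
    (v : E) : pd v (fun y => f y - g y) x = pd v f x - pd v g x := by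
  simp [pd, fderiv_fun_sub hf hg]

lemma pd_mul {f g : E → ℝ} {x : E} (hf : DifferentiableAt ℝ f x) (hg : DifferentiableAt ℝ g x)
    (v : E) : pd v (fun y => f y * g y) x = pd v f x * g x + f x * pd v g x := by
  simp [pd, fderiv_fun_mul hf hg]; ring

lemma pd_sum {κ : Type*} (s : Finset κ) {f : κ → E → ℝ} {x : E}
    (hf : ∀ k ∈ s, DifferentiableAt ℝ (f k) x) (v : E) :
    pd v (fun y => ∑ k ∈ s, f k y) x = ∑ k ∈ s, pd v (f k) x := by
  simp [pd, fderiv_fun_sum hf]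

lemma pd_const (v : E) (c : ℝ) (x : E) : pd v (fun _ => c) x = 0 := by simp [pd]

lemma pd_comp {h : ℝ → ℝ} {f : E → ℝ} {x : E} (hh : DifferentiableAt ℝ h (f x))
    (hf : DifferentiableAt ℝ f x) (v : E) :
    pd v (fun y => h (f y)) x = deriv h (f x) * pd v f x := by
  have := (hh.hasDerivAt.comp_hasFDerivAt x hf.hasFDerivAt).fderiv
  unfold pd
  rw [show (fun y => h (f y)) = h ∘ f from rfl, this]; simp

lemma pd_eq_zero_of_notMem {f : E → ℝ} {x : E} (hx : x ∉ tsupport f) (v : E) : pd v f x = 0 := by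
  have : fderiv ℝ f x = 0 := by
    have h := support_fderiv_subset ℝ (f := f)
    by_contra hne
    exact hx (h hne)
  simp [pd, this]

lemma tsupport_pd_subset {f : E → ℝ} (v : E) : tsupport (pd v f) ⊆ tsupport f := by
  apply closure_minimal _ (isClosed_tsupport _)
  intro x hx
  by_contra h
  exact hx (pd_eq_zero_of_notMem h v)

lemma hasCompactSupport_pd {f : E → ℝ} (hf : HasCompactSupport f) (v : E) :
    HasCompactSupport (pd v f) :=
  hf.mono' (subset_closure.trans (tsupport_pd_subset v))

variable {e : ι → E} (A : Ell e)

lemma L_eq_zero_of_notMem {f : E → ℝ} {x : E} (hx : x ∉ tsupport f) : A.L f x = 0 := by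
  unfold Ell.L
  refine Finset.sum_eq_zero fun i _ => Finset.sum_eq_zero fun j _ => ?_
  rw [pd_eq_zero_of_notMem (fun h => hx (tsupport_pd_subset _ h)), mul_zero]

lemma tsupport_L_subset {f : E → ℝ} : tsupport (A.L f) ⊆ tsupport f := by
  apply closure_minimal _ (isClosed_tsupport _)
  intro x hx
  by_contra h
  exact hx (L_eq_zero_of_notMem A h)

lemma hasCompactSupport_L {f : E → ℝ} (hf : HasCompactSupport f) : HasCompactSupport (A.L f) :=
  hf.mono' (subset_closure.trans (tsupport_L_subset A))

lemma L_continuous {f : E → ℝ} (hf : ContDiff ℝ 2 f) : Continuous (A.L f) := by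
  unfold Ell.L
  refine continuous_finsetSum _ fun i _ => continuous_finsetSum _ fun j _ => ?_
  exact (A.smooth i j).continuous.mul
    (pd_continuous (pd_contDiff hf (by norm_num [one_add_one_eq_two]) _) _)

lemma L_add {f g : E → ℝ} (hf : ContDiff ℝ 2 f) (hg : ContDiff ℝ 2 g) (x : E) :
    A.L (fun y => f y + g y) x = A.L f x + A.L g x := by
  have h1 : ∀ {f : E → ℝ}, ContDiff ℝ 2 f → ∀ v, ContDiff ℝ 1 (pd v f) := fun hf v =>
    pd_contDiff hf (by norm_num [one_add_one_eq_two]) v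
  unfold Ell.L
  rw [← Finset.sum_add_distrib]
  refine Finset.sum_congr rfl fun i _ => ?_
  rw [← Finset.sum_add_distrib]
  refine Finset.sum_congr rfl fun j _ => ?_
  have : pd (e j) (fun y => f y + g y) = fun y => pd (e j) f y + pd (e j) g y := by
    funext y
    exact pd_add (hf.differentiable (by simp) y) (hg.differentiable (by simp) y) _
  rw [this, pd_add ((h1 hf _).differentiable (by simp) x) ((h1 hg _).differentiable (by simp) x)]
  ring

/-- divergence form -/
lemma L_div {f : E → ℝ} (hf : ContDiff ℝ 2 f) (x : E) :
    A.L f x = ∑ i, pd (e i) (fun y => ∑ j, A.a i j y * pd (e j) f y) x := by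
  have h1 : ∀ v, ContDiff ℝ 1 (pd v f) := fun v =>
    pd_contDiff hf (by norm_num [one_add_one_eq_two]) v
  have hd : ∀ i j, DifferentiableAt ℝ (A.a i j) x := fun i j =>
    (A.smooth i j).differentiable (by simp) x
  have hd1 : ∀ v, DifferentiableAt ℝ (pd v f) x := fun v => (h1 v).differentiable (by simp) x
  have : ∀ i, pd (e i) (fun y => ∑ j, A.a i j y * pd (e j) f y) x
      = ∑ j, (pd (e i) (A.a i j) x * pd (e j) f x + A.a i j x * pd (e i) (pd (e j) f) x) := by
    intro i
    rw [pd_sum (f := fun j y => A.a i j y * pd (e j) f y) _ (fun j _ => (hd i j).fun_mul (hd1 _))]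
    exact Finset.sum_congr rfl fun j _ => pd_mul (hd i j) (hd1 _) _
  simp_rw [this, Finset.sum_add_distrib]
  rw [Finset.sum_comm (f := fun i j => pd (e i) (A.a i j) x * pd (e j) f x)]
  simp_rw [← Finset.sum_mul, A.divfree]
  simp [Ell.L]

end Basic

section Meas

variable {ι : Type*} [Fintype ι] {E : Type*} [NormedAddCommGroup E] [NormedSpace ℝ E]
  [FiniteDimensional ℝ E] [MeasurableSpace E] [BorelSpace E]
  (μ : Measure E) [μ.IsAddHaarMeasure] {e : ι → E} (A : Ell e)

lemma integral_pd_eq_zero {g : E → ℝ} (hg : ContDiff ℝ 1 g) (hc : HasCompactSupport g) (v : E) :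
    ∫ x, pd v g x ∂μ = 0 := by
  have h1 : Integrable (pd v g) μ :=
    (pd_continuous hg v).integrable_of_hasCompactSupport (hasCompactSupport_pd hc v)
  have h2 : Integrable g μ := hg.continuous.integrable_of_hasCompactSupport hc
  have := integral_mul_fderiv_eq_neg_fderiv_mul_of_integrable (μ := μ) (f := fun _ : E => (1:ℝ))
    (g := g) (v := v) (by simp) (by unfold pd at h1; simpa using h1) (by simpa using h2)
    (fun x _ => by fun_prop) (fun x _ => hg.differentiable (by simp) x)
  unfold pd
  simpa using this

lemma integral_div_eq_zero {X : ι → E → ℝ} (hX : ∀ i, ContDiff ℝ 1 (X i))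
    (hc : ∀ i, HasCompactSupport (X i)) : ∫ x, ∑ i, pd (e i) (X i) x ∂μ = 0 := by
  rw [integral_finsetSum]
  · exact Finset.sum_eq_zero fun i _ => integral_pd_eq_zero μ (hX i) (hc i) _
  · intro i _
    exact (pd_continuous (hX i) _).integrable_of_hasCompactSupport (hasCompactSupport_pd (hc i) _)

lemma contDiff_field {f : E → ℝ} (hf : ContDiff ℝ 2 f) (i : ι) :
    ContDiff ℝ 1 (fun y => ∑ j, A.a i j y * pd (e j) f y) :=
  ContDiff.sum fun j _ => (A.smooth i j).mul
    (pd_contDiff hf (by norm_num [one_add_one_eq_two]) _)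

lemma hasCompactSupport_field {f : E → ℝ} (hf : HasCompactSupport f) (i : ι) :
    HasCompactSupport (fun y => ∑ j, A.a i j y * pd (e j) f y) := by
  apply hf.mono'
  intro x hx
  by_contra h
  refine hx (Finset.sum_eq_zero fun j _ => ?_)
  rw [pd_eq_zero_of_notMem h, mul_zero]

/-- Integration by parts. -/
lemma ibp {f ω : E → ℝ} (hf : ContDiff ℝ 1 f) (hω : ContDiff ℝ 2 ω) (hc : HasCompactSupport ω) :
    ∫ x, f x * A.L ω x ∂μ
      = - ∫ x, ∑ i, pd (e i) f x * ∑ j, A.a i j x * pd (e j) ω x ∂μ := by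
  have hX := contDiff_field A hω
  have hXc := hasCompactSupport_field A hc
  have h0 := integral_div_eq_zero (e := e) μ (X := fun i y => f y * ∑ j, A.a i j y * pd (e j) ω y)
    (fun i => hf.mul (hX i)) (fun i => (hXc i).mul_left)
  have h1 : ∀ x, ∑ i, pd (e i) (fun y => f y * ∑ j, A.a i j y * pd (e j) ω y) x
      = (∑ i, pd (e i) f x * ∑ j, A.a i j x * pd (e j) ω x) + f x * A.L ω x := by
    intro x
    rw [L_div A hω, Finset.mul_sum, ← Finset.sum_add_distrib]
    refine Finset.sum_congr rfl fun i _ => ?_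
    exact pd_mul (hf.differentiable (by simp) x) ((hX i).differentiable (by simp) x) _
  simp_rw [h1] at h0
  rw [integral_add] at h0
  · linarith
  · apply Continuous.integrable_of_hasCompactSupport
    · exact continuous_finsetSum _ fun i _ => (pd_continuous hf _).mul (hX i).continuous
    · apply hc.mono'
      intro x hx
      by_contra h
      refine hx (Finset.sum_eq_zero fun i _ => ?_)
      rw [Finset.sum_eq_zero (fun j _ => by rw [pd_eq_zero_of_notMem h, mul_zero]), mul_zero]
  · exact (hf.continuous.mul (L_continuous A hω)).integrable_of_hasCompactSupport
      (hasCompactSupport_L A hc).mul_left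

/-- Self-adjointness. -/
lemma selfadj {f ω : E → ℝ} (hf : ContDiff ℝ 2 f) (hω : ContDiff ℝ 2 ω)
    (hc : HasCompactSupport ω) :
    ∫ x, f x * A.L ω x ∂μ = ∫ x, ω x * A.L f x ∂μ := by
  rw [ibp μ A (hf.of_le (by norm_num)) hω hc]
  have hX := contDiff_field A hf
  have h0 := integral_div_eq_zero (e := e) μ (X := fun i y => ω y * ∑ j, A.a i j y * pd (e j) f y)
    (fun i => (hω.of_le (by norm_num)).mul (hX i)) (fun i => hc.mul_right)
  have h1 : ∀ x, ∑ i, pd (e i) (fun y => ω y * ∑ j, A.a i j y * pd (e j) f y) x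
      = (∑ i, pd (e i) f x * ∑ j, A.a i j x * pd (e j) ω x) + ω x * A.L f x := by
    intro x
    rw [L_div A hf, Finset.mul_sum]
    have : ∑ i, pd (e i) f x * ∑ j, A.a i j x * pd (e j) ω x
        = ∑ i, pd (e i) ω x * ∑ j, A.a i j x * pd (e j) f x := by
      simp_rw [Finset.mul_sum]
      rw [Finset.sum_comm]
      refine Finset.sum_congr rfl fun i _ => Finset.sum_congr rfl fun j _ => ?_
      rw [A.symm]; ring
    rw [this, ← Finset.sum_add_distrib]
    refine Finset.sum_congr rfl fun i _ => ?_
    exact pd_mul (hω.differentiable (by simp) x) ((hX i).differentiable (by simp) x) _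
  simp_rw [h1] at h0
  rw [integral_add] at h0
  · linarith
  · apply Continuous.integrable_of_hasCompactSupport
    · exact continuous_finsetSum _ fun i _ =>
        (pd_continuous (hf.of_le (by norm_num)) _).mul (contDiff_field A hω i).continuous
    · apply hc.mono'
      intro x hx
      by_contra h
      refine hx (Finset.sum_eq_zero fun i _ => ?_)
      rw [Finset.sum_eq_zero (fun j _ => by rw [pd_eq_zero_of_notMem h, mul_zero]), mul_zero]
  · exact (hω.continuous.mul (L_continuous A hf)).integrable_of_hasCompactSupport hc.mul_right

/-- Distributional subsolutions. -/
def DS (Ω : Set E) (u : E → ℝ) : Prop :=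
  LocallyIntegrableOn u Ω μ ∧ ∀ ω : E → ℝ, ContDiff ℝ (⊤ : ℕ∞) ω → HasCompactSupport ω →
    tsupport ω ⊆ Ω → (∀ x, 0 ≤ ω x) → 0 ≤ ∫ x, u x * A.L ω x ∂μ

variable {μ}

lemma integrable_mul_of_locInt {Ω : Set E} {u g : E → ℝ}
    (hu : LocallyIntegrableOn u Ω μ) (hg : Continuous g) (hc : HasCompactSupport g)
    (hs : tsupport g ⊆ Ω) : Integrable (fun x => u x * g x) μ := by
  have h1 : IntegrableOn u (tsupport g) μ := hu.integrableOn_compact_subset hs hc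
  have h2 : IntegrableOn (fun x => u x * g x) (tsupport g) μ :=
    h1.mul_continuousOn hg.continuousOn hc
  refine (integrableOn_iff_integrable_of_support_subset ?_).1 h2
  intro x hx
  apply subset_tsupport
  intro h
  exact hx (by simp [h])

lemma integrable_mul_L {Ω : Set E} {u ω : E → ℝ}
    (hu : LocallyIntegrableOn u Ω μ) (hω : ContDiff ℝ (⊤ : ℕ∞) ω) (hc : HasCompactSupport ω)
    (hs : tsupport ω ⊆ Ω) : Integrable (fun x => u x * A.L ω x) μ :=
  integrable_mul_of_locInt hu (L_continuous A (hω.of_le two_le_infty))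
    (hasCompactSupport_L A hc) ((tsupport_L_subset A).trans hs)

variable {A}

lemma DS.add {Ω : Set E} {u v : E → ℝ} (hu : DS μ A Ω u) (hv : DS μ A Ω v) :
    DS μ A Ω (fun x => u x + v x) := by
  refine ⟨hu.1.add hv.1, fun ω h1 h2 h3 h4 => ?_⟩
  simp_rw [add_mul]
  rw [integral_add (integrable_mul_L A hu.1 h1 h2 h3) (integrable_mul_L A hv.1 h1 h2 h3)]
  exact add_nonneg (hu.2 ω h1 h2 h3 h4) (hv.2 ω h1 h2 h3 h4)

lemma DS.const_mul {Ω : Set E} {u : E → ℝ} (hu : DS μ A Ω u) {c : ℝ} (hc : 0 ≤ c) :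
    DS μ A Ω (fun x => c * u x) := by
  refine ⟨hu.1.smul c, fun ω h1 h2 h3 h4 => ?_⟩
  simp_rw [mul_assoc]
  rw [integral_const_mul]
  exact mul_nonneg hc (hu.2 ω h1 h2 h3 h4)

lemma DS.mono_set {Ω Ω' : Set E} {u : E → ℝ} (hu : DS μ A Ω u) (h : Ω' ⊆ Ω) : DS μ A Ω' u :=
  ⟨hu.1.mono_set h, fun ω h1 h2 h3 h4 => hu.2 ω h1 h2 (h3.trans h) h4⟩

lemma DS.congr_ae {Ω : Set E} {u v : E → ℝ} (hu : DS μ A Ω u)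
    (hm : MeasurableSet Ω) (h : ∀ᵐ x ∂μ, x ∈ Ω → u x = v x) : DS μ A Ω v := by
  constructor
  · intro x hx
    obtain ⟨s, hs, hi⟩ := hu.1 x hx
    refine ⟨s ∩ Ω, inter_mem hs self_mem_nhdsWithin, ?_⟩
    refine (hi.mono_set Set.inter_subset_left).congr ?_
    have : ∀ᵐ x ∂(μ.restrict Ω), u x = v x := (ae_restrict_iff' hm).2 h
    exact ae_mono (Measure.restrict_mono Set.inter_subset_right le_rfl) this
  · intro ω h1 h2 h3 h4
    rw [show ∫ x, v x * A.L ω x ∂μ = ∫ x, u x * A.L ω x ∂μ from ?_]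
    · exact hu.2 ω h1 h2 h3 h4
    · apply integral_congr_ae
      filter_upwards [h] with x hx
      by_cases hx' : x ∈ tsupport ω
      · simp only [hx (h3 hx')]
      · simp only [L_eq_zero_of_notMem A hx', mul_zero]

lemma DS.of_C2 {Ω : Set E} {f : E → ℝ} (hf : ContDiff ℝ 2 f) (h : ∀ x ∈ Ω, 0 ≤ A.L f x) :
    DS μ A Ω f := by
  refine ⟨hf.continuous.locallyIntegrable.locallyIntegrableOn _, fun ω h1 h2 h3 h4 => ?_⟩
  rw [selfadj μ A hf (h1.of_le two_le_infty) h2]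
  apply integral_nonneg
  intro x
  by_cases hx' : x ∈ tsupport ω
  · exact mul_nonneg (h4 x) (h x (h3 hx'))
  · simp [image_eq_zero_of_notMem_tsupport hx']

lemma DS.const {Ω : Set E} (c : ℝ) : DS μ A Ω (fun _ => c) := by
  refine DS.of_C2 contDiff_const fun x _ => le_of_eq ?_
  have : ∀ v : E, pd v (fun _ : E => c) = fun _ => 0 := fun v => funext fun x => pd_const v c x
  simp [Ell.L, this, pd_const]

end Meas

end ASub

end



noncomputable section

namespace ASub

set_option linter.unusedSectionVars false

section Calc

variable {ι : Type*} [Fintype ι] {E : Type*} [NormedAddCommGroup E] [NormedSpace ℝ E]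
  [FiniteDimensional ℝ E] [MeasurableSpace E] [BorelSpace E]
  (μ : Measure E) [μ.IsAddHaarMeasure] {e : ι → E} (A : Ell e)

/-- The error field. -/
def Ell.err (A : Ell e) (U : E → ℝ) (Z : ι → E → ℝ) (i : ι) (x : E) : ℝ :=
  (∑ j, A.a i j x * pd (e j) U x) - Z i x

lemma err_continuous {U : E → ℝ} {Z : ι → E → ℝ} (hU : ContDiff ℝ 1 U)
    (hZ : ∀ i, Continuous (Z i)) (i : ι) : Continuous (A.err U Z i) :=
  (continuous_finsetSum _ fun j _ => (A.smooth i j).continuous.mul (pd_continuous hU _)).sub (hZ i)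

lemma quad_bound {lam : ℝ} (hlam : 0 < lam) {d R : ι → ℝ} {Q : ℝ}
    (hQ : lam * ∑ i, d i ^ 2 ≤ Q) :
    0 ≤ Q - ∑ i, d i * R i + (4 * lam)⁻¹ * ∑ i, R i ^ 2 := by
  have : 0 ≤ lam * ∑ i, (d i - (2 * lam)⁻¹ * R i) ^ 2 :=
    mul_nonneg hlam.le (Finset.sum_nonneg fun i _ => sq_nonneg _)
  have h2 : lam * ∑ i, (d i - (2 * lam)⁻¹ * R i) ^ 2
      = lam * ∑ i, d i ^ 2 - ∑ i, d i * R i + (4 * lam)⁻¹ * ∑ i, R i ^ 2 := by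
    simp_rw [Finset.mul_sum, ← Finset.sum_sub_distrib, ← Finset.sum_add_distrib]
    refine Finset.sum_congr rfl fun i _ => ?_
    field_simp
    ring
  linarith

lemma calc_ineq {U V ω : E → ℝ} {ZU ZV : ι → E → ℝ} {h : ℝ → ℝ} {lam : ℝ}
    (hU : ContDiff ℝ 2 U) (hV : ContDiff ℝ 2 V)
    (hZU : ∀ i, ContDiff ℝ 1 (ZU i)) (hZV : ∀ i, ContDiff ℝ 1 (ZV i))
    (hω : ContDiff ℝ 2 ω) (hc : HasCompactSupport ω) (hω0 : ∀ x, 0 ≤ ω x)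
    (hh : ContDiff ℝ 2 h) (h0 : ∀ t, 0 ≤ deriv h t) (h1 : ∀ t, deriv h t ≤ 1)
    (h2 : ∀ t, 0 ≤ deriv (deriv h) t) (hlam : 0 < lam)
    (hell : ∀ x ∈ tsupport ω, ∀ ξ : ι → ℝ, lam * ∑ i, ξ i ^ 2 ≤ ∑ i, ∑ j, A.a i j x * ξ i * ξ j)
    (hdU : ∀ x ∈ tsupport ω, 0 ≤ ∑ i, pd (e i) (ZU i) x)
    (hdV : ∀ x ∈ tsupport ω, 0 ≤ ∑ i, pd (e i) (ZV i) x) :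
    0 ≤ ∫ x, (V x + h (U x - V x)) * A.L ω x ∂μ
      + ∫ x, ∑ i, |pd (e i) ω x| * (|A.err V ZV i x| + |A.err U ZU i x|) ∂μ
      + (4 * lam)⁻¹ * ∫ x, ω x * (deriv (deriv h) (U x - V x)
          * ∑ i, (A.err U ZU i x - A.err V ZV i x) ^ 2) ∂μ := by
  have hU1 : ContDiff ℝ 1 U := hU.of_le (by norm_num)
  have hV1 : ContDiff ℝ 1 V := hV.of_le (by norm_num)
  have hω1 : ContDiff ℝ 1 ω := hω.of_le (by norm_num)
  have hp : ContDiff ℝ 1 (fun x => U x - V x) := hU1.sub hV1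
  have hdh : ContDiff ℝ 1 (deriv h) :=
    ((contDiff_succ_iff_deriv (n := 1)).1 (by simpa [one_add_one_eq_two] using hh)).2.2
  have hddh : Continuous (deriv (deriv h)) := hdh.continuous_deriv (by simp)
  have hF : ContDiff ℝ 1 (fun x => V x + h (U x - V x)) :=
    hV1.add ((hh.of_le (by norm_num)).comp hp)
  have hk : ContDiff ℝ 1 (fun x => deriv h (U x - V x)) := hdh.comp hp
  -- the field
  set Y : ι → E → ℝ := fun i x => ZV i x + deriv h (U x - V x) * (ZU i x - ZV i x) with hY
  have hYs : ∀ i, ContDiff ℝ 1 (Y i) := fun i => (hZV i).add (hk.mul ((hZU i).sub (hZV i)))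
  have hdiv := integral_div_eq_zero (e := e) μ (X := fun i x => ω x * Y i x)
    (fun i => hω1.mul (hYs i)) (fun i => hc.mul_right)
  have hibp := ibp μ A hF hω hc
  have dU : Differentiable ℝ U := hU1.differentiable (by simp)
  have dV : Differentiable ℝ V := hV1.differentiable (by simp)
  have dh : Differentiable ℝ h := hh.differentiable (by simp)
  have ddh : Differentiable ℝ (deriv h) := hdh.differentiable (by simp)
  have pdF : ∀ i x, pd (e i) (fun x => V x + h (U x - V x)) x
      = pd (e i) V x + deriv h (U x - V x) * (pd (e i) U x - pd (e i) V x) := by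
    intro i x
    rw [pd_add (g := fun x => h (U x - V x)) (dV x) ((dh _).comp x ((dU x).sub (dV x))),
      pd_comp (f := fun x => U x - V x) (dh _) ((dU x).sub (dV x)), pd_sub (dU x) (dV x)]
  have pdY : ∀ i x, pd (e i) (fun x => ω x * Y i x) x
      = pd (e i) ω x * Y i x + ω x * (pd (e i) (ZV i) x
        + (deriv (deriv h) (U x - V x) * (pd (e i) U x - pd (e i) V x) * (ZU i x - ZV i x)
        + deriv h (U x - V x) * (pd (e i) (ZU i) x - pd (e i) (ZV i) x))) := by
    intro i x
    have dZU := (hZU i).differentiable (by simp) x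
    have dZV := (hZV i).differentiable (by simp) x
    rw [pd_mul (hω1.differentiable (by simp) x) ((hYs i).differentiable (by simp) x)]
    simp only [hY]
    rw [pd_add (g := fun x => deriv h (U x - V x) * (ZU i x - ZV i x)) dZV
      (((hk.differentiable (by simp)) x).mul (dZU.sub dZV)),
      pd_mul (g := fun x => ZU i x - ZV i x) ((hk.differentiable (by simp)) x) (dZU.sub dZV), pd_sub dZU dZV,
      pd_comp (f := fun x => U x - V x) (ddh _) ((dU x).sub (dV x)), pd_sub (dU x) (dV x)]
  -- continuity and integrability
  have cS : Continuous (fun x => ∑ i, |pd (e i) ω x| * (|A.err V ZV i x| + |A.err U ZU i x|)) :=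
    continuous_finsetSum _ fun i _ => (pd_continuous hω1 _).abs.mul
      ((err_continuous A hV1 (fun i => (hZV i).continuous) i).abs.add
        (err_continuous A hU1 (fun i => (hZU i).continuous) i).abs)
  have cQ : Continuous (fun x => ω x * (deriv (deriv h) (U x - V x)
          * ∑ i, (A.err U ZU i x - A.err V ZV i x) ^ 2)) :=
    hω.continuous.mul ((hddh.comp hp.continuous).mul (continuous_finsetSum _ fun i _ =>
      ((err_continuous A hU1 (fun i => (hZU i).continuous) i).sub
        (err_continuous A hV1 (fun i => (hZV i).continuous) i)).pow 2))
  have iS := cS.integrable_of_hasCompactSupport (μ := μ) (hc.mono' (by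
    intro x hx
    by_contra hn
    exact hx (Finset.sum_eq_zero fun i _ => by rw [pd_eq_zero_of_notMem hn]; simp)))
  have iQ := cQ.integrable_of_hasCompactSupport (μ := μ) hc.mul_right
  have cI : Continuous (fun x => ∑ i, pd (e i) (fun x => V x + h (U x - V x)) x
      * ∑ j, A.a i j x * pd (e j) ω x) :=
    continuous_finsetSum _ fun i _ => (pd_continuous hF _).mul (contDiff_field A hω i).continuous
  have iI := cI.integrable_of_hasCompactSupport (μ := μ) (hc.mono' (by
    intro x hx
    by_contra hn
    refine hx (Finset.sum_eq_zero fun i _ => ?_)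
    rw [Finset.sum_eq_zero (fun j _ => by rw [pd_eq_zero_of_notMem hn, mul_zero]), mul_zero]))
  have cD : Continuous (fun x => ∑ i, pd (e i) (fun x => ω x * Y i x) x) :=
    continuous_finsetSum _ fun i _ => pd_continuous (hω1.mul (hYs i)) _
  have iD := cD.integrable_of_hasCompactSupport (μ := μ) (hc.mono' (by
    intro x hx
    by_contra hn
    refine hx (Finset.sum_eq_zero fun i _ => ?_)
    apply pd_eq_zero_of_notMem
    exact fun h => hn ((tsupport_mul_subset_left (f := ω)) h)))
  have hsum : ∫ x, (V x + h (U x - V x)) * A.L ω x ∂μ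
      + ∫ x, ∑ i, |pd (e i) ω x| * (|A.err V ZV i x| + |A.err U ZU i x|) ∂μ
      + (4 * lam)⁻¹ * ∫ x, ω x * (deriv (deriv h) (U x - V x)
          * ∑ i, (A.err U ZU i x - A.err V ZV i x) ^ 2) ∂μ
      = ∫ x, (((∑ i, pd (e i) (fun x => ω x * Y i x) x) -
        ∑ i, pd (e i) (fun x => V x + h (U x - V x)) x * ∑ j, A.a i j x * pd (e j) ω x)
        + ∑ i, |pd (e i) ω x| * (|A.err V ZV i x| + |A.err U ZU i x|))
        + (4 * lam)⁻¹ * (ω x * (deriv (deriv h) (U x - V x)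
          * ∑ i, (A.err U ZU i x - A.err V ZV i x) ^ 2)) ∂μ := by
    have iDI := iD.sub iI
    simp only [Pi.sub_def] at iDI
    have iDIS := iDI.add iS
    simp only [Pi.add_def] at iDIS
    rw [integral_add iDIS (iQ.const_mul _), integral_add iDI iS,
      integral_sub iD iI, hdiv, hibp, integral_const_mul]
    ring
  rw [hsum]
  apply integral_nonneg
  intro x
  simp only [Pi.zero_apply]
  by_cases hx : x ∈ tsupport ω
  swap
  · have e1 : ∀ v, pd v ω x = 0 := fun v => pd_eq_zero_of_notMem hx v
    have e2 : ω x = 0 := image_eq_zero_of_notMem_tsupport hx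
    simp [pdY, e1, e2]
  -- main pointwise inequality
  have hq := quad_bound hlam (d := fun i => pd (e i) U x - pd (e i) V x)
    (R := fun i => A.err U ZU i x - A.err V ZV i x) (hell x hx _)
  set k := deriv h (U x - V x) with hkdef
  set k2 := deriv (deriv h) (U x - V x) with hk2def
  have hk0 : 0 ≤ k := h0 _
  have hk1 : k ≤ 1 := h1 _
  have hk2 : 0 ≤ k2 := h2 _
  have eI : ∑ i, pd (e i) (fun x => V x + h (U x - V x)) x * ∑ j, A.a i j x * pd (e j) ω x
      = ∑ i, pd (e i) ω x * (Y i x + ((1 - k) * A.err V ZV i x + k * A.err U ZU i x)) := by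
    have : ∀ i, Y i x + ((1 - k) * A.err V ZV i x + k * A.err U ZU i x)
        = ∑ j, A.a i j x * pd (e j) (fun x => V x + h (U x - V x)) x := by
      intro i
      simp only [hY, Ell.err, pdF, ← hkdef]
      have : ∑ j, A.a i j x * (pd (e j) V x + k * (pd (e j) U x - pd (e j) V x))
        = ∑ j, A.a i j x * pd (e j) V x + k * (∑ j, A.a i j x * pd (e j) U x
          - ∑ j, A.a i j x * pd (e j) V x) := by
        rw [← Finset.sum_sub_distrib, Finset.mul_sum, ← Finset.sum_add_distrib]
        exact Finset.sum_congr rfl fun j _ => by ring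
      rw [this]; ring
    simp_rw [this, Finset.mul_sum]
    rw [Finset.sum_comm]
    refine Finset.sum_congr rfl fun i _ => Finset.sum_congr rfl fun j _ => ?_
    rw [A.symm]; ring
  have eD : ∑ i, pd (e i) (fun x => ω x * Y i x) x
      = ∑ i, pd (e i) ω x * Y i x + ω x * ((1 - k) * ∑ i, pd (e i) (ZV i) x
        + k * ∑ i, pd (e i) (ZU i) x
        + k2 * ((∑ i, ∑ j, A.a i j x * (pd (e i) U x - pd (e i) V x)
            * (pd (e j) U x - pd (e j) V x))
          - ∑ i, (pd (e i) U x - pd (e i) V x) * (A.err U ZU i x - A.err V ZV i x))) := by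
    have e3 : ∀ i, (pd (e i) U x - pd (e i) V x) * (ZU i x - ZV i x)
        = (∑ j, A.a i j x * (pd (e i) U x - pd (e i) V x) * (pd (e j) U x - pd (e j) V x))
          - (pd (e i) U x - pd (e i) V x) * (A.err U ZU i x - A.err V ZV i x) := by
      intro i
      have : ∑ j, A.a i j x * (pd (e i) U x - pd (e i) V x) * (pd (e j) U x - pd (e j) V x)
          = (pd (e i) U x - pd (e i) V x) * (∑ j, A.a i j x * pd (e j) U x
          - ∑ j, A.a i j x * pd (e j) V x) := by
        rw [← Finset.sum_sub_distrib, Finset.mul_sum]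
        exact Finset.sum_congr rfl fun j _ => by ring
      rw [this]
      simp only [Ell.err]; ring
    rw [← Finset.sum_sub_distrib]
    simp_rw [← e3]
    simp only [pdY, Finset.mul_sum, ← Finset.sum_add_distrib]
    refine Finset.sum_congr rfl fun i _ => ?_
    ring
  rw [eI, eD]
  have hS : ∑ i, pd (e i) ω x * ((1 - k) * A.err V ZV i x + k * A.err U ZU i x)
      ≤ ∑ i, |pd (e i) ω x| * (|A.err V ZV i x| + |A.err U ZU i x|) := by
    refine Finset.sum_le_sum fun i _ => ?_
    refine (le_abs_self _).trans ?_
    rw [abs_mul]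
    refine mul_le_mul_of_nonneg_left ?_ (abs_nonneg _)
    refine (abs_add_le _ _).trans ?_
    rw [abs_mul, abs_mul, abs_of_nonneg hk0, abs_of_nonneg (by linarith : 0 ≤ 1 - k)]
    have := abs_nonneg (A.err V ZV i x)
    have := abs_nonneg (A.err U ZU i x)
    nlinarith
  simp_rw [mul_add, Finset.sum_add_distrib] at hS ⊢
  have t1 : 0 ≤ ω x * ((1 - k) * ∑ i, pd (e i) (ZV i) x) :=
    mul_nonneg (hω0 x) (mul_nonneg (by linarith) (hdV x hx))
  have t2 : 0 ≤ ω x * (k * ∑ i, pd (e i) (ZU i) x) :=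
    mul_nonneg (hω0 x) (mul_nonneg hk0 (hdU x hx))
  have t3 := mul_nonneg (hω0 x) (mul_nonneg hk2 hq)
  nlinarith [t1, t2, t3, hS]

end Calc

end ASub

end



noncomputable section

namespace ASub

set_option linter.unusedSectionVars false

section Moll

variable {ι : Type*} [Fintype ι] {E : Type*} [NormedAddCommGroup E] [NormedSpace ℝ E]
  [FiniteDimensional ℝ E] [MeasurableSpace E] [BorelSpace E]
  (μ : Measure E) [μ.IsAddHaarMeasure]

/-- Convolution. -/
def cv (f g : E → ℝ) (x : E) : ℝ := ∫ y, f y * g (x - y) ∂μ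

lemma cv_eq_convolution (f g : E → ℝ) :
    cv μ f g = convolution f g (ContinuousLinearMap.mul ℝ ℝ) μ := by
  funext x
  simp [cv, convolution]

lemma cv_contDiff {f g : E → ℝ} (hf : LocallyIntegrable f μ) (hg : ContDiff ℝ (⊤ : ℕ∞) g)
    (hc : HasCompactSupport g) : ContDiff ℝ (⊤ : ℕ∞) (cv μ f g) := by
  rw [cv_eq_convolution]
  exact hc.contDiff_convolution_right _ hf hg

lemma pd_cv {f g : E → ℝ} (hf : LocallyIntegrable f μ) (hg : ContDiff ℝ (⊤ : ℕ∞) g)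
    (hc : HasCompactSupport g) (v : E) : pd v (cv μ f g) = cv μ f (pd v g) := by
  funext x
  have h := hc.hasFDerivAt_convolution_right (ContinuousLinearMap.mul ℝ ℝ) hf
    (hg.of_le one_le_infty) x
  rw [cv_eq_convolution]
  unfold pd
  rw [h.fderiv]
  have hci : ConvolutionExistsAt f (fderiv ℝ g) x
      ((ContinuousLinearMap.mul ℝ ℝ).precompR E) μ :=
    (hc.fderiv ℝ).convolutionExists_right _ hf (hg.continuous_fderiv (by simp)) x
  simp only [convolution]
  rw [ContinuousLinearMap.integral_apply hci]
  simp [cv, pd]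

lemma exists_bound_of_compact {g : E → ℝ} (hg : Continuous g) (hc : HasCompactSupport g) :
    ∃ C, 0 < C ∧ ∀ x, |g x| ≤ C := by
  obtain ⟨C, hC⟩ := hc.exists_bound_of_continuous hg
  exact ⟨max C 1, lt_max_of_lt_right one_pos, fun x => (hC x).trans (le_max_left _ _)⟩

/-- Volume of balls. -/
def vol (s : ℝ) : ℝ := μ.real (closedBall (0 : E) s)

lemma vol_pos {s : ℝ} (hs : 0 < s) : 0 < vol μ s := by
  unfold vol
  exact ENNReal.toReal_pos (measure_closedBall_pos μ 0 hs).ne' measure_closedBall_lt_top.ne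

lemma exists_moll (e : ι → E) : ∃ C : ℝ, 0 < C ∧ ∀ s : ℝ, 0 < s → ∃ φ : E → ℝ,
    ContDiff ℝ (⊤ : ℕ∞) φ ∧ (∀ x, 0 ≤ φ x) ∧ tsupport φ ⊆ closedBall 0 s ∧ ∫ x, φ x ∂μ = 1 ∧
    (∀ x, φ x ≤ C * (vol μ s)⁻¹) ∧ (∀ i x, |pd (e i) φ x| ≤ C * s⁻¹ * (vol μ s)⁻¹) ∧
    (∀ i x, (pd (e i) φ x) ^ 2 ≤ C * s⁻¹ ^ 2 * (vol μ s)⁻¹ * φ x) := by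
  let b : ContDiffBump (0 : E) := ⟨1 / 2, 1, by norm_num, by norm_num⟩
  have hb : ContDiff ℝ (⊤ : ℕ∞) b := b.contDiff
  have hbc : HasCompactSupport b := b.hasCompactSupport
  have hex : ∃ C, 0 < C ∧ ∀ i x, |pd (e i) b x| ≤ C := by
    have : ∀ i, ∃ C, 0 < C ∧ ∀ x, |pd (e i) b x| ≤ C := fun i =>
      exists_bound_of_compact (pd_continuous (hb.of_le one_le_infty) (e i))
        (hasCompactSupport_pd hbc _)
    choose C hC0 hC using this
    refine ⟨1 + ∑ i, C i, by have := Finset.sum_nonneg fun i (_ : i ∈ Finset.univ) => (hC0 i).le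
                             linarith, fun i x => ?_⟩
    have := Finset.single_le_sum (f := C) (fun i _ => (hC0 i).le) (Finset.mem_univ i)
    linarith [hC i x]
  obtain ⟨C0, hC0, hC⟩ := hex
  have hI : 0 < ∫ x, b x ^ 2 ∂μ := by
    have hcont : Continuous fun x => b x ^ 2 := hb.continuous.pow 2
    rw [integral_pos_iff_support_of_nonneg (fun x => sq_nonneg _)
      (hcont.integrable_of_hasCompactSupport (hbc.mono' (by
        intro x hx; apply subset_tsupport; intro h; exact hx (by simp [h]))))]
    refine (measure_ball_pos μ (0 : E) one_pos).trans_le (measure_mono ?_)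
    intro x hx
    have : x ∈ Function.support b := by rw [b.support_eq]; exact hx
    simpa using this
  set I := ∫ x, b x ^ 2 ∂μ with hIdef
  set v1 := vol μ (E := E) 1
  have hv1 : 0 < v1 := vol_pos μ one_pos
  have hle1 : ∀ x, b x ≤ 1 := fun x => b.le_one
  have hge0 : ∀ x, 0 ≤ b x := fun x => b.nonneg
  set c := v1 / I with hc
  have hc0 : 0 < c := div_pos hv1 hI
  refine ⟨c + 2 * c * C0 + 4 * c * C0 ^ 2, by positivity, fun s hs => ?_⟩
  have hvs : vol μ (E := E) s = s ^ Module.finrank ℝ E * v1 := by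
    unfold v1 vol
    rw [Measure.addHaar_real_closedBall' μ _ hs.le]
  have hvs0 := vol_pos μ (E := E) hs
  set κ := (vol μ (E := E) s)⁻¹ with hκ
  have hκ0 : 0 < κ := inv_pos.2 hvs0
  have hs' := inv_pos.2 hs
  set g : E → ℝ := fun x => b (s⁻¹ • x) with hg
  have hgs : ContDiff ℝ (⊤ : ℕ∞) g := hb.comp (contDiff_const_smul _)
  have hpdg : ∀ v x, pd v g x = s⁻¹ * pd v b (s⁻¹ • x) := by
    intro v x
    unfold pd
    rw [hg, fderiv_comp_smul]
    simp
  have hpd : ∀ i x, pd (e i) (fun x => c * κ * (g x * g x)) x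
      = c * κ * (2 * g x * (s⁻¹ * pd (e i) b (s⁻¹ • x))) := by
    intro i x
    have d := hgs.differentiable (by simp) x
    rw [pd_mul (f := fun _ => c * κ) (g := fun x => g x * g x) (by fun_prop) (d.mul d), pd_const,
      pd_mul d d, hpdg]
    ring
  have hA : ∀ i x, |pd (e i) b (s⁻¹ • x)| ≤ C0 := fun i x => hC i _
  refine ⟨fun x => c * κ * (g x * g x), contDiff_const.mul (hgs.mul hgs), fun x => ?_, ?_, ?_,
    fun x => ?_, fun i x => ?_, fun i x => ?_⟩
  · have := hge0 (s⁻¹ • x)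
    positivity
  · apply closure_minimal _ isClosed_closedBall
    intro x hx
    by_contra hn
    apply hx
    have : g x = 0 := by
      simp only [hg]
      apply b.zero_of_le_dist
      simp only [mem_closedBall, dist_zero_right, not_le] at hn ⊢
      rw [norm_smul, Real.norm_of_nonneg hs'.le]
      change 1 ≤ s⁻¹ * ‖x‖
      rw [inv_mul_eq_div, one_le_div hs]
      exact hn.le
    simp [this]
  · rw [integral_const_mul]
    have : ∫ x, g x * g x ∂μ = s ^ Module.finrank ℝ E * I := by
      have := Measure.integral_comp_smul μ (fun x => b x ^ 2) s⁻¹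
      simp only [hg]
      simp_rw [← pow_two]
      rw [this, smul_eq_mul, ← hIdef, abs_of_pos (by positivity)]
      simp
    rw [this, hκ, hvs, hc]
    have : s ^ Module.finrank ℝ E ≠ 0 := by positivity
    field_simp
  · have h1 := hle1 (s⁻¹ • x)
    have h0 := hge0 (s⁻¹ • x)
    have : g x * g x ≤ 1 := by simp only [hg]; nlinarith
    have h2 : c * κ * (g x * g x) ≤ c * κ * 1 := mul_le_mul_of_nonneg_left this (by positivity)
    have : 0 ≤ (2 * c * C0 + 4 * c * C0 ^ 2) * κ := by positivity
    linarith
  · rw [hpd, abs_mul, abs_mul, abs_mul, abs_mul, abs_mul]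
    rw [abs_of_pos hc0, abs_of_pos hκ0, abs_of_pos hs']
    have h1 : |g x| ≤ 1 := by rw [abs_of_nonneg (hge0 _)]; exact hle1 _
    have h2 := hA i x
    have : |(2:ℝ)| * |g x| * (s⁻¹ * |pd (e i) b (s⁻¹ • x)|) ≤ 2 * 1 * (s⁻¹ * C0) := by
      rw [abs_two]; gcongr
    have h3 := mul_le_mul_of_nonneg_left this (by positivity : 0 ≤ c * κ)
    have : 0 ≤ (c + 4 * c * C0 ^ 2) * κ * s⁻¹ := by positivity
    linarith
  · rw [hpd]
    have h2 : pd (e i) b (s⁻¹ • x) ^ 2 ≤ C0 ^ 2 := by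
      rw [← sq_abs]; exact pow_le_pow_left₀ (abs_nonneg _) (hA i x) 2
    have h4 : (c * κ * (2 * g x * (s⁻¹ * pd (e i) b (s⁻¹ • x)))) ^ 2
        = (4 * c * κ * s⁻¹ ^ 2 * (c * κ * (g x * g x))) * pd (e i) b (s⁻¹ • x) ^ 2 := by ring
    have h5 : 0 ≤ c * κ * (g x * g x) := by
      have := hge0 (s⁻¹ • x)
      positivity
    rw [h4]
    have h6 := mul_le_mul_of_nonneg_left h2
      (by positivity : 0 ≤ 4 * c * κ * s⁻¹ ^ 2 * (c * κ * (g x * g x)))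
    have h7 : 0 ≤ (c + 2 * c * C0) * s⁻¹ ^ 2 * κ * (c * κ * (g x * g x)) := by positivity
    linarith

/-- Continuity of translations in `L¹`. -/
lemma tendsto_translation {u : E → ℝ} (hu : Integrable u μ) {ε : ℝ} (hε : 0 < ε) :
    ∃ δ > 0, ∀ w : E, ‖w‖ ≤ δ → ∫ x, |u (x - w) - u x| ∂μ ≤ ε := by
  obtain ⟨g, hgc, hg1, hgcont, hgi⟩ := hu.exists_hasCompactSupport_integral_sub_le
    (show 0 < ε / 3 by positivity)
  obtain ⟨R, hR⟩ := hgc.isCompact.isBounded.subset_closedBall (0 : E)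
  set V := vol μ (E := E) (|R| + 1)
  have hV : 0 < V := vol_pos μ (by positivity)
  have huc := hgc.uniformContinuous_of_continuous hgcont
  obtain ⟨δ, hδ, hd⟩ := Metric.uniformContinuous_iff.1 huc (ε / 3 / V) (by positivity)
  refine ⟨min (δ / 2) 1, by positivity, fun w hw => ?_⟩
  have hw1 : ‖w‖ < δ := by have := hw.trans (min_le_left _ _); linarith
  have hw2 : ‖w‖ ≤ 1 := hw.trans (min_le_right _ _)
  have i1 : Integrable (fun x => |u (x - w) - g (x - w)|) μ :=
    ((hu.sub hgi).comp_sub_right w).abs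
  have i2 : Integrable (fun x => |u x - g x|) μ := (hu.sub hgi).abs
  have i3 : Integrable (fun x => |g (x - w) - g x|) μ := ((hgi.comp_sub_right w).sub hgi).abs
  have e1 : ∫ x, |u (x - w) - g (x - w)| ∂μ = ∫ x, |u x - g x| ∂μ :=
    integral_sub_right_eq_self (fun x => |u x - g x|) w
  have e3 : ∫ x, |g (x - w) - g x| ∂μ ≤ ε / 3 := by
    have : ∫ x, |g (x - w) - g x| ∂μ
        ≤ ∫ x, (closedBall (0 : E) (|R| + 1)).indicator (fun _ => ε / 3 / V) x ∂μ := by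
      apply integral_mono i3
      · rw [integrable_indicator_iff measurableSet_closedBall]
        exact integrableOn_const measure_closedBall_lt_top.ne
      · intro x
        by_cases hx : x ∈ closedBall (0 : E) (|R| + 1)
        · simp only [Set.indicator_of_mem hx]
          have := hd (a := x - w) (b := x) (by simpa [dist_eq_norm] using hw1)
          rw [Real.dist_eq] at this
          exact this.le
        · simp only [Set.indicator_of_notMem hx]
          simp only [mem_closedBall, dist_zero_right, not_le] at hx
          have z1 : g x = 0 := by
            apply image_eq_zero_of_notMem_tsupport
            intro h
            have := hR h
            simp only [mem_closedBall, dist_zero_right] at this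
            linarith [le_abs_self R]
          have z2 : g (x - w) = 0 := by
            apply image_eq_zero_of_notMem_tsupport
            intro h
            have := hR h
            simp only [mem_closedBall, dist_zero_right] at this
            have := norm_sub_norm_le x w
            linarith [le_abs_self R]
          simp [z1, z2]
    refine this.trans (le_of_eq ?_)
    rw [integral_indicator measurableSet_closedBall, setIntegral_const, smul_eq_mul]
    change V * _ = _
    field_simp
  calc ∫ x, |u (x - w) - u x| ∂μ
      ≤ ∫ x, (|u (x - w) - g (x - w)| + |u x - g x|) + |g (x - w) - g x| ∂μ := by
        apply integral_mono ((hu.comp_sub_right w).sub hu).abs ((i1.add i2).add i3)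
        intro x
        simp only [Pi.add_apply]
        have a1 := abs_add_le (u (x - w) - g (x - w) + (g x - u x)) (g (x - w) - g x)
        have a2 := abs_add_le (u (x - w) - g (x - w)) (g x - u x)
        rw [abs_sub_comm (g x) (u x)] at a2
        have a3 : u (x - w) - g (x - w) + (g x - u x) + (g (x - w) - g x) = u (x - w) - u x := by
          ring
        rw [a3] at a1
        simp only [Pi.sub_apply]
        linarith
    _ = ∫ x, |u x - g x| ∂μ + ∫ x, |u x - g x| ∂μ + ∫ x, |g (x - w) - g x| ∂μ := by
        have i12 := i1.add i2
        simp only [Pi.add_def] at i12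
        rw [integral_add i12 i3, integral_add i1 i2, e1]
    _ ≤ ε := by
        simp only [Real.norm_eq_abs] at hg1
        linarith

/-- Averaged oscillation. -/
def osc (u : E → ℝ) (s : ℝ) (x : E) : ℝ :=
  (vol μ (E := E) s)⁻¹ * ∫ y, (closedBall (0 : E) s).indicator 1 y * |u (x - y) - u x| ∂μ

lemma osc_prod_integrable {u : E → ℝ} (hu : Integrable u μ) (s : ℝ) :
    Integrable (fun p : E × E => (closedBall (0 : E) s).indicator 1 p.2 * |u (p.1 - p.2) - u p.1|)
      (μ.prod μ) := by
  have hχ : Integrable ((closedBall (0 : E) s).indicator (1 : E → ℝ)) μ := by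
    rw [integrable_indicator_iff measurableSet_closedBall]
    exact integrableOn_const measure_closedBall_lt_top.ne
  have h1 := Integrable.convolution_integrand (ContinuousLinearMap.mul ℝ ℝ) hχ hu
  have h2 : Integrable (fun p : E × E => u p.1 * (closedBall (0 : E) s).indicator (1 : E → ℝ) p.2)
      (μ.prod μ) := hu.mul_prod hχ
  have h3 := (h1.sub h2).abs
  refine h3.congr (ae_of_all _ fun p => ?_)
  simp only [Pi.sub_apply, ContinuousLinearMap.mul_apply']
  by_cases hp : p.2 ∈ closedBall (0 : E) s
  · simp [Set.indicator_of_mem hp]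
  · simp [Set.indicator_of_notMem hp]

lemma osc_integrable {u : E → ℝ} (hu : Integrable u μ) (s : ℝ) : Integrable (osc μ u s) μ :=
  (osc_prod_integrable μ hu s).integral_prod_left.const_mul _

lemma osc_nonneg (u : E → ℝ) (s : ℝ) (x : E) : 0 ≤ osc μ u s x := by
  apply mul_nonneg (inv_nonneg.2 measureReal_nonneg)
  apply integral_nonneg
  intro y
  exact mul_nonneg (Set.indicator_nonneg (fun _ _ => by simp) _) (abs_nonneg _)

lemma osc_tendsto {u : E → ℝ} (hu : Integrable u μ) :
    Tendsto (fun s => ∫ x, osc μ u s x ∂μ) (𝓝[>] 0) (𝓝 0) := by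
  rw [Metric.tendsto_nhdsWithin_nhds]
  intro ε hε
  obtain ⟨δ, hδ, h⟩ := tendsto_translation μ hu (half_pos hε)
  refine ⟨δ, hδ, fun s hs hsd => ?_⟩
  have hs0 : 0 < s := hs
  have hsd : s ≤ δ := by
    rw [Real.dist_eq, sub_zero, abs_of_pos hs0] at hsd; exact hsd.le
  have h0 : 0 ≤ ∫ x, osc μ u s x ∂μ := integral_nonneg fun x => osc_nonneg μ u s x
  rw [Real.dist_eq, sub_zero, abs_of_nonneg h0]
  refine lt_of_le_of_lt ?_ (half_lt_self hε)
  have hv := vol_pos μ (E := E) hs0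
  unfold osc
  rw [integral_const_mul, integral_integral_swap (f := fun x y =>
    (closedBall (0 : E) s).indicator 1 y * |u (x - y) - u x|) (osc_prod_integrable μ hu s)]
  have : ∫ y, ∫ x, (closedBall (0 : E) s).indicator 1 y * |u (x - y) - u x| ∂μ ∂μ
      ≤ ∫ y, (closedBall (0 : E) s).indicator (fun _ => ε / 2) y ∂μ := by
    apply integral_mono (osc_prod_integrable μ hu s).integral_prod_right
    · rw [integrable_indicator_iff measurableSet_closedBall]
      exact integrableOn_const measure_closedBall_lt_top.ne
    · intro y
      simp only
      by_cases hy : y ∈ closedBall (0 : E) s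
      · simp only [Set.indicator_of_mem hy, Pi.one_apply, one_mul]
        apply h
        simpa using (mem_closedBall_zero_iff.1 hy).trans hsd
      · simp [Set.indicator_of_notMem hy]
  rw [integral_indicator measurableSet_closedBall, setIntegral_const, smul_eq_mul] at this
  change _ ≤ vol μ s * (ε / 2) at this
  rw [inv_mul_le_iff₀ hv]
  exact this

end Moll

end ASub

end



noncomputable section

namespace ASub

set_option linter.unusedSectionVars false

section Err

variable {ι : Type*} [Fintype ι] {E : Type*} [NormedAddCommGroup E] [NormedSpace ℝ E]
  [FiniteDimensional ℝ E] [MeasurableSpace E] [BorelSpace E]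
  (μ : Measure E) [μ.IsAddHaarMeasure] {e : ι → E} (A : Ell e)

lemma pd_comp_sub_left (v : E) (f : E → ℝ) (x y : E) :
    pd v (fun y => f (x - y)) y = - pd v f (x - y) := by
  unfold pd
  by_cases h : DifferentiableAt ℝ f (x - y)
  · have h1 : HasFDerivAt (fun y : E => x - y) (-(ContinuousLinearMap.id ℝ E)) y :=
      (hasFDerivAt_id y).const_sub x
    have := (h.hasFDerivAt.comp y h1).fderiv
    rw [show (fun y => f (x - y)) = f ∘ (fun y => x - y) from rfl, this]
    simp
  · rw [fderiv_zero_of_not_differentiableAt h, fderiv_zero_of_not_differentiableAt]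
    · simp
    · intro h2
      apply h
      have h3 : HasFDerivAt (fun z : E => x - z) (-(ContinuousLinearMap.id ℝ E)) (x - y) :=
        (hasFDerivAt_id _).const_sub x
      have h2' : DifferentiableAt ℝ (fun y => f (x - y)) (x - (x - y)) := by simpa using h2
      have := h2'.comp (x - y) h3.differentiableAt
      simpa [Function.comp_def] using this

lemma cv_integrable {f g : E → ℝ} (hf : LocallyIntegrable f μ) (hg : Continuous g)
    (hc : HasCompactSupport g) (x : E) : Integrable (fun y => f y * g (x - y)) μ := by
  have := hc.convolutionExists_right (ContinuousLinearMap.mul ℝ ℝ) hf hg x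
  simpa [ConvolutionExistsAt] using this

lemma cv_swap (f g : E → ℝ) (x : E) : cv μ f g x = ∫ y, f (x - y) * g y ∂μ := by
  unfold cv
  rw [← integral_sub_left_eq_self (fun y => f y * g (x - y)) μ x]
  simp

lemma cv_integrable' {f g : E → ℝ} (hf : LocallyIntegrable f μ) (hg : Continuous g)
    (hc : HasCompactSupport g) (x : E) : Integrable (fun y => f (x - y) * g y) μ := by
  have := (cv_integrable μ hf hg hc x).comp_sub_left x
  simpa using this

lemma osc_integrand {u : E → ℝ} (hu : Integrable u μ) (s : ℝ) (x : E) :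
    Integrable (fun y => (closedBall (0 : E) s).indicator 1 y * |u (x - y) - u x|) μ := by
  have h1 : IntegrableOn (fun y => |u (x - y) - u x|) (closedBall (0 : E) s) μ :=
    (((hu.comp_sub_left x).integrableOn).sub
      (integrableOn_const measure_closedBall_lt_top.ne)).abs
  have := (integrable_indicator_iff measurableSet_closedBall).2 h1
  refine this.congr (ae_of_all _ fun y => ?_)
  by_cases hy : y ∈ closedBall (0 : E) s
  · simp [Set.indicator_of_mem hy]
  · simp [Set.indicator_of_notMem hy]

lemma abs_integrand {u : E → ℝ} (hu : Integrable u μ) (s : ℝ) (x : E) :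
    Integrable (fun y => |u (x - y)| * (closedBall (0 : E) s).indicator 1 y) μ := by
  have h1 : IntegrableOn (fun y => |u (x - y)|) (closedBall (0 : E) s) μ :=
    ((hu.comp_sub_left x).integrableOn).abs
  have := (integrable_indicator_iff measurableSet_closedBall).2 h1
  refine this.congr (ae_of_all _ fun y => ?_)
  by_cases hy : y ∈ closedBall (0 : E) s
  · simp [Set.indicator_of_mem hy]
  · simp [Set.indicator_of_notMem hy]

lemma osc_bound {u : E → ℝ} (hu : Integrable u μ) {s C : ℝ} {g : E → ℝ} (x : E)
    (hg : ∀ y, |g y| ≤ C * (vol μ (E := E) s)⁻¹ * (closedBall (0 : E) s).indicator 1 y) :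
    |∫ y, (u (x - y) - u x) * g y ∂μ| ≤ C * osc μ u s x := by
  have h := norm_integral_le_of_norm_le
    ((osc_integrand μ hu s x).const_mul (C * (vol μ (E := E) s)⁻¹))
    (f := fun y => (u (x - y) - u x) * g y) (ae_of_all _ fun y => by
      rw [Real.norm_eq_abs, abs_mul]
      calc |u (x - y) - u x| * |g y| ≤ |u (x - y) - u x| * _ :=
            mul_le_mul_of_nonneg_left (hg y) (abs_nonneg _)
        _ = _ := by ring)
  rw [integral_const_mul] at h
  rw [Real.norm_eq_abs] at h
  unfold osc
  linarith

lemma abs_avg_bound {u : E → ℝ} (hu : Integrable u μ) {s : ℝ} (hs : 0 < s) (x : E) :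
    (vol μ (E := E) s)⁻¹ * ∫ y, |u (x - y)| * (closedBall (0 : E) s).indicator 1 y ∂μ
      ≤ osc μ u s x + |u x| := by
  have hv := vol_pos μ (E := E) hs
  have hχ : Integrable ((closedBall (0 : E) s).indicator (1 : E → ℝ)) μ := by
    rw [integrable_indicator_iff measurableSet_closedBall]
    exact integrableOn_const measure_closedBall_lt_top.ne
  have h1 : ∫ y, |u (x - y)| * (closedBall (0 : E) s).indicator 1 y ∂μ
      ≤ ∫ y, (closedBall (0 : E) s).indicator 1 y * |u (x - y) - u x|
        + |u x| * (closedBall (0 : E) s).indicator 1 y ∂μ := by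
    apply integral_mono (abs_integrand μ hu s x) ((osc_integrand μ hu s x).add (hχ.const_mul _))
    intro y
    have : 0 ≤ (closedBall (0 : E) s).indicator (1 : E → ℝ) y :=
      Set.indicator_nonneg (fun _ _ => by simp) _
    have h2 := abs_add_le (u (x - y) - u x) (u x)
    rw [sub_add_cancel] at h2
    simp only [Pi.add_apply]
    nlinarith
  rw [integral_add (osc_integrand μ hu s x) (hχ.const_mul _), integral_const_mul,
    integral_indicator measurableSet_closedBall] at h1
  simp only [Pi.one_apply, setIntegral_const, smul_eq_mul, mul_one] at h1
  change _ ≤ _ + |u x| * vol μ s at h1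
  have := mul_le_mul_of_nonneg_left h1 (inv_nonneg.2 hv.le)
  unfold osc
  rw [mul_add, show (vol μ (E := E) s)⁻¹ * (|u x| * vol μ s) = |u x| by field_simp] at this
  exact this

lemma sq_le_of_forall {B P Q : ℝ} (hB : 0 ≤ B) (hP : 0 ≤ P) (hQ : 0 ≤ Q)
    (h : ∀ t : ℝ, 0 < t → 2 * B * t ≤ t ^ 2 * P + Q) : B ^ 2 ≤ P * Q := by
  have : ∀ t : ℝ, 0 ≤ P * (t * t) + (-2 * B) * t + Q := by
    intro t
    rcases lt_or_ge 0 t with ht | ht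
    · have := h t ht; nlinarith
    · have : 0 ≤ P * (t * t) := mul_nonneg hP (mul_self_nonneg t)
      have : 0 ≤ -2 * B * t := by nlinarith
      linarith
  have := discrim_le_zero this
  unfold discrim at this
  nlinarith

lemma cs_bound {u : E → ℝ} (hu : Integrable u μ) {s : ℝ} {g φ : E → ℝ} {D : ℝ} (hD : 0 ≤ D) (x : E)
    (hφ : Continuous φ) (hφc : HasCompactSupport φ) (hφ0 : ∀ y, 0 ≤ φ y)
    (hgs : ∀ y, g y ^ 2 ≤ D * φ y) (hsupp : ∀ y, y ∉ closedBall (0 : E) s → g y = 0) :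
    (∫ y, u (x - y) * g y ∂μ) ^ 2 ≤ (∫ y, |u (x - y)| * φ y ∂μ)
      * (D * ∫ y, |u (x - y)| * (closedBall (0 : E) s).indicator 1 y ∂μ) := by
  have i1 : Integrable (fun y => |u (x - y)| * φ y) μ :=
    cv_integrable' (f := fun y => |u y|) μ hu.abs.locallyIntegrable hφ hφc x
  have i2 := abs_integrand μ hu s x
  have hP : 0 ≤ ∫ y, |u (x - y)| * φ y ∂μ :=
    integral_nonneg fun y => mul_nonneg (abs_nonneg _) (hφ0 y)
  have hχ0 : ∀ y, 0 ≤ (closedBall (0 : E) s).indicator (1 : E → ℝ) y := fun y =>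
      Set.indicator_nonneg (fun _ _ => by simp) _
  have hQ : 0 ≤ D * ∫ y, |u (x - y)| * (closedBall (0 : E) s).indicator 1 y ∂μ :=
    mul_nonneg hD (integral_nonneg fun y => mul_nonneg (abs_nonneg _) (hχ0 y))
  rw [← sq_abs]
  apply sq_le_of_forall (abs_nonneg _) hP hQ
  intro t ht
  have h3 := norm_integral_le_of_norm_le (f := fun y => u (x - y) * g y)
    ((i1.const_mul (t / 2)).add (i2.const_mul (D / (2 * t)))) (ae_of_all _ fun y => by
      simp only [Pi.add_apply]
      rw [Real.norm_eq_abs, abs_mul]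
      by_cases hy : y ∈ closedBall (0 : E) s
      · simp only [Set.indicator_of_mem hy, Pi.one_apply, mul_one]
        have : |g y| ≤ t / 2 * φ y + D / (2 * t) := by
          have h5 := sq_nonneg (t * φ y - D / t)
          have h6 : |g y| ^ 2 ≤ (t / 2 * φ y + D / (2 * t)) ^ 2 := by
            rw [sq_abs]
            refine (hgs y).trans ?_
            have : (t / 2 * φ y + D / (2 * t)) ^ 2 = D * φ y + (t * φ y - D / t) ^ 2 / 4 := by
              field_simp; ring
            rw [this]; linarith
          exact abs_le_of_sq_le_sq' (by simpa using h6)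
            (by have := hφ0 y; positivity) |>.2
        have := mul_le_mul_of_nonneg_left this (abs_nonneg (u (x - y)))
        linarith
      · simp only [Set.indicator_of_notMem hy, hsupp y hy, abs_zero, mul_zero, add_zero]
        have := hφ0 y
        positivity)
  rw [integral_add' (i1.const_mul _) (i2.const_mul _), integral_const_mul, integral_const_mul,
    Real.norm_eq_abs] at h3
  have h4 := mul_le_mul_of_nonneg_left h3 (by positivity : 0 ≤ 2 * t)
  have h5 : 2 * t * (t / 2 * ∫ y, |u (x - y)| * φ y ∂μ
      + D / (2 * t) * ∫ y, |u (x - y)| * (closedBall (0 : E) s).indicator 1 y ∂μ)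
      = t ^ 2 * (∫ y, |u (x - y)| * φ y ∂μ)
      + D * ∫ y, |u (x - y)| * (closedBall (0 : E) s).indicator 1 y ∂μ := by
    field_simp
  rw [h5] at h4
  linarith

/-- Mollified flux. -/
def flux (A : Ell e) (u φ : E → ℝ) (i : ι) (x : E) : ℝ :=
  ∑ j, cv μ (fun y => A.a i j y * u y) (pd (e j) φ) x

lemma flux_contDiff {u φ : E → ℝ} (hau : ∀ i j, LocallyIntegrable (fun y => A.a i j y * u y) μ)
    (hφ : ContDiff ℝ (⊤ : ℕ∞) φ) (hc : HasCompactSupport φ) (i : ι) :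
    ContDiff ℝ (⊤ : ℕ∞) (flux μ A u φ i) :=
  ContDiff.sum fun j _ => cv_contDiff μ (hau i j) (pd_contDiff_inf hφ _) (hasCompactSupport_pd hc _)

lemma div_flux {u φ : E → ℝ} (hau : ∀ i j, LocallyIntegrable (fun y => A.a i j y * u y) μ)
    (hφ : ContDiff ℝ (⊤ : ℕ∞) φ) (hc : HasCompactSupport φ) (x : E) :
    ∑ i, pd (e i) (flux μ A u φ i) x = ∫ y, u y * A.L (fun y => φ (x - y)) y ∂μ := by
  have h1 : ∀ i, pd (e i) (flux μ A u φ i) x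
      = ∑ j, ∫ y, A.a i j y * u y * pd (e i) (pd (e j) φ) (x - y) ∂μ := by
    intro i
    unfold flux
    rw [pd_sum (f := fun j => cv μ (fun y => A.a i j y * u y) (pd (e j) φ)) _ (fun j _ =>
      (cv_contDiff μ (hau i j) (pd_contDiff_inf hφ _)
        (hasCompactSupport_pd hc _)).differentiable (by simp) x)]
    refine Finset.sum_congr rfl fun j _ => ?_
    rw [pd_cv μ (hau i j) (pd_contDiff_inf hφ _) (hasCompactSupport_pd hc _)]
    rfl
  have h2 : ∀ i j, Integrable (fun y => A.a i j y * u y * pd (e i) (pd (e j) φ) (x - y)) μ :=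
    fun i j => cv_integrable μ (hau i j)
      (pd_contDiff_inf (pd_contDiff_inf hφ _) _).continuous
      (hasCompactSupport_pd (hasCompactSupport_pd hc _) _) x
  simp_rw [h1]
  simp_rw [← integral_finsetSum _ (fun j _ => h2 _ j)]
  rw [← integral_finsetSum _ (fun i _ => integrable_finsetSum _ fun j _ => h2 i j)]
  congr 1
  funext y
  unfold Ell.L
  rw [Finset.mul_sum]
  refine Finset.sum_congr rfl fun i _ => ?_
  rw [Finset.mul_sum]
  refine Finset.sum_congr rfl fun j _ => ?_
  have : pd (e j) (fun y => φ (x - y)) = fun y => - pd (e j) φ (x - y) :=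
    funext fun y => pd_comp_sub_left _ _ _ _
  rw [this, pd_comp_sub_left (e i) (fun z => - pd (e j) φ z) x y]
  have h3 : pd (e i) (fun z => - pd (e j) φ z) (x - y) = - pd (e i) (pd (e j) φ) (x - y) := by
    unfold pd
    rw [fderiv_fun_neg]; simp
  rw [h3]; ring

/-- The commutator kernel. -/
def ker (A : Ell e) (φ : E → ℝ) (i : ι) (x y : E) : ℝ :=
  ∑ j, (A.a i j x - A.a i j (x - y)) * pd (e j) φ y

lemma ker_continuous {φ : E → ℝ} (hφ : ContDiff ℝ (⊤ : ℕ∞) φ) (i : ι) (x : E) :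
    Continuous (ker A φ i x) :=
  continuous_finsetSum _ fun j _ => (continuous_const.sub
    ((A.smooth i j).continuous.comp (continuous_const.sub continuous_id))).mul
    (pd_contDiff_inf hφ _).continuous

lemma ker_compact {φ : E → ℝ} (hc : HasCompactSupport φ) (i : ι) (x : E) :
    HasCompactSupport (ker A φ i x) := by
  apply hc.mono'
  intro y hy
  by_contra h
  exact hy (Finset.sum_eq_zero fun j _ => by rw [pd_eq_zero_of_notMem h, mul_zero])

lemma err_eq {u φ : E → ℝ} (hu : LocallyIntegrable u μ)
    (hau : ∀ i j, LocallyIntegrable (fun y => A.a i j y * u y) μ)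
    (hφ : ContDiff ℝ (⊤ : ℕ∞) φ) (hc : HasCompactSupport φ) (i : ι) (x : E) :
    A.err (cv μ u φ) (flux μ A u φ) i x = ∫ y, u (x - y) * ker A φ i x y ∂μ := by
  unfold Ell.err flux ker
  rw [← Finset.sum_sub_distrib]
  have h1 : ∀ j, A.a i j x * pd (e j) (cv μ u φ) x
      - cv μ (fun y => A.a i j y * u y) (pd (e j) φ) x
      = ∫ y, u (x - y) * ((A.a i j x - A.a i j (x - y)) * pd (e j) φ y) ∂μ := by
    intro j
    rw [pd_cv μ hu hφ hc, cv_swap, cv_swap, ← integral_const_mul, ← integral_sub]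
    · congr 1; funext y; ring
    · exact (cv_integrable' μ hu (pd_contDiff_inf hφ _).continuous
        (hasCompactSupport_pd hc _) x).const_mul _
    · exact cv_integrable' μ (hau i j) (pd_contDiff_inf hφ _).continuous
        (hasCompactSupport_pd hc _) x
  simp_rw [h1, Finset.mul_sum]
  rw [integral_finsetSum]
  intro j _
  refine cv_integrable' (g := fun y => (A.a i j x - A.a i j (x - y)) * pd (e j) φ y) μ hu ?_ ?_ x
  · exact (continuous_const.sub
      ((A.smooth i j).continuous.comp (continuous_const.sub continuous_id))).mul
      (pd_contDiff_inf hφ _).continuous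
  · exact (hasCompactSupport_pd hc _).mul_left

lemma ker_integral {φ : E → ℝ} (hφ : ContDiff ℝ (⊤ : ℕ∞) φ) (hc : HasCompactSupport φ)
    (i : ι) (x : E) : ∫ y, ker A φ i x y ∂μ = 0 := by
  have h0 := integral_div_eq_zero (e := e) μ
    (X := fun j y => (A.a i j x - A.a i j (x - y)) * φ y)
    (fun j => (contDiff_const.sub ((A.smooth i j).comp (contDiff_const.sub contDiff_id))).mul
      (hφ.of_le one_le_infty)) (fun j => hc.mul_left)
  rw [← h0]
  congr 1
  funext y
  unfold ker
  have h1 : ∀ j, pd (e j) (fun y => (A.a i j x - A.a i j (x - y)) * φ y) y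
      = pd (e j) (A.a i j) (x - y) * φ y + (A.a i j x - A.a i j (x - y)) * pd (e j) φ y := by
    intro j
    have d1 : DifferentiableAt ℝ (fun y => A.a i j (x - y)) y :=
      ((A.smooth i j).comp (contDiff_const.sub contDiff_id)).differentiable (by simp) y
    rw [pd_mul (f := fun y => A.a i j x - A.a i j (x - y)) ((differentiableAt_const _).sub d1)
      (hφ.differentiable (by simp) y),
      pd_sub (f := fun _ => A.a i j x) (differentiableAt_const _) d1, pd_const, pd_comp_sub_left]
    ring
  simp_rw [h1]
  rw [Finset.sum_add_distrib, ← Finset.sum_mul]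
  have : ∑ j, pd (e j) (A.a i j) (x - y) = 0 := by
    rw [← A.divfree i (x - y)]
    refine Finset.sum_congr rfl fun j _ => ?_
    rw [show A.a i j = A.a j i from funext fun z => A.symm i j z]
  rw [this]; ring

/-- The error estimates. -/
lemma err_bounds {C0 Λ : ℝ} (hC0 : 0 < C0) (hΛ : 0 ≤ Λ) {s : ℝ} (hs : 0 < s)
    {φ : E → ℝ} (hφ : ContDiff ℝ (⊤ : ℕ∞) φ) (hφ0 : ∀ x, 0 ≤ φ x)
    (hsupp : tsupport φ ⊆ closedBall 0 s) (hint : ∫ x, φ x ∂μ = 1)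
    (hb : ∀ x, φ x ≤ C0 * (vol μ (E := E) s)⁻¹)
    (hb1 : ∀ i x, |pd (e i) φ x| ≤ C0 * s⁻¹ * (vol μ (E := E) s)⁻¹)
    (hb2 : ∀ i x, (pd (e i) φ x) ^ 2 ≤ C0 * s⁻¹ ^ 2 * (vol μ (E := E) s)⁻¹ * φ x)
    {u : E → ℝ} (hu : Integrable u μ)
    (hau : ∀ i j, LocallyIntegrable (fun y => A.a i j y * u y) μ) (x : E)
    (hlip : ∀ i j y, ‖y‖ ≤ s → |A.a i j x - A.a i j (x - y)| ≤ Λ * ‖y‖) :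
    |cv μ u φ x - u x| ≤ C0 * osc μ u s x ∧
    (∀ i, |A.err (cv μ u φ) (flux μ A u φ) i x| ≤ (Fintype.card ι * Λ * C0) * osc μ u s x) ∧
    (∀ i, A.err (cv μ u φ) (flux μ A u φ) i x ^ 2 ≤
      (Fintype.card ι ^ 2 * Λ ^ 2 * C0) * cv μ (fun y => |u y|) φ x * (osc μ u s x + |u x|)) := by
  have hc : HasCompactSupport φ :=
    HasCompactSupport.of_support_subset_isCompact (isCompact_closedBall 0 s)
      (subset_closure.trans hsupp)
  have hv := vol_pos μ (E := E) hs
  have hχ : ∀ y ∉ closedBall (0 : E) s, φ y = 0 ∧ ∀ v, pd v φ y = 0 := fun y hy =>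
    ⟨image_eq_zero_of_notMem_tsupport fun h => hy (hsupp h),
      fun v => pd_eq_zero_of_notMem (fun h => hy (hsupp h)) v⟩
  have huL := hu.locallyIntegrable
  have hker0 : ∀ i y, y ∉ closedBall (0 : E) s → ker A φ i x y = 0 := by
    intro i y hy
    exact Finset.sum_eq_zero fun j _ => by rw [(hχ y hy).2, mul_zero]
  have hsplit : ∀ g : E → ℝ, Continuous g → HasCompactSupport g →
      ∫ y, (u (x - y) - u x) * g y ∂μ = ∫ y, u (x - y) * g y ∂μ - u x * ∫ y, g y ∂μ := by
    intro g hg hgc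
    rw [← integral_const_mul, ← integral_sub (cv_integrable' μ huL hg hgc x)
      ((hg.integrable_of_hasCompactSupport hgc).const_mul _)]
    congr 1; funext y; ring
  refine ⟨?_, fun i => ?_, fun i => ?_⟩
  · have := osc_bound μ hu (s := s) (C := C0) (g := φ) x (fun y => by
      by_cases hy : y ∈ closedBall (0 : E) s
      · simp only [Set.indicator_of_mem hy, Pi.one_apply, mul_one]
        rw [abs_of_nonneg (hφ0 y)]; exact hb y
      · simp [Set.indicator_of_notMem hy, (hχ y hy).1])
    rw [hsplit φ hφ.continuous hc, hint, mul_one, ← cv_swap] at this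
    exact this
  · have := osc_bound μ hu (s := s) (C := Fintype.card ι * Λ * C0) (g := ker A φ i x) x (fun y => by
      by_cases hy : y ∈ closedBall (0 : E) s
      · simp only [Set.indicator_of_mem hy, Pi.one_apply, mul_one]
        have hy' : ‖y‖ ≤ s := mem_closedBall_zero_iff.1 hy
        calc |ker A φ i x y| ≤ ∑ j : ι, |(A.a i j x - A.a i j (x - y)) * pd (e j) φ y| :=
              Finset.abs_sum_le_sum_abs _ _
          _ ≤ ∑ j : ι, Λ * C0 * (vol μ (E := E) s)⁻¹ := by
              refine Finset.sum_le_sum fun j _ => ?_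
              rw [abs_mul]
              calc _ ≤ (Λ * s) * (C0 * s⁻¹ * (vol μ (E := E) s)⁻¹) := by
                    refine mul_le_mul ((hlip i j y hy').trans ?_) (hb1 j y) (abs_nonneg _)
                      (by positivity)
                    exact mul_le_mul_of_nonneg_left hy' hΛ
                _ = _ := by field_simp
          _ = _ := by simp; ring
      · simp [Set.indicator_of_notMem hy, hker0 i y hy])
    rw [hsplit _ (ker_continuous A hφ i x) (ker_compact A hc i x), ker_integral μ A hφ hc,
      mul_zero, sub_zero, ← err_eq μ A huL hau hφ hc] at this
    exact this
  · set D := Fintype.card ι ^ 2 * Λ ^ 2 * C0 * (vol μ (E := E) s)⁻¹ with hD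
    have hD0 : 0 ≤ D := by positivity
    have h1 := cs_bound μ hu (s := s) (g := ker A φ i x) (φ := φ) hD0 x
      hφ.continuous hc hφ0 (fun y => by
        by_cases hy : y ∈ closedBall (0 : E) s
        · have hy' : ‖y‖ ≤ s := mem_closedBall_zero_iff.1 hy
          have h2 : ker A φ i x y ^ 2 ≤ Fintype.card ι *
              ∑ j : ι, ((A.a i j x - A.a i j (x - y)) * pd (e j) φ y) ^ 2 := by
            have := sq_sum_le_card_mul_sum_sq (s := (Finset.univ : Finset ι))
              (f := fun j => (A.a i j x - A.a i j (x - y)) * pd (e j) φ y)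
            simpa [ker] using this
          have h3 : ∀ j : ι, ((A.a i j x - A.a i j (x - y)) * pd (e j) φ y) ^ 2
              ≤ Λ ^ 2 * C0 * (vol μ (E := E) s)⁻¹ * φ y := by
            intro j
            rw [mul_pow]
            have h4 : (A.a i j x - A.a i j (x - y)) ^ 2 ≤ (Λ * s) ^ 2 := by
              rw [← sq_abs]
              refine pow_le_pow_left₀ (abs_nonneg _) ((hlip i j y hy').trans ?_) 2
              exact mul_le_mul_of_nonneg_left hy' hΛ
            calc _ ≤ (Λ * s) ^ 2 * (C0 * s⁻¹ ^ 2 * (vol μ (E := E) s)⁻¹ * φ y) :=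
                  mul_le_mul h4 (hb2 j y) (sq_nonneg _) (sq_nonneg _)
              _ = _ := by field_simp
          have h5 := Finset.sum_le_sum fun j (_ : j ∈ (Finset.univ : Finset ι)) => h3 j
          have h6 := mul_le_mul_of_nonneg_left h5 (Nat.cast_nonneg (α := ℝ) (Fintype.card ι))
          refine h2.trans (h6.trans (le_of_eq ?_))
          simp [hD]; ring
        · rw [hker0 i y hy, (hχ y hy).1]; simp) (hker0 i)
    rw [← err_eq μ A huL hau hφ hc, ← cv_swap μ (fun y => |u y|)] at h1
    refine h1.trans ?_
    have hP : 0 ≤ cv μ (fun y => |u y|) φ x :=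
      integral_nonneg fun y => mul_nonneg (abs_nonneg _) (hφ0 _)
    have h2 := abs_avg_bound μ hu hs x
    have h3 := mul_le_mul_of_nonneg_left h2
      (by positivity : 0 ≤ (Fintype.card ι ^ 2 * Λ ^ 2 * C0) * cv μ (fun y => |u y|) φ x)
    refine le_trans (le_of_eq ?_) h3
    rw [hD]; ring

end Err

end ASub

end



noncomputable section

namespace ASub

set_option linter.unusedSectionVars false

section KatoPrep

lemma exists_h {ρ : ℝ} (hρ : 0 < ρ) : ∃ (h : ℝ → ℝ) (C : ℝ), 0 ≤ C ∧ ContDiff ℝ 2 h ∧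
    (∀ t, 0 ≤ deriv h t) ∧ (∀ t, deriv h t ≤ 1) ∧ (∀ t, 0 ≤ deriv (deriv h) t) ∧
    (∀ t, deriv (deriv h) t ≤ C) ∧ (∀ t, t < 0 ∨ ρ < t → deriv (deriv h) t = 0) ∧
    (∀ t, |h t - max t 0| ≤ ρ) ∧ (∀ a b, |h a - h b| ≤ |a - b|) := by
  set g : ℝ → ℝ := fun t => Real.smoothTransition (t / ρ) with hg
  have hgc : ContDiff ℝ (⊤ : ℕ∞) g := Real.smoothTransition.contDiff.comp (contDiff_id.div_const ρ)
  have hgm : Monotone g := fun a b hab => Real.smoothTransition.monotone (by gcongr)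
  have hg0 : ∀ t, 0 ≤ g t := fun t => Real.smoothTransition.nonneg _
  have hg1 : ∀ t, g t ≤ 1 := fun t => Real.smoothTransition.le_one _
  have hgz : ∀ t, t ≤ 0 → g t = 0 := fun t ht =>
    Real.smoothTransition.zero_of_nonpos (div_nonpos_of_nonpos_of_nonneg ht hρ.le)
  have hgo : ∀ t, ρ ≤ t → g t = 1 := fun t ht =>
    Real.smoothTransition.one_of_one_le ((one_le_div hρ).2 ht)
  set h : ℝ → ℝ := fun t => ∫ τ in (0:ℝ)..t, g τ with hh
  have hd : ∀ t, HasDerivAt h (g t) t := fun t =>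
    intervalIntegral.integral_hasDerivAt_right (hgc.continuous.intervalIntegrable _ _)
      (hgc.continuous.stronglyMeasurableAtFilter _ _) hgc.continuous.continuousAt
  have hdh : deriv h = g := funext fun t => (hd t).deriv
  have hcd : ContDiff ℝ 2 h := by
    rw [show (2 : WithTop ℕ∞) = 1 + 1 from one_add_one_eq_two.symm, contDiff_succ_iff_deriv]
    refine ⟨fun t => (hd t).differentiableAt, by simp, ?_⟩
    rw [hdh]; exact hgc.of_le one_le_infty
  have hdz : ∀ t, t < 0 ∨ ρ < t → deriv g t = 0 := by
    rintro t (ht | ht)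
    · have : g =ᶠ[𝓝 t] fun _ => (0 : ℝ) := by
        filter_upwards [Iio_mem_nhds ht] with x hx using hgz x (le_of_lt hx)
      rw [this.deriv_eq]; simp
    · have : g =ᶠ[𝓝 t] fun _ => (1 : ℝ) := by
        filter_upwards [Ioi_mem_nhds ht] with x hx using hgo x (le_of_lt hx)
      rw [this.deriv_eq]; simp
  obtain ⟨C, hC⟩ := (isCompact_Icc (a := (0:ℝ)) (b := ρ)).exists_bound_of_continuousOn
    ((hgc.continuous_deriv (by simp)).continuousOn)
  have hlip : ∀ a b, |h a - h b| ≤ |a - b| := by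
    intro a b
    have := (convex_univ (𝕜 := ℝ) (E := ℝ)).norm_image_sub_le_of_norm_deriv_le (f := h) (C := 1) (x := b) (y := a)
      (fun x _ => (hd x).differentiableAt) (fun x _ => by
        rw [hdh, Real.norm_eq_abs, abs_of_nonneg (hg0 x)]; exact hg1 x) (Set.mem_univ _) (Set.mem_univ _)
    simpa using this
  refine ⟨h, max C 0, le_max_right _ _, hcd, ?_, ?_, ?_, ?_, ?_, ?_, hlip⟩
  · rw [hdh]; exact hg0
  · rw [hdh]; exact hg1
  · rw [hdh]; exact fun t => hgm.deriv_nonneg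
  · rw [hdh]; intro t
    by_cases ht : t ∈ Set.Icc 0 ρ
    · exact ((le_abs_self _).trans (hC t ht)).trans (le_max_left _ _)
    · rw [hdz t]
      · exact le_max_right _ _
      · simp only [Set.mem_Icc, not_and_or, not_le] at ht; exact ht
  · rw [hdh]; exact hdz
  · have h0 : h 0 = 0 := by simp [hh]
    have hneg : ∀ t, t ≤ 0 → h t = 0 := by
      intro t ht
      simp only [hh]
      rw [intervalIntegral.integral_congr (g := fun _ => (0:ℝ))]
      · simp
      · intro x hx
        rw [Set.uIcc_of_ge ht] at hx
        exact hgz x hx.2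
    have hup : ∀ t, 0 ≤ t → 0 ≤ h t ∧ h t ≤ t := by
      intro t ht
      refine ⟨?_, ?_⟩
      · exact intervalIntegral.integral_nonneg ht fun x _ => hg0 x
      · have := hlip t 0
        rw [h0, sub_zero, sub_zero, abs_of_nonneg ht] at this
        exact (le_abs_self _).trans this
    have hlow : ∀ t, ρ ≤ t → t - ρ ≤ h t := by
      intro t ht
      have h3 : h t = h ρ + ∫ τ in ρ..t, g τ :=
        (intervalIntegral.integral_add_adjacent_intervals (hgc.continuous.intervalIntegrable _ _)
          (hgc.continuous.intervalIntegrable _ _)).symm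
      have h4 : ∫ τ in ρ..t, g τ = t - ρ := by
        rw [intervalIntegral.integral_congr (g := fun _ => (1:ℝ))]
        · simp
        · intro x hx
          rw [Set.uIcc_of_le ht] at hx
          exact hgo x hx.1
      rw [h3, h4]
      have := (hup ρ hρ.le).1
      linarith
    intro t
    rcases le_total t 0 with ht | ht
    · rw [hneg t ht, max_eq_right ht]; simpa using hρ.le
    · rw [max_eq_left ht, abs_le]
      obtain ⟨q1, q2⟩ := hup t ht
      refine ⟨?_, by linarith⟩
      rcases le_total ρ t with h5 | h5
      · have := hlow t h5; linarith
      · linarith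

variable {ι : Type*} [Fintype ι] {E : Type*} [NormedAddCommGroup E] [NormedSpace ℝ E]
  [FiniteDimensional ℝ E] [MeasurableSpace E] [BorelSpace E]
  (μ : Measure E) [μ.IsAddHaarMeasure] {e : ι → E} (A : Ell e)

lemma exists_ellip {K : Set E} (hK : IsCompact K) : ∃ lam : ℝ, 0 < lam ∧ ∀ x ∈ K, ∀ ξ : ι → ℝ,
    lam * ∑ i, ξ i ^ 2 ≤ ∑ i, ∑ j, A.a i j x * ξ i * ξ j := by
  set S : Set (ι → ℝ) := {ξ | ∑ i, ξ i ^ 2 = 1} with hS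
  have hSc : IsCompact S := by
    apply Metric.isCompact_of_isClosed_isBounded
    · exact isClosed_eq (by fun_prop) continuous_const
    · refine (Metric.isBounded_closedBall (x := (0 : ι → ℝ)) (r := 1)).subset fun ξ hξ => ?_
      rw [mem_closedBall_zero_iff, pi_norm_le_iff_of_nonneg zero_le_one]
      intro i
      have h1 : ξ i ^ 2 ≤ ∑ i, ξ i ^ 2 :=
        Finset.single_le_sum (f := fun i => ξ i ^ 2) (fun i _ => sq_nonneg _) (Finset.mem_univ i)
      have : ∑ i, ξ i ^ 2 = 1 := hξ
      rw [Real.norm_eq_abs, abs_le_one_iff_mul_self_le_one]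
      nlinarith
  have hcont : Continuous fun p : E × (ι → ℝ) => ∑ i, ∑ j, A.a i j p.1 * p.2 i * p.2 j := by
    refine continuous_finsetSum _ fun i _ => continuous_finsetSum _ fun j _ => ?_
    have := (A.smooth i j).continuous
    fun_prop
  have key : ∃ lam : ℝ, 0 < lam ∧ ∀ x ∈ K, ∀ ξ ∈ S, lam ≤ ∑ i, ∑ j, A.a i j x * ξ i * ξ j := by
    rcases (K ×ˢ S).eq_empty_or_nonempty with he | hne
    · refine ⟨1, one_pos, fun x hx ξ hξ => ?_⟩
      have : (x, ξ) ∈ K ×ˢ S := ⟨hx, hξ⟩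
      rw [he] at this; exact this.elim
    · obtain ⟨p, hp, hmin⟩ := (hK.prod hSc).exists_isMinOn hne hcont.continuousOn
      refine ⟨_, A.pos p.1 p.2 ?_, fun x hx ξ hξ => hmin (show (x, ξ) ∈ K ×ˢ S from ⟨hx, hξ⟩)⟩
      intro h0
      have : ∑ i, p.2 i ^ 2 = 1 := hp.2
      rw [h0] at this; simp at this
  obtain ⟨lam, hl, H⟩ := key
  refine ⟨lam, hl, fun x hx ξ => ?_⟩
  by_cases h0 : ∑ i, ξ i ^ 2 = 0
  · have : ξ = 0 := by
      funext i
      have := (Finset.sum_eq_zero_iff_of_nonneg (fun i _ => sq_nonneg (ξ i))).1 h0 i (Finset.mem_univ i)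
      simpa using this
    simp [this]
  · have hpos : 0 < ∑ i, ξ i ^ 2 := lt_of_le_of_ne (Finset.sum_nonneg fun i _ => sq_nonneg _) (Ne.symm h0)
    set r := Real.sqrt (∑ i, ξ i ^ 2) with hr
    have hr0 : 0 < r := Real.sqrt_pos.2 hpos
    have hr2 : r ^ 2 = ∑ i, ξ i ^ 2 := Real.sq_sqrt hpos.le
    have h1 := H x hx (fun i => ξ i / r) (by
      simp only [hS, Set.mem_setOf_eq, div_pow, ← Finset.sum_div, ← hr2]
      field_simp)
    have h2 : ∑ i, ∑ j, A.a i j x * (ξ i / r) * (ξ j / r)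
        = (∑ i, ∑ j, A.a i j x * ξ i * ξ j) / r ^ 2 := by
      rw [Finset.sum_div]
      refine Finset.sum_congr rfl fun i _ => ?_
      rw [Finset.sum_div]
      refine Finset.sum_congr rfl fun j _ => ?_
      field_simp
    rw [h2, le_div_iff₀ (by positivity), hr2] at h1
    exact h1

lemma exists_lip {K : Set E} (hK : IsCompact K) : ∃ Λ : ℝ, 0 ≤ Λ ∧ ∀ x ∈ K, ∀ i j y, ‖y‖ ≤ 1 →
    |A.a i j x - A.a i j (x - y)| ≤ Λ * ‖y‖ := by
  obtain ⟨R, hR⟩ := hK.isBounded.subset_closedBall (0 : E)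
  have h1 : ∀ i j, ∃ C : ℝ, ∀ x ∈ closedBall (0:E) (R + 1), ‖fderiv ℝ (A.a i j) x‖ ≤ C := fun i j =>
    (isCompact_closedBall (0:E) (R+1)).exists_bound_of_continuousOn
      (((A.smooth i j).continuous_fderiv (by simp)).continuousOn)
  choose C hC using h1
  refine ⟨∑ i, ∑ j, |C i j|, Finset.sum_nonneg fun i _ => Finset.sum_nonneg fun j _ => abs_nonneg _,
    fun x hx i j y hy => ?_⟩
  have hx' := hR hx
  rw [mem_closedBall_zero_iff] at hx'
  have h2 := (convex_closedBall (0:E) (R+1)).norm_image_sub_le_of_norm_fderiv_le (𝕜 := ℝ)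
    (f := A.a i j) (C := C i j) (x := x - y) (y := x)
    (fun x _ => (A.smooth i j).differentiable (by simp) x) (hC i j)
    (by rw [mem_closedBall_zero_iff]; exact (norm_sub_le _ _).trans (by linarith))
    (by rw [mem_closedBall_zero_iff]; linarith)
  rw [sub_sub_cancel, Real.norm_eq_abs] at h2
  refine h2.trans (mul_le_mul_of_nonneg_right ?_ (norm_nonneg _))
  refine (le_abs_self _).trans ?_
  refine le_trans ?_ (Finset.single_le_sum (f := fun i => ∑ j, |C i j|)
    (fun i _ => Finset.sum_nonneg fun j _ => abs_nonneg _) (Finset.mem_univ i))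
  exact Finset.single_le_sum (f := fun j => |C i j|) (fun j _ => abs_nonneg _) (Finset.mem_univ j)

/-- the quadratic error density -/
def mq (w : E → ℝ) (s : ℝ) (x : E) : ℝ := min (osc μ w s x ^ 2) (osc μ w s x + |w x|)

lemma mq_nonneg (w : E → ℝ) (s : ℝ) (x : E) : 0 ≤ mq μ w s x :=
  le_min (sq_nonneg _) (add_nonneg (osc_nonneg μ w s x) (abs_nonneg _))

lemma mq_integrable {w : E → ℝ} (hw : Integrable w μ) (s : ℝ) : Integrable (mq μ w s) μ := by
  have h1 : Integrable (fun x => osc μ w s x + |w x|) μ := (osc_integrable μ hw s).add hw.abs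
  refine h1.mono' ?_ (ae_of_all _ fun x => ?_)
  · exact (((osc_integrable μ hw s).aestronglyMeasurable).pow 2).inf h1.aestronglyMeasurable
  · rw [Real.norm_eq_abs, abs_of_nonneg (mq_nonneg μ w s x)]
    exact min_le_right _ _

lemma tail_tendsto {w : E → ℝ} (hw : Integrable w μ) :
    Tendsto (fun n : ℕ => ∫ x, max (|w x| - n) 0 ∂μ) atTop (𝓝 0) := by
  have := tendsto_integral_of_dominated_convergence (μ := μ) (F := fun (n : ℕ) x => max (|w x| - n) 0)
    (f := fun _ => (0:ℝ)) (fun x => |w x|)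
    (fun n => (hw.abs.aestronglyMeasurable.sub aestronglyMeasurable_const).sup aestronglyMeasurable_const)
    hw.abs (fun n => ae_of_all _ fun x => ?_) (ae_of_all _ fun x => ?_)
  · simpa using this
  · rw [Real.norm_eq_abs, abs_of_nonneg (le_max_right _ _)]
    exact max_le (by have : (0:ℝ) ≤ n := Nat.cast_nonneg n
                     linarith) (abs_nonneg _)
  · obtain ⟨N, hN⟩ := exists_nat_ge |w x|
    apply tendsto_const_nhds.congr'
    filter_upwards [eventually_ge_atTop N] with n hn
    have : (N:ℝ) ≤ n := by exact_mod_cast hn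
    rw [max_eq_right]; linarith

lemma mq_tendsto {w : E → ℝ} (hw : Integrable w μ) :
    Tendsto (fun s => ∫ x, mq μ w s x ∂μ) (𝓝[>] 0) (𝓝 0) := by
  have hb : ∀ (n : ℕ) s, ∫ x, mq μ w s x ∂μ ≤ (2 + n) * ∫ x, osc μ w s x ∂μ + ∫ x, max (|w x| - n) 0 ∂μ := by
    intro n s
    have i2 : Integrable (fun x => max (|w x| - (n:ℝ)) 0) μ := by
      refine hw.abs.mono' ((hw.abs.aestronglyMeasurable.sub aestronglyMeasurable_const).sup
        aestronglyMeasurable_const) (ae_of_all _ fun x => ?_)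
      change ‖max (|w x| - (n:ℝ)) 0‖ ≤ _
      rw [Real.norm_eq_abs, abs_of_nonneg (le_max_right _ _)]
      exact max_le (by have : (0:ℝ) ≤ n := Nat.cast_nonneg n
                       linarith) (abs_nonneg _)
    have i1 : Integrable (fun x => (2 + (n:ℝ)) * osc μ w s x) μ := (osc_integrable μ hw s).const_mul _
    rw [← integral_const_mul, ← integral_add i1 i2]
    refine integral_mono (mq_integrable μ hw s) (i1.add i2) fun x => ?_
    simp only [Pi.add_apply]
    have h0 := osc_nonneg μ w s x
    have h1 := le_max_left (|w x| - (n:ℝ)) 0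
    have h2 := le_max_right (|w x| - (n:ℝ)) 0
    have hn : (0:ℝ) ≤ n := Nat.cast_nonneg n
    unfold mq
    set a := osc μ w s x
    rcases le_total a 1 with ha | ha
    · refine (min_le_left _ _).trans ?_
      nlinarith [mul_nonneg hn h0]
    · refine (min_le_right _ _).trans ?_
      nlinarith
  rw [Metric.tendsto_nhds]
  intro ε hε
  obtain ⟨n, hn⟩ := ((tail_tendsto μ hw).eventually (gt_mem_nhds (half_pos hε))).exists
  have h1 := (osc_tendsto μ hw).const_mul (2 + (n:ℝ))
  rw [mul_zero] at h1
  filter_upwards [h1.eventually (gt_mem_nhds (half_pos hε))] with s hs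
  rw [Real.dist_eq, sub_zero, abs_of_nonneg (integral_nonneg fun x => mq_nonneg μ w s x)]
  linarith [hb n s]

end KatoPrep

end ASub

end



noncomputable section

namespace ASub

set_option linter.unusedSectionVars false

section Kato

variable {ι : Type*} [Fintype ι] {E : Type*} [NormedAddCommGroup E] [NormedSpace ℝ E]
  [FiniteDimensional ℝ E] [MeasurableSpace E] [BorelSpace E]
  (μ : Measure E) [μ.IsAddHaarMeasure] {e : ι → E} (A : Ell e)

lemma cv_nonpos {u φ : E → ℝ} (hu0 : ∀ x, u x ≤ 0) (hφ0 : ∀ x, 0 ≤ φ x) (x : E) :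
    cv μ u φ x ≤ 0 :=
  integral_nonpos fun y => mul_nonpos_of_nonpos_of_nonneg (hu0 y) (hφ0 _)

lemma cv_abs {u φ : E → ℝ} (hu0 : ∀ x, u x ≤ 0) (x : E) :
    cv μ (fun y => |u y|) φ x = - cv μ u φ x := by
  unfold cv
  rw [← integral_neg]
  congr 1; funext y
  simp only [abs_of_nonpos (hu0 y)]; ring

lemma cv_ge {v φ : E → ℝ} {M : ℝ} (hv : Integrable v μ) (hM : ∀ x, -M ≤ v x)
    (hφ : ContDiff ℝ (⊤ : ℕ∞) φ) (hc : HasCompactSupport φ) (hφ0 : ∀ x, 0 ≤ φ x)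
    (hint : ∫ x, φ x ∂μ = 1) (x : E) : -M ≤ cv μ v φ x := by
  rw [cv_swap]
  have h1 : Integrable φ μ := hφ.continuous.integrable_of_hasCompactSupport hc
  have : -M = ∫ y, -M * φ y ∂μ := by rw [integral_const_mul, hint, mul_one]
  rw [this]
  exact integral_mono (h1.const_mul _) (cv_integrable' μ hv.locallyIntegrable hφ.continuous hc x)
    fun y => mul_le_mul_of_nonneg_right (hM _) (hφ0 y)

set_option maxHeartbeats 1000000 in
lemma kato_core {u v ω : E → ℝ} {M δ ρ : ℝ} (hu : Integrable u μ) (hv : Integrable v μ)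
    (hau : ∀ i j, LocallyIntegrable (fun y => A.a i j y * u y) μ)
    (hav : ∀ i j, LocallyIntegrable (fun y => A.a i j y * v y) μ)
    (hu0 : ∀ x, u x ≤ 0) (hv0 : ∀ x, v x ≤ 0) (hM : ∀ x, -M ≤ v x)
    (hω : ContDiff ℝ (⊤ : ℕ∞) ω) (hc : HasCompactSupport ω) (hω0 : ∀ x, 0 ≤ ω x)
    (hδ : 0 < δ) (hδ1 : δ ≤ 1)
    (hdu : ∀ x ∈ tsupport ω, ∀ φ : E → ℝ, ContDiff ℝ (⊤ : ℕ∞) φ → (∀ x, 0 ≤ φ x) →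
      tsupport φ ⊆ closedBall 0 δ → 0 ≤ ∫ y, u y * A.L (fun y => φ (x - y)) y ∂μ)
    (hdv : ∀ x ∈ tsupport ω, ∀ φ : E → ℝ, ContDiff ℝ (⊤ : ℕ∞) φ → (∀ x, 0 ≤ φ x) →
      tsupport φ ⊆ closedBall 0 δ → 0 ≤ ∫ y, v y * A.L (fun y => φ (x - y)) y ∂μ)
    {h : ℝ → ℝ} {Ch : ℝ} (hCh : 0 ≤ Ch) (hh : ContDiff ℝ 2 h) (h0 : ∀ t, 0 ≤ deriv h t)
    (h1 : ∀ t, deriv h t ≤ 1) (h2 : ∀ t, 0 ≤ deriv (deriv h) t) (h3 : ∀ t, deriv (deriv h) t ≤ Ch)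
    (h4 : ∀ t, t < 0 ∨ ρ < t → deriv (deriv h) t = 0)
    (h5 : ∀ a b, |h a - h b| ≤ |a - b|) :
    0 ≤ ∫ x, (v x + h (u x - v x)) * A.L ω x ∂μ := by
  have hM0 : 0 ≤ M := by have := hM 0; have := hv0 0; linarith
  obtain ⟨lam, hlam, hell⟩ := exists_ellip A (K := tsupport ω) hc
  obtain ⟨Λ, hΛ, hlip⟩ := exists_lip A (K := tsupport ω) hc
  obtain ⟨C0, hC0, hmoll⟩ := exists_moll μ e
  have hω2 := hω.of_le two_le_infty
  obtain ⟨CL, hCL, hCLb⟩ := exists_bound_of_compact (L_continuous A hω2) (hasCompactSupport_L A hc)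
  obtain ⟨Cω, hCω, hCωb⟩ := exists_bound_of_compact hω.continuous hc
  have hex : ∃ Cd : ℝ, 0 < Cd ∧ ∀ i x, |pd (e i) ω x| ≤ Cd := by
    have : ∀ i, ∃ C, 0 < C ∧ ∀ x, |pd (e i) ω x| ≤ C := fun i =>
      exists_bound_of_compact (pd_continuous (hω.of_le one_le_infty) (e i)) (hasCompactSupport_pd hc _)
    choose C hC0 hC using this
    refine ⟨1 + ∑ i, C i, by
      have := Finset.sum_nonneg (fun i (_ : i ∈ Finset.univ) => (hC0 i).le)
      linarith, fun i x => (hC i x).trans ?_⟩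
    have := Finset.single_le_sum (fun i _ => (hC0 i).le) (Finset.mem_univ i)
    linarith
  obtain ⟨Cd, hCd, hCdb⟩ := hex
  set N : ℝ := (Fintype.card ι : ℝ) with hN
  have hN0 : 0 ≤ N := Nat.cast_nonneg _
  set c1 : ℝ := N * Λ * C0 with hc1
  have hc10 : 0 ≤ c1 := by positivity
  set c2 : ℝ := N ^ 2 * Λ ^ 2 * C0 * M with hc2
  have hc20 : 0 ≤ c2 := by positivity
  set c3 : ℝ := c1 ^ 2 + c2 with hc3
  have hc30 : 0 ≤ c3 := by positivity
  -- integrability of the limit integrand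
  set F0 : E → ℝ := fun x => v x + h (u x - v x) with hF0
  have hF0i : LocallyIntegrable F0 μ := by
    apply hv.locallyIntegrable.add
    have e1 : LocallyIntegrable (fun x => |u x - v x| + |h 0|) μ :=
      ((hu.sub hv).abs.locallyIntegrable).add (locallyIntegrable_const _)
    refine e1.mono (hh.continuous.comp_aestronglyMeasurable
      (hu.sub hv).aestronglyMeasurable) (ae_of_all _ fun x => ?_)
    have q1 := h5 (u x - v x) 0
    have q2 := abs_sub_abs_le_abs_sub (h (u x - v x)) (h 0)
    rw [Real.norm_eq_abs, Real.norm_eq_abs]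
    refine le_trans ?_ (le_abs_self _)
    rw [sub_zero] at q1
    linarith
  have hF0L : Integrable (fun x => F0 x * A.L ω x) μ :=
    integrable_mul_of_locInt (hF0i.locallyIntegrableOn Set.univ) (L_continuous A hω2)
      (hasCompactSupport_L A hc) (Set.subset_univ _)
  -- main estimate
  have main : ∀ s : ℝ, 0 < s → s ≤ δ → 0 ≤ ∫ x, F0 x * A.L ω x ∂μ
      + (CL * 2 * C0 + N * Cd * c1) * (∫ x, osc μ u s x ∂μ + ∫ x, osc μ v s x ∂μ)
      + ((4 * lam)⁻¹ * (Cω * Ch * (2 * N * c3))) * (∫ x, mq μ u s x ∂μ + ∫ x, mq μ v s x ∂μ) := by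
    intro s hs hsδ
    obtain ⟨φ, hφ, hφ0, hsupp, hint, hb, hb1, hb2⟩ := hmoll s hs
    have hcφ : HasCompactSupport φ :=
      HasCompactSupport.of_support_subset_isCompact (isCompact_closedBall 0 s)
        (subset_closure.trans hsupp)
    have hsup' : tsupport φ ⊆ closedBall 0 δ := hsupp.trans (closedBall_subset_closedBall hsδ)
    have hU := cv_contDiff μ hu.locallyIntegrable hφ hcφ
    have hV := cv_contDiff μ hv.locallyIntegrable hφ hcφ
    have hZU := flux_contDiff μ A hau hφ hcφ
    have hZV := flux_contDiff μ A hav hφ hcφ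
    have EU : ∀ x ∈ tsupport ω, _ := fun x hx => err_bounds μ A hC0 hΛ hs hφ hφ0 hsupp hint hb hb1 hb2 hu hau x
      (fun i j y hy => hlip x hx i j y (hy.trans (hsδ.trans hδ1)))
    have EV : ∀ x ∈ tsupport ω, _ := fun x hx => err_bounds μ A hC0 hΛ hs hφ hφ0 hsupp hint hb hb1 hb2 hv hav x
      (fun i j y hy => hlip x hx i j y (hy.trans (hsδ.trans hδ1)))
    have key := calc_ineq μ A (hU.of_le two_le_infty) (hV.of_le two_le_infty)
      (fun i => (hZU i).of_le one_le_infty) (fun i => (hZV i).of_le one_le_infty) hω2 hc hω0 hh h0 h1 h2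
      hlam hell (fun x hx => by rw [div_flux μ A hau hφ hcφ]; exact hdu x hx φ hφ hφ0 hsup')
      (fun x hx => by rw [div_flux μ A hav hφ hcφ]; exact hdv x hx φ hφ hφ0 hsup')
    set U := cv μ u φ with hUdef
    set V := cv μ v φ with hVdef
    set ZU := flux μ A u φ
    set ZV := flux μ A v φ
    have ou := osc_integrable μ hu s
    have ov := osc_integrable μ hv s
    have mu := mq_integrable μ hu s
    have mv := mq_integrable μ hv s
    -- first term
    have T1 : ∫ x, (V x + h (U x - V x)) * A.L ω x ∂μ ≤ ∫ x, F0 x * A.L ω x ∂μ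
        + (CL * 2 * C0) * (∫ x, osc μ u s x ∂μ + ∫ x, osc μ v s x ∂μ) := by
      have iF : Integrable (fun x => (V x + h (U x - V x)) * A.L ω x) μ := by
        have cc : Continuous (fun x => V x + h (U x - V x)) :=
          hV.continuous.add (hh.continuous.comp (hU.continuous.sub hV.continuous))
        exact integrable_mul_of_locInt (cc.locallyIntegrable.locallyIntegrableOn Set.univ)
          (L_continuous A hω2) (hasCompactSupport_L A hc) (Set.subset_univ _)
      have i3 : Integrable (fun x => (CL * 2 * C0) * (osc μ u s x + osc μ v s x)) μ := (ou.add ov).const_mul _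
      rw [← integral_add ou ov, ← integral_const_mul, ← integral_add hF0L i3]
      refine integral_mono iF (hF0L.add i3) fun x => ?_
      simp only [Pi.add_apply]
      have p1 := osc_nonneg μ u s x
      have p2 := osc_nonneg μ v s x
      by_cases hx : x ∈ tsupport ω
      · have a1 := (EU x hx).1
        have a2 := (EV x hx).1
        have a3 := h5 (U x - V x) (u x - v x)
        have a4 : |(V x + h (U x - V x)) - F0 x| ≤ 2 * C0 * (osc μ u s x + osc μ v s x) := by
          have b1 : (V x + h (U x - V x)) - F0 x = (V x - v x) + (h (U x - V x) - h (u x - v x)) := by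
            simp only [hF0]; ring
          have b2 : |U x - V x - (u x - v x)| ≤ |U x - u x| + |V x - v x| := by
            rw [show U x - V x - (u x - v x) = (U x - u x) - (V x - v x) by ring]
            exact abs_sub _ _
          rw [b1]
          refine (abs_add_le _ _).trans ?_
          have : 0 ≤ C0 * osc μ u s x := by positivity
          linarith
        have a5 : ((V x + h (U x - V x)) - F0 x) * A.L ω x
            ≤ (2 * C0 * (osc μ u s x + osc μ v s x)) * CL := by
          refine (le_abs_self _).trans ?_
          rw [abs_mul]
          exact mul_le_mul a4 (hCLb x) (abs_nonneg _) ((abs_nonneg _).trans a4)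
        linarith
      · rw [L_eq_zero_of_notMem A hx, mul_zero, mul_zero, zero_add]
        positivity
    have T2 : ∫ x, ∑ i, |pd (e i) ω x| * (|A.err V ZV i x| + |A.err U ZU i x|) ∂μ
        ≤ (N * Cd * c1) * (∫ x, osc μ u s x ∂μ + ∫ x, osc μ v s x ∂μ) := by
      rw [← integral_add ou ov, ← integral_const_mul]
      refine integral_mono_of_nonneg (ae_of_all _ fun x => Finset.sum_nonneg fun i _ => by positivity)
        ((ou.add ov).const_mul _) (ae_of_all _ fun x => ?_)
      have p1 := osc_nonneg μ u s x
      have p2 := osc_nonneg μ v s x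
      simp only [Pi.add_apply]
      by_cases hx : x ∈ tsupport ω
      · have : ∀ i ∈ (Finset.univ : Finset ι), |pd (e i) ω x| * (|A.err V ZV i x| + |A.err U ZU i x|)
            ≤ Cd * (c1 * (osc μ u s x + osc μ v s x)) := by
          intro i _
          have a1 := (EU x hx).2.1 i
          have a2 := (EV x hx).2.1 i
          refine mul_le_mul (hCdb i x) ?_ (by positivity) hCd.le
          linarith
        refine (Finset.sum_le_card_nsmul _ _ _ this).trans (le_of_eq ?_)
        rw [nsmul_eq_mul, Finset.card_univ, ← hN]; ring
      · rw [Finset.sum_eq_zero fun i _ => by rw [pd_eq_zero_of_notMem hx, abs_zero, zero_mul]]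
        positivity
    have T3 : ∫ x, ω x * (deriv (deriv h) (U x - V x)
          * ∑ i, (A.err U ZU i x - A.err V ZV i x) ^ 2) ∂μ
        ≤ (Cω * Ch * (2 * N * c3)) * (∫ x, mq μ u s x ∂μ + ∫ x, mq μ v s x ∂μ) := by
      rw [← integral_add mu mv, ← integral_const_mul]
      refine integral_mono_of_nonneg (ae_of_all _ fun x => mul_nonneg (hω0 x) (mul_nonneg (h2 _)
        (Finset.sum_nonneg fun i _ => sq_nonneg _)))
        ((mu.add mv).const_mul _) (ae_of_all _ fun x => ?_)
      have p1 := mq_nonneg μ u s x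
      have p2 := mq_nonneg μ v s x
      have r1 := osc_nonneg μ u s x
      have r2 := osc_nonneg μ v s x
      simp only [Pi.add_apply]
      have hz : 0 ≤ Cω * Ch * (2 * N * c3) * (mq μ u s x + mq μ v s x) := by positivity
      by_cases hx : x ∈ tsupport ω
      swap
      · rw [image_eq_zero_of_notMem_tsupport hx, zero_mul]; exact hz
      by_cases hd : deriv (deriv h) (U x - V x) = 0
      · rw [hd, zero_mul, mul_zero]; exact hz
      have hUV : 0 ≤ U x - V x := by
        by_contra hlt
        exact hd (h4 _ (Or.inl (not_le.1 hlt)))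
      have hVM : -M ≤ V x := cv_ge μ hv hM hφ hcφ hφ0 hint x
      have hU0 : U x ≤ 0 := cv_nonpos μ hu0 hφ0 x
      have gen : ∀ (w : E → ℝ) (i : ι) (er W : ℝ), |er| ≤ c1 * osc μ w s x →
          er ^ 2 ≤ (N ^ 2 * Λ ^ 2 * C0) * W * (osc μ w s x + |w x|) → W ≤ M →
          er ^ 2 ≤ c3 * mq μ w s x := by
        intro w i er W g1 g2 g3
        have r1 := osc_nonneg μ w s x
        have k1 : er ^ 2 ≤ c1 ^ 2 * osc μ w s x ^ 2 := by
          rw [← sq_abs, ← mul_pow]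
          exact pow_le_pow_left₀ (abs_nonneg _) g1 2
        have k2 : er ^ 2 ≤ c2 * (osc μ w s x + |w x|) := by
          refine g2.trans ?_
          rw [hc2]
          gcongr
        unfold mq
        rcases min_cases (osc μ w s x ^ 2) (osc μ w s x + |w x|) with ⟨hm, _⟩ | ⟨hm, _⟩
        · rw [hm, hc3]
          have : 0 ≤ c2 * osc μ w s x ^ 2 := by positivity
          linarith
        · rw [hm, hc3]
          have : 0 ≤ c1 ^ 2 * (osc μ w s x + |w x|) := by positivity
          linarith
      have hsum : ∑ i, (A.err U ZU i x - A.err V ZV i x) ^ 2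
          ≤ 2 * N * c3 * (mq μ u s x + mq μ v s x) := by
        have : ∀ i ∈ (Finset.univ : Finset ι), (A.err U ZU i x - A.err V ZV i x) ^ 2
            ≤ 2 * (c3 * mq μ u s x + c3 * mq μ v s x) := by
          intro i _
          have a1 := gen u i (A.err U ZU i x) _ ((EU x hx).2.1 i) ((EU x hx).2.2 i)
            (by rw [cv_abs μ hu0]; linarith)
          have a2 := gen v i (A.err V ZV i x) _ ((EV x hx).2.1 i) ((EV x hx).2.2 i)
            (by rw [cv_abs μ hv0]; linarith)
          nlinarith [sq_nonneg (A.err U ZU i x + A.err V ZV i x)]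
        refine (Finset.sum_le_card_nsmul _ _ _ this).trans (le_of_eq ?_)
        rw [nsmul_eq_mul, Finset.card_univ, ← hN]; ring
      have hs0 : 0 ≤ ∑ i, (A.err U ZU i x - A.err V ZV i x) ^ 2 := Finset.sum_nonneg fun i _ => sq_nonneg _
      calc _ ≤ Cω * (Ch * (2 * N * c3 * (mq μ u s x + mq μ v s x))) := by
            refine mul_le_mul ((le_abs_self _).trans (hCωb x)) ?_ (mul_nonneg (h2 _) hs0) hCω.le
            exact mul_le_mul (h3 _) hsum hs0 hCh
        _ = _ := by ring
    have T3' := mul_le_mul_of_nonneg_left T3 (inv_nonneg.2 (by linarith : (0:ℝ) ≤ 4 * lam))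
    have e3 : (4 * lam)⁻¹ * ((Cω * Ch * (2 * N * c3)) * (∫ x, mq μ u s x ∂μ + ∫ x, mq μ v s x ∂μ))
      = ((4 * lam)⁻¹ * (Cω * Ch * (2 * N * c3))) * (∫ x, mq μ u s x ∂μ + ∫ x, mq μ v s x ∂μ) := by ring
    rw [e3] at T3'
    have e4 := add_mul (CL * 2 * C0) (N * Cd * c1) (∫ x, osc μ u s x ∂μ + ∫ x, osc μ v s x ∂μ)
    rw [e4]
    linarith
  have lim : Tendsto (fun s => ∫ x, F0 x * A.L ω x ∂μ
      + (CL * 2 * C0 + N * Cd * c1) * (∫ x, osc μ u s x ∂μ + ∫ x, osc μ v s x ∂μ)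
      + ((4 * lam)⁻¹ * (Cω * Ch * (2 * N * c3))) * (∫ x, mq μ u s x ∂μ + ∫ x, mq μ v s x ∂μ))
      (𝓝[>] 0) (𝓝 (∫ x, F0 x * A.L ω x ∂μ + (CL * 2 * C0 + N * Cd * c1) * (0 + 0)
        + ((4 * lam)⁻¹ * (Cω * Ch * (2 * N * c3))) * (0 + 0))) :=
    (tendsto_const_nhds.add (((osc_tendsto μ hu).add (osc_tendsto μ hv)).const_mul _)).add
      (((mq_tendsto μ hu).add (mq_tendsto μ hv)).const_mul _)
  simp only [add_zero, mul_zero] at lim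
  refine ge_of_tendsto lim ?_
  filter_upwards [Ioc_mem_nhdsGT hδ] with s hs using main s hs.1 hs.2

lemma locInt_max {Ω : Set E} {u v : E → ℝ} (hu : LocallyIntegrableOn u Ω μ)
    (hv : LocallyIntegrableOn v Ω μ) : LocallyIntegrableOn (fun x => max (u x) (v x)) Ω μ := by
  intro x hx
  obtain ⟨s, hs, hi⟩ := hu x hx
  obtain ⟨t, ht, hj⟩ := hv x hx
  exact ⟨s ∩ t, inter_mem hs ht, Integrable.sup (hi.mono_set Set.inter_subset_left)
    (hj.mono_set Set.inter_subset_right)⟩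

theorem kato {Ω : Set E} {u v : E → ℝ} {M : ℝ} (hΩ : IsOpen Ω) (hu : DS μ A Ω u) (hv : DS μ A Ω v)
    (hu0 : ∀ x ∈ Ω, u x ≤ 0) (hv0 : ∀ x ∈ Ω, v x ≤ 0) (hM : ∀ x ∈ Ω, -M ≤ v x) :
    DS μ A Ω (fun x => max (u x) (v x)) := by
  refine ⟨locInt_max μ hu.1 hv.1, fun ω hω hc hsub hω0 => ?_⟩
  have hω2 := hω.of_le two_le_infty
  obtain ⟨δ', hδ', hcth⟩ := hc.isCompact.exists_cthickening_subset_open hΩ hsub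
  set δ := min δ' 1 with hδdef
  have hδ : 0 < δ := lt_min hδ' one_pos
  have hδ1 : δ ≤ 1 := min_le_right _ _
  set Kc := cthickening δ (tsupport ω) with hKc
  have hKcΩ : Kc ⊆ Ω := (cthickening_mono (min_le_left _ _) _).trans hcth
  have hKcc : IsCompact Kc := hc.isCompact.cthickening
  have hm : MeasurableSet Kc := hKcc.isClosed.measurableSet
  have hK0 : tsupport ω ⊆ Kc := self_subset_cthickening _
  have gen : ∀ w : E → ℝ, DS μ A Ω w → Integrable (Kc.indicator w) μ ∧
      (∀ i j, LocallyIntegrable (fun y => A.a i j y * Kc.indicator w y) μ) ∧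
      (∀ x ∈ tsupport ω, ∀ φ : E → ℝ, ContDiff ℝ (⊤ : ℕ∞) φ → (∀ x, 0 ≤ φ x) →
      tsupport φ ⊆ closedBall 0 δ → 0 ≤ ∫ y, Kc.indicator w y * A.L (fun y => φ (x - y)) y ∂μ) := by
    intro w hw
    have hi : Integrable (Kc.indicator w) μ :=
      (integrable_indicator_iff hm).2 (hw.1.integrableOn_compact_subset hKcΩ hKcc)
    refine ⟨hi, fun i j => ?_, fun x hx φ hφ hφ0 hs => ?_⟩
    · rw [locallyIntegrable_iff]
      intro k hk
      have h2 : IntegrableOn (fun y => Kc.indicator w y * A.a i j y) k μ :=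
        hi.integrableOn.mul_continuousOn (A.smooth i j).continuous.continuousOn hk
      simpa only [mul_comm] using h2
    · have hts : tsupport (fun y => φ (x - y)) ⊆ closedBall x δ := by
        apply closure_minimal _ isClosed_closedBall
        intro y hy
        have := hs (subset_tsupport _ hy)
        rw [mem_closedBall_zero_iff] at this
        rw [mem_closedBall_comm, mem_closedBall_iff_norm]; exact this
      have hbK : closedBall x δ ⊆ Kc := closedBall_subset_cthickening hx δ
      have := hw.2 (fun y => φ (x - y)) (hφ.comp (contDiff_const.sub contDiff_id))
        (HasCompactSupport.of_support_subset_isCompact (isCompact_closedBall x δ)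
        (subset_closure.trans hts)) (hts.trans (hbK.trans hKcΩ)) (fun y => hφ0 _)
      refine this.trans (le_of_eq ?_)
      congr 1; funext y
      by_cases hy : y ∈ Kc
      · rw [Set.indicator_of_mem hy]
      · rw [L_eq_zero_of_notMem A (fun h => hy (hbK (hts h))), mul_zero, mul_zero]
  obtain ⟨u1, u2, u3⟩ := gen u hu
  obtain ⟨v1, v2, v3⟩ := gen v hv
  set M' := max M 0
  have hu0' : ∀ x, Kc.indicator u x ≤ 0 := Set.indicator_nonpos fun x hx => hu0 x (hKcΩ hx)
  have hv0' : ∀ x, Kc.indicator v x ≤ 0 := Set.indicator_nonpos fun x hx => hv0 x (hKcΩ hx)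
  have hM' : ∀ x, -M' ≤ Kc.indicator v x := by
    intro x
    by_cases hx : x ∈ Kc
    · rw [Set.indicator_of_mem hx]
      have := hM x (hKcΩ hx)
      have : M ≤ M' := le_max_left _ _
      linarith
    · rw [Set.indicator_of_notMem hx]
      have : 0 ≤ M' := le_max_right _ _
      linarith
  have hLi : Integrable (A.L ω) μ :=
    (L_continuous A hω2).integrable_of_hasCompactSupport (hasCompactSupport_L A hc)
  set I := ∫ x, max (u x) (v x) * A.L ω x ∂μ
  have hmaxi : Integrable (fun x => max (u x) (v x) * A.L ω x) μ :=
    integrable_mul_L A (locInt_max μ hu.1 hv.1) hω hc hsub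
  have step : ∀ ρ : ℝ, 0 < ρ → 0 ≤ I + ρ * ∫ x, |A.L ω x| ∂μ := by
    intro ρ hρ
    obtain ⟨h, Ch, hCh, hh, q0, q1, q2, q3, q4, q5, q6⟩ := exists_h hρ
    have := kato_core μ A u1 v1 u2 v2 hu0' hv0' hM' hω hc hω0 hδ hδ1 u3 v3 hCh hh q0 q1 q2 q3 q4 q6
    refine this.trans ?_
    have i2 : Integrable (fun x => ρ * |A.L ω x|) μ := hLi.abs.const_mul _
    rw [← integral_const_mul, ← integral_add hmaxi i2]
    by_cases hint : Integrable (fun x => (Kc.indicator v x + h (Kc.indicator u x - Kc.indicator v x)) * A.L ω x) μ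
    swap
    · rw [integral_undef hint] at *
      -- use positivity through the other approximation
      exfalso
      apply hint
      have hF : LocallyIntegrable (fun x => Kc.indicator v x + h (Kc.indicator u x - Kc.indicator v x)) μ := by
        apply v1.locallyIntegrable.add
        have e1 : LocallyIntegrable (fun x => |Kc.indicator u x - Kc.indicator v x| + |h 0|) μ :=
          ((u1.sub v1).abs.locallyIntegrable).add (locallyIntegrable_const _)
        refine e1.mono (hh.continuous.comp_aestronglyMeasurable
          (u1.sub v1).aestronglyMeasurable) (ae_of_all _ fun x => ?_)
        have q1 := q6 (Kc.indicator u x - Kc.indicator v x) 0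
        have q2 := abs_sub_abs_le_abs_sub (h (Kc.indicator u x - Kc.indicator v x)) (h 0)
        rw [Real.norm_eq_abs, Real.norm_eq_abs]
        refine le_trans ?_ (le_abs_self _)
        rw [sub_zero] at q1
        linarith
      exact integrable_mul_of_locInt (hF.locallyIntegrableOn Set.univ) (L_continuous A hω2)
        (hasCompactSupport_L A hc) (Set.subset_univ _)
    refine integral_mono hint (hmaxi.add i2) fun x => ?_
    simp only [Pi.add_apply]
    by_cases hx : x ∈ tsupport ω
    · rw [Set.indicator_of_mem (hK0 hx), Set.indicator_of_mem (hK0 hx)]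
      have a1 := q5 (u x - v x)
      have a2 : max (u x) (v x) = v x + max (u x - v x) 0 := by
        rw [← max_add_add_left]; congr 1 <;> ring
      have a3 : (v x + h (u x - v x) - max (u x) (v x)) * A.L ω x ≤ ρ * |A.L ω x| := by
        refine (le_abs_self _).trans ?_
        rw [abs_mul, a2]
        refine mul_le_mul_of_nonneg_right ?_ (abs_nonneg _)
        rw [add_sub_add_left_eq_sub]; exact a1
      linarith
    · rw [L_eq_zero_of_notMem A hx]; simp
  by_contra hneg
  push Not at hneg
  set J := ∫ x, |A.L ω x| ∂μ
  have hJ : 0 ≤ J := integral_nonneg fun x => abs_nonneg _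
  have := step (-I / (2 * (J + 1))) (div_pos (by linarith) (by linarith))
  have e : -I / (2 * (J + 1)) * J ≤ -I / 2 := by
    rw [div_mul_eq_mul_div, div_le_div_iff₀ (by linarith) (by norm_num)]
    nlinarith
  linarith

end Kato

end ASub

end



noncomputable section

namespace ASub

set_option linter.unusedSectionVars false

section Quad

variable {ι : Type*} [Fintype ι] [DecidableEq ι] {E : Type*} [NormedAddCommGroup E] [NormedSpace ℝ E]
  [FiniteDimensional ℝ E] [MeasurableSpace E] [BorelSpace E] {e : ι → E} (A : Ell e)

lemma exists_entry_bound {K : Set E} (hK : IsCompact K) : ∃ S : ℝ, 0 ≤ S ∧ ∀ y ∈ K, ∀ i j,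
    |A.a i j y| ≤ S := by
  have h1 : ∀ i j, ∃ C : ℝ, ∀ x ∈ K, ‖A.a i j x‖ ≤ C := fun i j =>
    hK.exists_bound_of_continuousOn ((A.smooth i j).continuous.continuousOn)
  choose C hC using h1
  refine ⟨∑ i, ∑ j, |C i j|, Finset.sum_nonneg fun i _ => Finset.sum_nonneg fun j _ => abs_nonneg _,
    fun x hx i j => ((hC i j x hx).trans (le_abs_self _)).trans ?_⟩
  refine le_trans ?_ (Finset.single_le_sum (f := fun i => ∑ j, |C i j|)
    (fun i _ => Finset.sum_nonneg fun j _ => abs_nonneg _) (Finset.mem_univ i))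
  exact Finset.single_le_sum (f := fun j => |C i j|) (fun j _ => abs_nonneg _) (Finset.mem_univ j)

lemma exists_inv {K : Set E} (hK : IsCompact K) : ∃ C : ℝ, 1 ≤ C ∧ ∀ y ∈ K, ∃ B : ι → ι → ℝ,
    (∀ i j, B i j = B j i) ∧ (∀ i k, ∑ j, A.a i j y * B j k = if i = k then 1 else 0) ∧
    (∀ i j, |B i j| ≤ C) ∧
    (∀ w : ι → ℝ, ∑ i, w i ^ 2 ≤ C * ∑ i, ∑ j, B i j * w i * w j) ∧
    (∀ w : ι → ℝ, ∑ i, ∑ j, B i j * w i * w j ≤ C * ∑ i, w i ^ 2) ∧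
    (∀ w : ι → ℝ, ∑ i, (∑ j, B i j * w j) ^ 2 ≤ C * ∑ i, ∑ j, B i j * w i * w j) := by
  obtain ⟨lam, hl, hell⟩ := exists_ellip A hK
  obtain ⟨S, hS, hSb⟩ := exists_entry_bound A hK
  set N : ℝ := (Fintype.card ι : ℝ) with hN
  have hN0 : 0 ≤ N := Nat.cast_nonneg _
  refine ⟨1 + lam⁻¹ + N ^ 2 * S ^ 2 * lam⁻¹, by
    have : 0 < lam⁻¹ := inv_pos.2 hl
    have : 0 ≤ N ^ 2 * S ^ 2 * lam⁻¹ := by positivity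
    linarith, fun y hy => ?_⟩
  set C := 1 + lam⁻¹ + N ^ 2 * S ^ 2 * lam⁻¹ with hC
  set M : Matrix ι ι ℝ := Matrix.of fun i j => A.a i j y with hM
  have hMs : M.transpose = M := by
    ext i j; simp [hM, A.symm j i y]
  have hinj : Function.Injective M.mulVec := by
    intro v w hvw
    by_contra hne
    have h0 : v - w ≠ 0 := sub_ne_zero.2 hne
    have h1 := A.pos y (v - w) h0
    have h2 : M.mulVec (v - w) = 0 := by rw [Matrix.mulVec_sub, hvw, sub_self]
    have h3 : ∑ i, ∑ j, A.a i j y * (v - w) i * (v - w) j = ∑ i, (v - w) i * M.mulVec (v - w) i := by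
      refine Finset.sum_congr rfl fun i _ => ?_
      simp only [Matrix.mulVec, dotProduct, Finset.mul_sum]
      refine Finset.sum_congr rfl fun j _ => ?_
      simp [hM]; ring
    rw [h3, h2] at h1
    simp at h1
  have hunit : IsUnit M.det := (Matrix.isUnit_iff_isUnit_det M).1 (Matrix.mulVec_injective_iff_isUnit.1 hinj)
  set B : ι → ι → ℝ := fun i j => M⁻¹ i j with hB
  have hBs : ∀ i j, B i j = B j i := by
    intro i j
    have : (M⁻¹).transpose = M⁻¹ := by rw [Matrix.transpose_nonsing_inv, hMs]
    have := congrFun (congrFun this j) i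
    simpa [hB] using this
  have hAB : ∀ i k, ∑ j, A.a i j y * B j k = if i = k then 1 else 0 := by
    intro i k
    have := congrFun (congrFun (Matrix.mul_nonsing_inv M hunit) i) k
    rw [Matrix.mul_apply, Matrix.one_apply] at this
    simpa [hM, hB] using this
  -- basic facts about ξ
  have hq : ∀ w : ι → ℝ, lam * ∑ i, (∑ j, B i j * w j) ^ 2 ≤ ∑ i, ∑ j, B i j * w i * w j ∧
      ∑ i, w i ^ 2 ≤ N ^ 2 * S ^ 2 * ∑ i, (∑ j, B i j * w j) ^ 2 := by
    intro w
    set ξ : ι → ℝ := fun i => ∑ j, B i j * w j with hξ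
    have hw : ∀ i, ∑ j, A.a i j y * ξ j = w i := by
      intro i
      simp only [hξ, Finset.mul_sum]
      rw [Finset.sum_comm]
      have : ∀ k, ∑ j, A.a i j y * (B j k * w k) = (if i = k then 1 else 0) * w k := by
        intro k
        rw [← hAB i k, Finset.sum_mul]
        exact Finset.sum_congr rfl fun j _ => by ring
      simp [this]
    have e1 : ∑ i, ∑ j, B i j * w i * w j = ∑ i, w i * ξ i := by
      refine Finset.sum_congr rfl fun i _ => ?_
      simp only [hξ, Finset.mul_sum]
      exact Finset.sum_congr rfl fun j _ => by ring
    have e2 : ∑ i, ∑ j, A.a i j y * ξ i * ξ j = ∑ i, w i * ξ i := by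
      refine Finset.sum_congr rfl fun i _ => ?_
      rw [← hw i, Finset.sum_mul]
      exact Finset.sum_congr rfl fun j _ => by ring
    refine ⟨by rw [e1, ← e2]; exact hell y hy ξ, ?_⟩
    have h1 : ∀ i ∈ (Finset.univ : Finset ι), w i ^ 2 ≤ N * S ^ 2 * ∑ j, ξ j ^ 2 := by
      intro i _
      rw [← hw i]
      have h2 := sq_sum_le_card_mul_sum_sq (s := (Finset.univ : Finset ι)) (f := fun j => A.a i j y * ξ j)
      refine h2.trans ?_
      rw [Finset.card_univ, ← hN, mul_assoc]
      refine mul_le_mul_of_nonneg_left ?_ hN0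
      rw [Finset.mul_sum]
      refine Finset.sum_le_sum fun j _ => ?_
      rw [mul_pow]
      refine mul_le_mul_of_nonneg_right ?_ (sq_nonneg _)
      rw [← sq_abs]
      exact pow_le_pow_left₀ (abs_nonneg _) (hSb y hy i j) 2
    refine (Finset.sum_le_card_nsmul _ _ _ h1).trans (le_of_eq ?_)
    rw [nsmul_eq_mul, Finset.card_univ, ← hN]; ring
  have hli : 0 < lam⁻¹ := inv_pos.2 hl
  have hNS : 0 ≤ N ^ 2 * S ^ 2 * lam⁻¹ := by positivity
  have hξq : ∀ w : ι → ℝ, ∑ i, (∑ j, B i j * w j) ^ 2 ≤ lam⁻¹ * ∑ i, ∑ j, B i j * w i * w j := by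
    intro w
    rw [inv_mul_eq_div, le_div_iff₀ hl, mul_comm]
    exact (hq w).1
  have hq0 : ∀ w : ι → ℝ, 0 ≤ ∑ i, ∑ j, B i j * w i * w j := fun w =>
    le_trans (mul_nonneg hl.le (Finset.sum_nonneg fun i _ => sq_nonneg _)) (hq w).1
  have hqu : ∀ w : ι → ℝ, ∑ i, ∑ j, B i j * w i * w j ≤ lam⁻¹ * ∑ i, w i ^ 2 := by
    intro w
    have e1 : ∑ i, ∑ j, B i j * w i * w j = ∑ i, w i * (∑ j, B i j * w j) := by
      refine Finset.sum_congr rfl fun i _ => ?_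
      simp only [Finset.mul_sum]
      exact Finset.sum_congr rfl fun j _ => by ring
    have h1 : ∑ i, w i * (∑ j, B i j * w j) ≤ ∑ i, (lam⁻¹ / 2 * w i ^ 2 + lam / 2 * (∑ j, B i j * w j) ^ 2) := by
      refine Finset.sum_le_sum fun i _ => ?_
      set z := ∑ j, B i j * w j
      have : 0 ≤ lam⁻¹ / 2 * (w i - lam * z) ^ 2 := by positivity
      have e : lam⁻¹ / 2 * (w i - lam * z) ^ 2 = lam⁻¹ / 2 * w i ^ 2 + lam / 2 * z ^ 2 - w i * z := by
        field_simp; ring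
      linarith
    rw [Finset.sum_add_distrib, ← Finset.mul_sum, ← Finset.mul_sum] at h1
    have h2 := (hq w).1
    linarith
  have hC1 : lam⁻¹ ≤ C := by rw [hC]; linarith
  have hC0 : 0 ≤ C := hli.le.trans hC1
  refine ⟨B, hBs, hAB, fun i j => ?_, fun w => ?_, fun w => ?_, fun w => ?_⟩
  · have h1 := hξq (Pi.single j 1)
    have h2 := hqu (Pi.single j 1)
    have h3 : ∀ i, ∑ k, B i k * (Pi.single j 1 : ι → ℝ) k = B i j := by
      intro i; simp [Pi.single_apply]
    have h4 : ∑ i, (Pi.single j 1 : ι → ℝ) i ^ 2 = 1 := by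
      rw [Finset.sum_eq_single j] <;> simp +contextual [Pi.single_apply]
    rw [h4, mul_one] at h2
    simp only [h3] at h1
    have h5 : B i j ^ 2 ≤ ∑ i, B i j ^ 2 :=
      Finset.single_le_sum (f := fun i => B i j ^ 2) (fun i _ => sq_nonneg _) (Finset.mem_univ i)
    have h6 : B i j ^ 2 ≤ lam⁻¹ ^ 2 := by
      refine h5.trans (h1.trans ?_)
      rw [pow_two]
      exact mul_le_mul_of_nonneg_left h2 hli.le
    exact (abs_le_of_sq_le_sq h6 hli.le).trans hC1
  · refine (hq w).2.trans ?_
    calc _ ≤ N ^ 2 * S ^ 2 * (lam⁻¹ * ∑ i, ∑ j, B i j * w i * w j) :=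
          mul_le_mul_of_nonneg_left (hξq w) (by positivity)
      _ = (N ^ 2 * S ^ 2 * lam⁻¹) * ∑ i, ∑ j, B i j * w i * w j := by ring
      _ ≤ _ := mul_le_mul_of_nonneg_right (by rw [hC]; linarith) (hq0 w)
  · exact (hqu w).trans (mul_le_mul_of_nonneg_right hC1 (Finset.sum_nonneg fun i _ => sq_nonneg _))
  · exact (hξq w).trans (mul_le_mul_of_nonneg_right hC1 (hq0 w))

end Quad

end ASub

end



noncomputable section

namespace ASub

set_option linter.unusedSectionVars false

section Rad

variable {ι : Type*} [Fintype ι] [DecidableEq ι] {E : Type*} [NormedAddCommGroup E] [NormedSpace ℝ E]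
  [FiniteDimensional ℝ E] [MeasurableSpace E] [BorelSpace E] {e : ι → E} (A : Ell e)
  (ℓ : ι → E →L[ℝ] ℝ)

/-- the quadratic form -/
def Qf (B : ι → ι → ℝ) (y x : E) : ℝ := ∑ i, ∑ j, B i j * ℓ i (x - y) * ℓ j (x - y)

lemma Qf_contDiff (B : ι → ι → ℝ) (y : E) : ContDiff ℝ (⊤ : ℕ∞) (Qf ℓ B y) := by
  unfold Qf
  refine ContDiff.sum fun i _ => ContDiff.sum fun j _ => ?_
  have h : ∀ i, ContDiff ℝ (⊤ : ℕ∞) (fun x => ℓ i (x - y)) := fun i =>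
    (ℓ i).contDiff.comp (contDiff_id.sub contDiff_const)
  exact (contDiff_const.mul (h i)).mul (h j)

lemma pd_ell (hℓ : ∀ i j, ℓ i (e j) = if i = j then 1 else 0) (y : E) (i k : ι) (x : E) :
    pd (e k) (fun x => ℓ i (x - y)) x = if i = k then 1 else 0 := by
  unfold pd
  have : HasFDerivAt (fun x => ℓ i (x - y)) (ℓ i) x :=
    (ℓ i).hasFDerivAt.comp x ((hasFDerivAt_id x).sub_const y)
  rw [this.fderiv, hℓ]

lemma ell_diff (y : E) (i : ι) (x : E) : DifferentiableAt ℝ (fun x => ℓ i (x - y)) x :=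
  (ℓ i).differentiableAt.comp x (differentiableAt_id.sub_const y)

lemma pd_Qf (hℓ : ∀ i j, ℓ i (e j) = if i = j then 1 else 0) {B : ι → ι → ℝ}
    (hB : ∀ i j, B i j = B j i) (y : E) (k : ι) (x : E) :
    pd (e k) (Qf ℓ B y) x = 2 * ∑ j, B k j * ℓ j (x - y) := by
  have h1 : ∀ i j, pd (e k) (fun x => B i j * ℓ i (x - y) * ℓ j (x - y)) x
      = (if i = k then B i j * ℓ j (x - y) else 0) + (if j = k then B i j * ℓ i (x - y) else 0) := by
    intro i j
    rw [pd_mul (f := fun x => B i j * ℓ i (x - y)) (g := fun x => ℓ j (x - y))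
      ((ell_diff ℓ y i x).const_mul _) (ell_diff ℓ y j x),
      pd_mul (f := fun _ => B i j) (g := fun x => ℓ i (x - y)) (by fun_prop) (ell_diff ℓ y i x),
      pd_const, pd_ell ℓ hℓ, pd_ell ℓ hℓ]
    split_ifs <;> ring
  have hd : ∀ i j, DifferentiableAt ℝ (fun x => B i j * ℓ i (x - y) * ℓ j (x - y)) x := fun i j =>
    ((ell_diff ℓ y i x).const_mul _).mul (ell_diff ℓ y j x)
  unfold Qf
  rw [pd_sum (f := fun i x => ∑ j, B i j * ℓ i (x - y) * ℓ j (x - y)) _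
    (fun i _ => DifferentiableAt.fun_sum fun j _ => hd i j)]
  have h2 : ∀ i, pd (e k) (fun x => ∑ j, B i j * ℓ i (x - y) * ℓ j (x - y)) x
      = ∑ j, ((if i = k then B i j * ℓ j (x - y) else 0) + (if j = k then B i j * ℓ i (x - y) else 0)) := by
    intro i
    rw [pd_sum (f := fun j x => B i j * ℓ i (x - y) * ℓ j (x - y)) _ (fun j _ => hd i j)]
    exact Finset.sum_congr rfl fun j _ => h1 i j
  simp only [h2, Finset.sum_add_distrib]
  rw [two_mul]
  congr 1
  · rw [Finset.sum_eq_single k]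
    · simp
    · intro i _ hi; simp [hi]
    · simp
  · simp only [Finset.sum_ite_eq', Finset.mem_univ, if_true]
    exact Finset.sum_congr rfl fun i _ => by rw [hB]

lemma L_rad (hℓ : ∀ i j, ℓ i (e j) = if i = j then 1 else 0) {B : ι → ι → ℝ}
    (hB : ∀ i j, B i j = B j i) (y : E) {f : ℝ → ℝ} (hf : ContDiff ℝ 2 f) (x : E) :
    A.L (fun x => f (Qf ℓ B y x)) x = 4 * deriv (deriv f) (Qf ℓ B y x) *
        (∑ i, ∑ j, A.a i j x * (∑ k, B i k * ℓ k (x - y)) * (∑ k, B j k * ℓ k (x - y)))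
      + 2 * deriv f (Qf ℓ B y x) * ∑ i, ∑ j, A.a i j x * B j i := by
  have hQ := Qf_contDiff ℓ B y
  have hQd : ∀ x, DifferentiableAt ℝ (Qf ℓ B y) x := fun x => hQ.differentiable (by simp) x
  have hdf : ContDiff ℝ 1 (deriv f) :=
    ((contDiff_succ_iff_deriv (n := 1)).1 (by simpa [one_add_one_eq_two] using hf)).2.2
  have h1 : ∀ j, pd (e j) (fun x => f (Qf ℓ B y x))
      = fun x => deriv f (Qf ℓ B y x) * (2 * ∑ k, B j k * ℓ k (x - y)) := by
    intro j; funext x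
    rw [pd_comp (hf.differentiable (by norm_num) _) (hQd x), pd_Qf ℓ hℓ hB]
  have hld : ∀ j, DifferentiableAt ℝ (fun x => 2 * ∑ k, B j k * ℓ k (x - y)) x := fun j =>
    (DifferentiableAt.fun_sum fun k _ => (ell_diff ℓ y k x).const_mul _).const_mul _
  have h3 : ∀ i j, pd (e i) (fun x => 2 * ∑ k, B j k * ℓ k (x - y)) x = 2 * B j i := by
    intro i j
    rw [pd_mul (f := fun _ => (2:ℝ)) (g := fun x => ∑ k, B j k * ℓ k (x - y)) (by fun_prop)
      (DifferentiableAt.fun_sum fun k _ => (ell_diff ℓ y k x).const_mul _), pd_const,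
      pd_sum (f := fun k x => B j k * ℓ k (x - y)) _ (fun k _ => (ell_diff ℓ y k x).const_mul _)]
    have : ∀ k, pd (e i) (fun x => B j k * ℓ k (x - y)) x = if k = i then B j k else 0 := by
      intro k
      rw [pd_mul (f := fun _ => B j k) (g := fun x => ℓ k (x - y)) (by fun_prop) (ell_diff ℓ y k x),
        pd_const, pd_ell ℓ hℓ]
      split_ifs <;> ring
    simp [this, -map_sub]
  unfold Ell.L
  rw [Finset.mul_sum, Finset.mul_sum, ← Finset.sum_add_distrib]
  refine Finset.sum_congr rfl fun i _ => ?_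
  rw [Finset.mul_sum, Finset.mul_sum, ← Finset.sum_add_distrib]
  refine Finset.sum_congr rfl fun j _ => ?_
  rw [h1 j, pd_mul (f := fun x => deriv f (Qf ℓ B y x)) (g := fun x => 2 * ∑ k, B j k * ℓ k (x - y))
    ((hdf.differentiable (by norm_num) _).comp x (hQd x)) (hld j), h3 i j,
    pd_comp (hdf.differentiable (by norm_num) _) (hQd x), pd_Qf ℓ hℓ hB]
  ring

/-- packaged radial functions -/
structure Rad (C : ℝ) (y : E) (Q : E → ℝ) : Prop where
  smooth : ContDiff ℝ (⊤ : ℕ∞) Q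
  lower : ∀ x, ‖x - y‖ ^ 2 ≤ C * Q x
  upper : ∀ x, Q x ≤ C * ‖x - y‖ ^ 2
  est : ∀ f : ℝ → ℝ, ContDiff ℝ 2 f → ∀ x, ‖x - y‖ ≤ 1 →
    |A.L (fun x => f (Q x)) x - (4 * Q x * deriv (deriv f) (Q x)
      + 2 * Fintype.card ι * deriv f (Q x))|
      ≤ C * Real.sqrt (Q x) * (Q x * |deriv (deriv f) (Q x)| + |deriv f (Q x)|)

lemma Rad.nonneg {C : ℝ} (hC : 1 ≤ C) {y : E} {Q : E → ℝ} (h : Rad A C y Q) (x : E) : 0 ≤ Q x := by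
  have := h.lower x
  by_contra hn
  push Not at hn
  nlinarith [sq_nonneg ‖x - y‖]

lemma exists_rad (hℓ : ∀ i j, ℓ i (e j) = if i = j then 1 else 0)
    (hco : ∀ w : E, w = ∑ i, ℓ i w • e i) {K : Set E} (hK : IsCompact K) :
    ∃ C : ℝ, 1 ≤ C ∧ ∀ y ∈ K, ∃ Q : E → ℝ, Rad A C y Q := by
  obtain ⟨C, hC, hinv⟩ := exists_inv A hK
  obtain ⟨Λ, hΛ, hlip⟩ := exists_lip A hK
  set N : ℝ := (Fintype.card ι : ℝ) with hN
  have hN0 : 0 ≤ N := Nat.cast_nonneg _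
  set S1 : ℝ := ∑ i, ‖e i‖ ^ 2 with hS1
  have hS10 : 0 ≤ S1 := Finset.sum_nonneg fun i _ => sq_nonneg _
  set S2 : ℝ := ∑ i, ‖ℓ i‖ ^ 2 with hS2
  have hS20 : 0 ≤ S2 := Finset.sum_nonneg fun i _ => sq_nonneg _
  have hC0 : 0 ≤ C := by linarith
  have hn1 : ∀ w : E, ‖w‖ ^ 2 ≤ S1 * ∑ i, (ℓ i w) ^ 2 := by
    intro w
    have h1 : ‖w‖ ≤ ∑ i, ‖e i‖ * |ℓ i w| := by
      conv_lhs => rw [hco w]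
      refine (norm_sum_le _ _).trans (Finset.sum_le_sum fun i _ => ?_)
      rw [norm_smul, Real.norm_eq_abs, mul_comm]
    have h2 := Finset.sum_mul_sq_le_sq_mul_sq Finset.univ (fun i => ‖e i‖) (fun i => |ℓ i w|)
    simp only [sq_abs] at h2
    exact (pow_le_pow_left₀ (norm_nonneg _) h1 2).trans h2
  have hn2 : ∀ w : E, ∑ i, (ℓ i w) ^ 2 ≤ S2 * ‖w‖ ^ 2 := by
    intro w
    rw [hS2, Finset.sum_mul]
    refine Finset.sum_le_sum fun i _ => ?_
    rw [← sq_abs, ← mul_pow]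
    exact pow_le_pow_left₀ (abs_nonneg _) ((ℓ i).le_opNorm w) 2
  set D1 : ℝ := S1 * C with hD1
  have hD10 : 0 ≤ D1 := by positivity
  set D3 : ℝ := Λ * Real.sqrt D1 * (4 * N * C + 2 * N ^ 2 * C) with hD3
  have hD30 : 0 ≤ D3 := by positivity
  refine ⟨1 + D1 + C * S2 + D3, by have : 0 ≤ C * S2 := by positivity
                                   linarith, fun y hy => ?_⟩
  obtain ⟨B, hBs, hAB, hBb, hB1, hB2, hB3⟩ := hinv y hy
  have hCS : 0 ≤ C * S2 := by positivity
  have hlow : ∀ x, ‖x - y‖ ^ 2 ≤ D1 * Qf ℓ B y x := by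
    intro x
    refine (hn1 (x - y)).trans ?_
    rw [hD1, mul_assoc]
    exact mul_le_mul_of_nonneg_left (hB1 fun i => ℓ i (x - y)) hS10
  have hQ0 : ∀ x, 0 ≤ Qf ℓ B y x := by
    intro x
    have h1 := hB1 fun i => ℓ i (x - y)
    have h2 : 0 ≤ ∑ i, (ℓ i (x - y)) ^ 2 := Finset.sum_nonneg fun i _ => sq_nonneg _
    have h3 := h2.trans h1
    exact nonneg_of_mul_nonneg_right h3 (by linarith)
  refine ⟨Qf ℓ B y, Qf_contDiff ℓ B y, fun x => ?_, fun x => ?_, fun f hf x hx => ?_⟩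
  · refine (hlow x).trans (mul_le_mul_of_nonneg_right ?_ (hQ0 x))
    linarith
  · have h1 := hB2 fun i => ℓ i (x - y)
    have h2 : Qf ℓ B y x ≤ C * S2 * ‖x - y‖ ^ 2 := by
      refine h1.trans ?_
      rw [mul_assoc]
      exact mul_le_mul_of_nonneg_left (hn2 _) hC0
    refine h2.trans (mul_le_mul_of_nonneg_right ?_ (sq_nonneg _))
    linarith
  · rw [L_rad A ℓ hℓ hBs y hf x]
    set q := Qf ℓ B y x with hq
    set ξ : ι → ℝ := fun i => ∑ k, B i k * ℓ k (x - y) with hξ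
    have hξq : ∑ i, ξ i ^ 2 ≤ C * q := hB3 fun i => ℓ i (x - y)
    have hda : ∀ i j, |A.a i j x - A.a i j y| ≤ Λ * ‖x - y‖ := by
      intro i j
      have := hlip y hy i j (y - x) (by rw [norm_sub_rev]; exact hx)
      rw [sub_sub_cancel, abs_sub_comm, norm_sub_rev] at this
      exact this
    have hxy : ‖x - y‖ ≤ Real.sqrt D1 * Real.sqrt q := by
      rw [← Real.sqrt_mul hD10]
      exact Real.le_sqrt_of_sq_le (hlow x)
    -- exact values at y
    have ev1 : ∑ i, ∑ j, A.a i j y * ξ i * ξ j = q := by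
      have hw : ∀ i, ∑ j, A.a i j y * ξ j = ℓ i (x - y) := by
        intro i
        simp only [hξ, Finset.mul_sum]
        rw [Finset.sum_comm]
        have : ∀ k, ∑ j, A.a i j y * (B j k * ℓ k (x - y)) = (if i = k then 1 else 0) * ℓ k (x - y) := by
          intro k
          rw [← hAB i k, Finset.sum_mul]
          exact Finset.sum_congr rfl fun j _ => by ring
        simp [this, -map_sub]
      rw [hq]; unfold Qf
      refine Finset.sum_congr rfl fun i _ => ?_
      have : ∑ j, A.a i j y * ξ i * ξ j = ℓ i (x - y) * ξ i := by
        rw [← hw i, Finset.sum_mul]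
        exact Finset.sum_congr rfl fun j _ => by ring
      rw [this, hξ, Finset.mul_sum]
      exact Finset.sum_congr rfl fun j _ => by ring
    have ev2 : ∑ i, ∑ j, A.a i j y * B j i = N := by
      simp [hAB, hN]
    have b1 : |∑ i, ∑ j, A.a i j x * ξ i * ξ j - q| ≤ Λ * ‖x - y‖ * (N * (C * q)) := by
      conv_lhs => rw [← ev1, ← Finset.sum_sub_distrib]
      have : ∀ i, |∑ j, A.a i j x * ξ i * ξ j - ∑ j, A.a i j y * ξ i * ξ j|
          ≤ ∑ j, Λ * ‖x - y‖ * ((ξ i ^ 2 + ξ j ^ 2) / 2) := by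
        intro i
        rw [← Finset.sum_sub_distrib]
        refine (Finset.abs_sum_le_sum_abs _ _).trans (Finset.sum_le_sum fun j _ => ?_)
        rw [show A.a i j x * ξ i * ξ j - A.a i j y * ξ i * ξ j = (A.a i j x - A.a i j y) * (ξ i * ξ j) by ring,
          abs_mul]
        refine mul_le_mul (hda i j) ?_ (abs_nonneg _) (by positivity)
        rw [abs_le]
        constructor <;> nlinarith [sq_nonneg (ξ i + ξ j), sq_nonneg (ξ i - ξ j)]
      refine (Finset.abs_sum_le_sum_abs _ _).trans ((Finset.sum_le_sum fun i _ => this i).trans ?_)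
      have e1 : ∑ i, ∑ j, Λ * ‖x - y‖ * ((ξ i ^ 2 + ξ j ^ 2) / 2) = Λ * ‖x - y‖ * (N * ∑ i, ξ i ^ 2) := by
        simp only [← Finset.mul_sum, ← Finset.sum_div, Finset.sum_add_distrib, Finset.sum_const,
          Finset.card_univ, nsmul_eq_mul, ← hN]
        ring
      rw [e1]
      gcongr
    have b2 : |∑ i, ∑ j, A.a i j x * B j i - N| ≤ Λ * ‖x - y‖ * (N ^ 2 * C) := by
      conv_lhs => rw [← ev2, ← Finset.sum_sub_distrib]
      have : ∀ i, |∑ j, A.a i j x * B j i - ∑ j, A.a i j y * B j i| ≤ ∑ j : ι, Λ * ‖x - y‖ * C := by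
        intro i
        rw [← Finset.sum_sub_distrib]
        refine (Finset.abs_sum_le_sum_abs _ _).trans (Finset.sum_le_sum fun j _ => ?_)
        rw [← sub_mul, abs_mul]
        exact mul_le_mul (hda i j) (hBb j i) (abs_nonneg _) (by positivity)
      refine (Finset.abs_sum_le_sum_abs _ _).trans ((Finset.sum_le_sum fun i _ => this i).trans (le_of_eq ?_))
      simp only [Finset.sum_const, Finset.card_univ, nsmul_eq_mul, ← hN]
      ring
    set d2 := deriv (deriv f) q
    set d1 := deriv f q
    set P := ∑ i, ∑ j, A.a i j x * ξ i * ξ j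
    set R := ∑ i, ∑ j, A.a i j x * B j i
    have hq0 : 0 ≤ q := hQ0 x
    have e : 4 * d2 * P + 2 * d1 * R - (4 * q * d2 + 2 * N * d1) = 4 * (d2 * (P - q)) + 2 * (d1 * (R - N)) := by
      ring
    have step : |4 * d2 * P + 2 * d1 * R - (4 * q * d2 + 2 * N * d1)|
        ≤ 4 * (|d2| * (Λ * ‖x - y‖ * (N * (C * q)))) + 2 * (|d1| * (Λ * ‖x - y‖ * (N ^ 2 * C))) := by
      rw [e]
      refine (abs_add_le _ _).trans ?_
      rw [abs_mul, abs_mul 2, abs_mul d2, abs_mul d1, abs_of_pos (by norm_num : (0:ℝ) < 4),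
        abs_of_pos (by norm_num : (0:ℝ) < 2)]
      gcongr
    refine step.trans ?_
    have sq0 := Real.sqrt_nonneg q
    have sD0 := Real.sqrt_nonneg D1
    have k1 : Λ * ‖x - y‖ ≤ Λ * (Real.sqrt D1 * Real.sqrt q) := mul_le_mul_of_nonneg_left hxy hΛ
    have k2 : 4 * (|d2| * (Λ * ‖x - y‖ * (N * (C * q)))) + 2 * (|d1| * (Λ * ‖x - y‖ * (N ^ 2 * C)))
        ≤ 4 * (|d2| * (Λ * (Real.sqrt D1 * Real.sqrt q) * (N * (C * q))))
          + 2 * (|d1| * (Λ * (Real.sqrt D1 * Real.sqrt q) * (N ^ 2 * C))) := by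
      gcongr
    refine k2.trans ?_
    have k3 : 4 * (|d2| * (Λ * (Real.sqrt D1 * Real.sqrt q) * (N * (C * q))))
          + 2 * (|d1| * (Λ * (Real.sqrt D1 * Real.sqrt q) * (N ^ 2 * C)))
        ≤ D3 * Real.sqrt q * (q * |d2| + |d1|) := by
      rw [hD3]
      have z1 : 0 ≤ Λ * Real.sqrt D1 * Real.sqrt q * (2 * N ^ 2 * C) * (q * |d2|) := by positivity
      have z2 : 0 ≤ Λ * Real.sqrt D1 * Real.sqrt q * (4 * N * C) * |d1| := by positivity
      nlinarith
    refine k3.trans ?_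
    have : 0 ≤ Real.sqrt q * (q * |d2| + |d1|) := by positivity
    have hD : D3 ≤ 1 + D1 + C * S2 + D3 := by linarith
    have := mul_le_mul_of_nonneg_right hD this
    simpa only [← mul_assoc] using this

end Rad

end ASub

end



noncomputable section

namespace ASub

set_option linter.unusedSectionVars false

section Prof

/-- cut-off -/
def chi (t : ℝ) : ℝ := Real.smoothTransition (2 * t - 1)

lemma chi_smooth : ContDiff ℝ (⊤ : ℕ∞) chi :=
  Real.smoothTransition.contDiff.comp ((contDiff_const.mul contDiff_id).sub contDiff_const)

lemma chi_nonneg (t : ℝ) : 0 ≤ chi t := Real.smoothTransition.nonneg _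
lemma chi_le_one (t : ℝ) : chi t ≤ 1 := Real.smoothTransition.le_one _
lemma chi_zero {t : ℝ} (h : t ≤ 1/2) : chi t = 0 :=
  Real.smoothTransition.zero_of_nonpos (by linarith)
lemma chi_one {t : ℝ} (h : 1 ≤ t) : chi t = 1 :=
  Real.smoothTransition.one_of_one_le (by linarith)

lemma chi_deriv_continuous : Continuous (deriv chi) :=
  chi_smooth.continuous_deriv (by simp)

lemma chi_mono : Monotone chi := by
  intro a b h
  exact Real.smoothTransition.monotone (by linarith)

lemma chi_deriv_nonneg (t : ℝ) : 0 ≤ deriv chi t := chi_mono.deriv_nonneg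

lemma chi_deriv_zero_left {t : ℝ} (h : t ≤ 1/2) : deriv chi t = 0 := by
  have h0 : IsMinOn chi Set.univ t := by
    intro x _
    simp only [Set.mem_setOf_eq, chi_zero h]
    exact chi_nonneg x
  exact (h0.isLocalMin univ_mem).deriv_eq_zero

lemma chi_deriv_zero_right {t : ℝ} (h : 1 ≤ t) : deriv chi t = 0 := by
  have h0 : IsMaxOn chi Set.univ t := by
    intro x _
    simp only [Set.mem_setOf_eq, chi_one h]
    exact chi_le_one x
  exact (h0.isLocalMax univ_mem).deriv_eq_zero

lemma exists_chi_bound : ∃ M : ℝ, 0 < M ∧ ∀ t, deriv chi t ≤ M := by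
  have hs : HasCompactSupport (deriv chi) := by
    refine HasCompactSupport.intro (isCompact_Icc (a := (1/2:ℝ)) (b := 1)) fun t ht => ?_
    by_cases h : t ≤ 1/2
    · exact chi_deriv_zero_left h
    · refine chi_deriv_zero_right ?_
      by_contra h'
      exact ht ⟨by linarith, by linarith⟩
  obtain ⟨M, hM⟩ := hs.exists_bound_of_continuous chi_deriv_continuous
  refine ⟨|M| + 1, by positivity, fun t => ?_⟩
  have := hM t
  have h2 := le_abs_self (deriv chi t)
  rw [Real.norm_eq_abs] at this
  linarith [le_abs_self M]

/-- the ring kernel -/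
def kk (n : ℕ) (ε q : ℝ) : ℝ := q * (q ^ n)⁻¹ * (deriv chi (q / ε ^ 2) / ε ^ 2)

lemma kk_nonneg (n : ℕ) (ε : ℝ) {q : ℝ} (hq : 0 ≤ q) : 0 ≤ kk n ε q := by
  unfold kk
  have := chi_deriv_nonneg (q / ε ^ 2)
  positivity

lemma kk_zero_left (n : ℕ) {ε q : ℝ} (hε : 0 < ε) (hq : q ≤ ε ^ 2 / 2) : kk n ε q = 0 := by
  unfold kk
  rw [chi_deriv_zero_left]; · simp
  rw [div_le_iff₀ (by positivity)]; linarith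

lemma kk_zero_right (n : ℕ) {ε q : ℝ} (hε : 0 < ε) (hq : ε ^ 2 ≤ q) : kk n ε q = 0 := by
  unfold kk
  rw [chi_deriv_zero_right]; · simp
  rw [le_div_iff₀ (by positivity)]; linarith

lemma kk_bound {M : ℝ} (hM : 0 < M) (hMb : ∀ t, deriv chi t ≤ M) (n : ℕ) {ε q : ℝ} (hε : 0 < ε) :
    kk n ε q ≤ 2 ^ n * M * (ε ^ (2 * n))⁻¹ := by
  have hpos : 0 ≤ 2 ^ n * M * (ε ^ (2 * n))⁻¹ := by positivity
  by_cases h1 : q ≤ ε ^ 2 / 2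
  · rw [kk_zero_left n hε h1]; exact hpos
  by_cases h2 : ε ^ 2 ≤ q
  · rw [kk_zero_right n hε h2]; exact hpos
  push Not at h1 h2
  have hq : 0 < q := lt_trans (by positivity) h1
  unfold kk
  have a1 : q * (q ^ n)⁻¹ ≤ ε ^ 2 * ((ε ^ 2 / 2) ^ n)⁻¹ := by
    gcongr
  have a2 : deriv chi (q / ε ^ 2) / ε ^ 2 ≤ M / ε ^ 2 := by
    gcongr; exact hMb _
  refine (mul_le_mul a1 a2 (div_nonneg (chi_deriv_nonneg _) (by positivity)) (by positivity)).trans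
    (le_of_eq ?_)
  rw [div_pow, ← pow_mul]
  field_simp

/-- `p` -/
def pp (n : ℕ) (s ε R q : ℝ) : ℝ :=
  chi (q / ε ^ 2) * (1 - chi (q / R ^ 2)) * (1 + s * Real.sqrt q / R) * (q ^ n)⁻¹

lemma pp_zero_left (n : ℕ) (s R : ℝ) {ε q : ℝ} (hε : 0 < ε) (hq : q ≤ ε ^ 2 / 2) :
    pp n s ε R q = 0 := by
  unfold pp
  rw [chi_zero]; · simp
  rw [div_le_iff₀ (by positivity)]; linarith

lemma pp_zero_right (n : ℕ) (s ε : ℝ) {R q : ℝ} (hR : 0 < R) (hq : R ^ 2 ≤ q) :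
    pp n s ε R q = 0 := by
  unfold pp
  rw [chi_one (t := q / R ^ 2)]; · simp
  rw [le_div_iff₀ (by positivity)]; linarith

lemma pp_smooth (n : ℕ) (s R : ℝ) {ε : ℝ} (hε : 0 < ε) : ContDiff ℝ (⊤ : ℕ∞) (pp n s ε R) := by
  rw [contDiff_iff_contDiffAt]
  intro q
  by_cases hq : q < ε ^ 2 / 2
  · have : pp n s ε R =ᶠ[𝓝 q] fun _ => 0 := by
      filter_upwards [Iio_mem_nhds hq] with t ht
      exact pp_zero_left n s R hε (le_of_lt ht)
    exact contDiffAt_const.congr_of_eventuallyEq this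
  · push Not at hq
    have hq0 : 0 < q := lt_of_lt_of_le (by positivity) hq
    unfold pp
    have c1 : ContDiffAt ℝ (⊤ : ℕ∞) (fun q => chi (q / ε ^ 2)) q :=
      (chi_smooth.comp (contDiff_id.div_const _)).contDiffAt
    have c2 : ContDiffAt ℝ (⊤ : ℕ∞) (fun q => 1 - chi (q / R ^ 2)) q :=
      contDiffAt_const.sub (chi_smooth.comp (contDiff_id.div_const _)).contDiffAt
    have c3 : ContDiffAt ℝ (⊤ : ℕ∞) (fun q => 1 + s * Real.sqrt q / R) q :=
      contDiffAt_const.add ((contDiffAt_const.mul (contDiffAt_id.sqrt hq0.ne')).div_const _)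
    have c4 : ContDiffAt ℝ (⊤ : ℕ∞) (fun q : ℝ => (q ^ n)⁻¹) q :=
      (contDiffAt_id.pow n).inv (by simpa using (pow_pos hq0 n).ne')
    exact ((c1.mul c2).mul c3).mul c4

/-- key identity: `q p' = - n p + Γ` -/
lemma pp_deriv (n : ℕ) (s : ℝ) {ε R q : ℝ} (hε : 0 < ε) (hR : 0 < R) (hεR : ε ^ 2 ≤ R ^ 2 / 2)
    (hq : 0 < q) :
    q * deriv (pp n s ε R) q = - n * pp n s ε R q
      + (kk n ε q * (1 + s * Real.sqrt q / R)
        + (chi (q / ε ^ 2) * (1 - chi (q / R ^ 2)) * (q ^ n)⁻¹) * s * Real.sqrt q / (2 * R)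
        - kk n R q * (1 + s * Real.sqrt q / R)) := by
  have d1 : HasDerivAt (fun q => chi (q / ε ^ 2)) (deriv chi (q / ε ^ 2) * (1 / ε ^ 2)) q :=
    ((chi_smooth.differentiable (by simp) _).hasDerivAt).comp q ((hasDerivAt_id q).div_const _)
  have d2 : HasDerivAt (fun q => 1 - chi (q / R ^ 2)) (-(deriv chi (q / R ^ 2) * (1 / R ^ 2))) q :=
    (((chi_smooth.differentiable (by simp) _).hasDerivAt).comp q
      ((hasDerivAt_id q).div_const _)).const_sub 1
  have d3 : HasDerivAt (fun q => 1 + s * Real.sqrt q / R) (s * (1 / (2 * Real.sqrt q)) / R) q :=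
    (((Real.hasDerivAt_sqrt hq.ne').const_mul s).div_const R).const_add 1
  have d4 : HasDerivAt (fun q : ℝ => (q ^ n)⁻¹) (-(n * q ^ (n - 1)) / (q ^ n) ^ 2) q :=
    (hasDerivAt_pow n q).fun_inv (pow_pos hq n).ne'
  have d := ((d1.mul d2).mul d3).mul d4
  have hd : deriv (pp n s ε R) q = _ := d.deriv
  rw [hd]
  have hs : 0 < Real.sqrt q := Real.sqrt_pos.2 hq
  have hss : Real.sqrt q * Real.sqrt q = q := Real.mul_self_sqrt hq.le
  have hk : kk n ε q * (1 - chi (q / R ^ 2)) = kk n ε q := by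
    by_cases h : ε ^ 2 ≤ q
    · rw [kk_zero_right n hε h]; simp
    · rw [chi_zero (t := q / R ^ 2)]; · simp
      rw [div_le_iff₀ (by positivity)]; linarith
  have hT : kk n R q * chi (q / ε ^ 2) = kk n R q := by
    by_cases h : q ≤ R ^ 2 / 2
    · rw [kk_zero_left n hR h]; simp
    · rw [chi_one (t := q / ε ^ 2)]; · simp
      rw [le_div_iff₀ (by positivity)]; linarith
  rw [← hk, ← hT]
  have hqn : q * (-(n * q ^ (n - 1)) / (q ^ n) ^ 2) = - n * (q ^ n)⁻¹ := by
    rcases Nat.eq_zero_or_pos n with h | h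
    · subst h; simp
    · have : q ^ n = q ^ (n - 1) * q := by rw [← pow_succ]; congr 1; omega
      have hp : 0 < q ^ (n - 1) := pow_pos hq _
      rw [this]; field_simp
  have hsq : q * (s * (1 / (2 * Real.sqrt q)) / R) = s * Real.sqrt q / (2 * R) := by
    nth_rewrite 1 [← hss]
    field_simp
  unfold pp kk
  simp only [Pi.mul_apply]
  generalize chi (q / ε ^ 2) = X1 at *
  generalize chi (q / R ^ 2) = X2 at *
  generalize deriv chi (q / ε ^ 2) = Y1 at *
  generalize deriv chi (q / R ^ 2) = Y2 at *
  generalize -(n * q ^ (n - 1)) / (q ^ n) ^ 2 = Z at *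
  generalize s * (1 / (2 * Real.sqrt q)) / R = W at *
  have : ∀ a b c d e : ℝ, q * ((a * b + c * W) * d + e * Z)
      = q * a * b * d + c * d * (q * W) + e * (q * Z) := by intros; ring
  rw [this, hqn, hsq]
  ring

/-- `f` -/
def ff (n : ℕ) (s ε R q : ℝ) : ℝ := ∫ t in q..R ^ 2, pp n s ε R t

lemma ff_hasDerivAt (n : ℕ) (s R : ℝ) {ε : ℝ} (hε : 0 < ε) (q : ℝ) :
    HasDerivAt (ff n s ε R) (- pp n s ε R q) q := by
  have hc : Continuous (pp n s ε R) := (pp_smooth n s R hε).continuous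
  exact intervalIntegral.integral_hasDerivAt_left (hc.intervalIntegrable _ _)
    (hc.stronglyMeasurableAtFilter _ _) hc.continuousAt

lemma ff_deriv (n : ℕ) (s R : ℝ) {ε : ℝ} (hε : 0 < ε) :
    deriv (ff n s ε R) = fun q => - pp n s ε R q :=
  funext fun q => (ff_hasDerivAt n s R hε q).deriv

lemma ff_smooth (n : ℕ) (s R : ℝ) {ε : ℝ} (hε : 0 < ε) : ContDiff ℝ (⊤ : ℕ∞) (ff n s ε R) := by
  rw [contDiff_infty_iff_deriv]
  refine ⟨fun q => (ff_hasDerivAt n s R hε q).differentiableAt, ?_⟩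
  rw [ff_deriv n s R hε]
  exact (pp_smooth n s R hε).neg

lemma ff_zero (n : ℕ) (s ε : ℝ) {R q : ℝ} (hR : 0 < R) (hq : R ^ 2 ≤ q) : ff n s ε R q = 0 := by
  unfold ff
  rw [intervalIntegral.integral_symm, neg_eq_zero]
  have : ∫ t in (R^2)..q, pp n s ε R t = ∫ t in (R^2)..q, (0:ℝ) := by
    refine intervalIntegral.integral_congr fun t ht => ?_
    rw [Set.uIcc_of_le hq] at ht
    exact pp_zero_right n s ε hR ht.1
  rw [this]; simp

lemma pp_nonneg (n : ℕ) {s ε R q : ℝ} (hs : -1 ≤ s) (hε : 0 < ε) (hR : 0 < R) : 0 ≤ pp n s ε R q := by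
  by_cases h1 : q ≤ ε ^ 2 / 2
  · rw [pp_zero_left n s R hε h1]
  by_cases h2 : R ^ 2 ≤ q
  · rw [pp_zero_right n s ε hR h2]
  push Not at h1 h2
  have hq : 0 < q := lt_trans (by positivity) h1
  unfold pp
  have a1 := chi_nonneg (q / ε ^ 2)
  have a2 : 0 ≤ 1 - chi (q / R ^ 2) := by linarith [chi_le_one (q / R ^ 2)]
  have a3 : 0 ≤ 1 + s * Real.sqrt q / R := by
    have : Real.sqrt q ≤ R := Real.sqrt_le_iff.2 ⟨hR.le, h2.le⟩
    have h3 : Real.sqrt q / R ≤ 1 := by rw [div_le_one hR]; exact this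
    have h4 : 0 ≤ Real.sqrt q / R := by positivity
    rw [mul_div_assoc]
    nlinarith
  positivity

lemma ff_nonneg (n : ℕ) {s ε R q : ℝ} (hs : -1 ≤ s) (hε : 0 < ε) (hR : 0 < R) : 0 ≤ ff n s ε R q := by
  by_cases h : R ^ 2 ≤ q
  · rw [ff_zero n s ε hR h]
  · push Not at h
    exact intervalIntegral.integral_nonneg h.le fun t _ => pp_nonneg n hs hε hR

/-- master estimate -/
lemma prof_est (n : ℕ) {s ε R q C X : ℝ} (hs : -1 ≤ s) (hs1 : s ≤ 1) (hε : 0 < ε) (hR : 0 < R)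
    (hεR : ε ^ 2 ≤ R ^ 2 / 2) (hC : 0 ≤ C) (hCR : C * (n + 1) * R ≤ 1 / 4) (hq : 0 < q) (hqR : q ≤ R ^ 2)
    (hX : |X - (4 * q * deriv (deriv (ff n s ε R)) q + 2 * (2 * n : ℝ) * deriv (ff n s ε R) q)|
      ≤ C * Real.sqrt q * (q * |deriv (deriv (ff n s ε R)) q| + |deriv (ff n s ε R) q|)) :
    let a := chi (q / ε ^ 2) * (1 - chi (q / R ^ 2)) * (q ^ n)⁻¹ * Real.sqrt q / R
    let g := 1 + s * Real.sqrt q / R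
    |X + 4 * kk n ε q * g + 2 * a * s - 4 * kk n R q * g| ≤
      1 / 4 * (a * g + kk n ε q * g + a * |s| / 2 + kk n R q * g) := by
  intro a g
  set m := chi (q / ε ^ 2) * (1 - chi (q / R ^ 2)) * (q ^ n)⁻¹ with hm
  set σ := Real.sqrt q with hσ
  have hσ0 : 0 < σ := Real.sqrt_pos.2 hq
  have hσR : σ ≤ R := Real.sqrt_le_iff.2 ⟨hR.le, hqR⟩
  have hm0 : 0 ≤ m := by
    have a1 := chi_nonneg (q / ε ^ 2)
    have a2 : 0 ≤ 1 - chi (q / R ^ 2) := by linarith [chi_le_one (q / R ^ 2)]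
    positivity
  have ha : a = m * σ / R := rfl
  have ha0 : 0 ≤ a := by rw [ha]; positivity
  have hpa : pp n s ε R q = m * g := by
    simp only [pp, hm, g]; ring
  have hg0 : 0 ≤ g := by
    have h3 : σ / R ≤ 1 := by rw [div_le_one hR]; exact hσR
    have h4 : 0 ≤ σ / R := by positivity
    simp only [g]
    rw [mul_div_assoc]
    nlinarith
  have hk := kk_nonneg n ε hq.le
  have hT := kk_nonneg n R hq.le
  have hd := pp_deriv n s hε hR hεR hq
  have hdd : deriv (deriv (ff n s ε R)) q = - deriv (pp n s ε R) q := by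
    rw [ff_deriv n s R hε]; exact deriv.fun_neg
  have hd1 : deriv (ff n s ε R) q = - pp n s ε R q := by rw [ff_deriv n s R hε]
  rw [hdd, hd1, abs_neg, abs_neg] at hX
  set k := kk n ε q
  set T := kk n R q
  set p' := deriv (pp n s ε R) q
  have hG : m * s * σ / (2 * R) = a * s / 2 := by rw [ha]; field_simp
  rw [hpa, ← hm] at hd
  change q * p' = - n * (m * g) + (k * g + m * s * σ / (2 * R) - T * g) at hd
  rw [hG] at hd
  rw [hpa] at hX
  have e1 : X - (4 * q * -p' + 2 * (2 * n) * -(m * g)) = X + 4 * k * g + 2 * a * s - 4 * T * g := by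
    have : 4 * q * -p' = -4 * (q * p') := by ring
    rw [this, hd]; ring
  rw [e1] at hX
  refine hX.trans ?_
  have hmg : 0 ≤ m * g := mul_nonneg hm0 hg0
  have e2 : q * |p'| + |m * g| ≤ (n + 1) * (m * g) + (k * g + a * |s| / 2 + T * g) := by
    have : q * |p'| = |q * p'| := by rw [abs_mul, abs_of_pos hq]
    rw [this, hd, abs_of_nonneg hmg]
    have hn : (0:ℝ) ≤ n := Nat.cast_nonneg _
    have h1 : |-(n:ℝ) * (m * g) + (k * g + a * s / 2 - T * g)|
        ≤ n * (m * g) + (k * g + a * |s| / 2 + T * g) := by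
      have i1 : |-(n:ℝ) * (m * g)| = n * (m * g) := by
        rw [abs_mul, abs_neg, abs_of_nonneg hn, abs_of_nonneg hmg]
      have i2 : |k * g + a * s / 2 - T * g| ≤ k * g + a * |s| / 2 + T * g := by
        refine (abs_sub _ _).trans ?_
        rw [abs_of_nonneg (mul_nonneg hT hg0)]
        refine add_le_add ((abs_add_le _ _).trans ?_) le_rfl
        rw [abs_of_nonneg (mul_nonneg hk hg0), abs_div, abs_mul, abs_of_nonneg ha0]
        norm_num
      refine (abs_add_le _ _).trans ?_
      rw [i1]; linarith
    linarith
  have hn : (0:ℝ) ≤ n := Nat.cast_nonneg _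
  have hCσ0 : 0 ≤ C * σ := mul_nonneg hC hσ0.le
  refine (mul_le_mul_of_nonneg_left e2 hCσ0).trans ?_
  have hCσ : C * σ ≤ 1 / 4 := by
    have : C * σ ≤ C * R := mul_le_mul_of_nonneg_left hσR hC
    have h2 : 0 ≤ C * R * n := by positivity
    nlinarith
  have j1 : C * σ * ((n + 1) * (m * g)) ≤ 1 / 4 * (a * g) := by
    have : C * σ * ((n + 1) * (m * g)) = (C * (n + 1) * R) * (a * g) := by
      rw [ha]; field_simp
    rw [this]
    exact mul_le_mul_of_nonneg_right hCR (mul_nonneg ha0 hg0)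
  have j2 : C * σ * (k * g + a * |s| / 2 + T * g) ≤ 1 / 4 * (k * g + a * |s| / 2 + T * g) := by
    refine mul_le_mul_of_nonneg_right hCσ ?_
    have := abs_nonneg s
    have := mul_nonneg hk hg0
    have := mul_nonneg hT hg0
    positivity
  rw [mul_add]
  linarith

lemma prof_upper (n : ℕ) {ε R q C X M : ℝ} (hM : 0 < M) (hMb : ∀ t, deriv chi t ≤ M)
    (hε : 0 < ε) (hR : 0 < R)
    (hεR : ε ^ 2 ≤ R ^ 2 / 2) (hC : 0 ≤ C) (hCR : C * (n + 1) * R ≤ 1 / 4) (hq : 0 < q) (hqR : q ≤ R ^ 2)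
    (hX : |X - (4 * q * deriv (deriv (ff n 1 ε R)) q + 2 * (2 * n : ℝ) * deriv (ff n 1 ε R) q)|
      ≤ C * Real.sqrt q * (q * |deriv (deriv (ff n 1 ε R)) q| + |deriv (ff n 1 ε R) q|)) :
    X ≤ - 3 * kk n ε q + 9 * (2 ^ n * M * (R ^ (2 * n))⁻¹) := by
  have h := prof_est n (s := 1) (by norm_num) le_rfl hε hR hεR hC hCR hq hqR hX
  simp only [one_mul, mul_one, abs_one] at h
  set a := chi (q / ε ^ 2) * (1 - chi (q / R ^ 2)) * (q ^ n)⁻¹ * Real.sqrt q / R with ha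
  have ha0 : 0 ≤ a := by
    have a1 := chi_nonneg (q / ε ^ 2)
    have a2 : 0 ≤ 1 - chi (q / R ^ 2) := by linarith [chi_le_one (q / R ^ 2)]
    positivity
  have hr0 : 0 ≤ Real.sqrt q / R := by positivity
  have hr1 : Real.sqrt q / R ≤ 1 := by
    rw [div_le_one hR]; exact Real.sqrt_le_iff.2 ⟨hR.le, hqR⟩
  set r := Real.sqrt q / R
  have hk := kk_nonneg n ε hq.le
  have hT := kk_nonneg n R hq.le
  have hTb := kk_bound hM hMb n (q := q) hR
  set k := kk n ε q
  set T := kk n R q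
  have h' := (abs_le.1 h).2
  have := mul_nonneg ha0 hr0
  have := mul_nonneg hk hr0
  have := mul_nonneg hT hr0
  have := mul_nonneg ha0 (sub_nonneg.2 hr1)
  have := mul_nonneg hk (sub_nonneg.2 hr1)
  have := mul_nonneg hT (sub_nonneg.2 hr1)
  nlinarith

lemma prof_lower (n : ℕ) (hn : 1 ≤ n) {ε R q C X : ℝ}
    (hε : 0 < ε) (hR : 0 < R)
    (hεR : ε ^ 2 ≤ R ^ 2 / 2) (hC : 0 ≤ C) (hCR : C * (n + 1) * R ≤ 1 / 4) (hq : 0 < q) (hqR : q ≤ R ^ 2)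
    (hX : |X - (4 * q * deriv (deriv (ff n (-1/2) ε R)) q + 2 * (2 * n : ℝ) * deriv (ff n (-1/2) ε R) q)|
      ≤ C * Real.sqrt q * (q * |deriv (deriv (ff n (-1/2) ε R)) q| + |deriv (ff n (-1/2) ε R) q|)) :
    - 5 * kk n ε q ≤ X ∧ (ε ^ 2 ≤ q → q ≤ R ^ 2 / 2 → 1 / 2 * (R ^ (2 * n))⁻¹ ≤ X) := by
  have h := prof_est n (s := -1/2) (by norm_num) (by norm_num) hε hR hεR hC hCR hq hqR hX
  simp only [] at h
  rw [show |(-1/2:ℝ)| = 1/2 by norm_num [abs_of_neg]] at h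
  set a := chi (q / ε ^ 2) * (1 - chi (q / R ^ 2)) * (q ^ n)⁻¹ * Real.sqrt q / R with ha
  have ha0 : 0 ≤ a := by
    have a1 := chi_nonneg (q / ε ^ 2)
    have a2 : 0 ≤ 1 - chi (q / R ^ 2) := by linarith [chi_le_one (q / R ^ 2)]
    positivity
  have hr0 : 0 ≤ Real.sqrt q / R := by positivity
  have hr1 : Real.sqrt q / R ≤ 1 := by
    rw [div_le_one hR]; exact Real.sqrt_le_iff.2 ⟨hR.le, hqR⟩
  rw [mul_div_assoc (-1/2:ℝ)] at h
  set r := Real.sqrt q / R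
  have hk := kk_nonneg n ε hq.le
  have hT := kk_nonneg n R hq.le
  set k := kk n ε q with hkdef
  set T := kk n R q with hTdef
  have h' := (abs_le.1 h).1
  have main : -5 * k + 1 / 2 * a ≤ X := by
    have := mul_nonneg ha0 hr0
    have := mul_nonneg hk hr0
    have := mul_nonneg hT hr0
    have := mul_nonneg ha0 (sub_nonneg.2 hr1)
    have := mul_nonneg hk (sub_nonneg.2 hr1)
    have := mul_nonneg hT (sub_nonneg.2 hr1)
    nlinarith
  refine ⟨by linarith, fun h1 h2 => ?_⟩
  have hk0 : k = 0 := kk_zero_right n hε h1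
  have hae : a = (q ^ n)⁻¹ * Real.sqrt q / R := by
    rw [ha, chi_one, chi_zero (t := q / R ^ 2)]; · ring
    · rw [div_le_iff₀ (by positivity)]; linarith
    · rw [le_div_iff₀ (by positivity)]; linarith
  have hlow : (R ^ (2 * n))⁻¹ ≤ a := by
    rw [hae]
    have hσ0 : 0 < Real.sqrt q := Real.sqrt_pos.2 hq
    have hσR : Real.sqrt q ≤ R := Real.sqrt_le_iff.2 ⟨hR.le, hqR⟩
    have : q ^ n = Real.sqrt q ^ (2 * n - 1) * Real.sqrt q := by
      rw [← pow_succ, show 2 * n - 1 + 1 = 2 * n by omega, pow_mul, Real.sq_sqrt hq.le]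
    have hR2 : R ^ (2 * n) = R ^ (2 * n - 1) * R := by
      rw [← pow_succ, show 2 * n - 1 + 1 = 2 * n by omega]
    have e : (q ^ n)⁻¹ * Real.sqrt q / R = (Real.sqrt q ^ (2 * n - 1) * R)⁻¹ := by
      rw [this]; field_simp
    rw [e, hR2]
    gcongr
  rw [hk0] at main
  linarith

end Prof

end ASub

end



noncomputable section

namespace ASub

set_option linter.unusedSectionVars false

section Kern

variable {ι : Type*} [Fintype ι] [DecidableEq ι] {E : Type*} [NormedAddCommGroup E] [NormedSpace ℝ E]
  [FiniteDimensional ℝ E] [MeasurableSpace E] [BorelSpace E] (μ : Measure E) [μ.IsAddHaarMeasure]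
  {e : ι → E} (A : Ell e)

lemma Rad.sub_ball {C : ℝ} (hC : 1 ≤ C) {y : E} {Q : E → ℝ} (h : Rad A C y Q) {R : ℝ} (hR : 0 < R)
    {x : E} (hx : Q x ≤ R ^ 2) : ‖x - y‖ ≤ C * R := by
  have h1 := h.lower x
  have h2 : ‖x - y‖ ^ 2 ≤ (C * R) ^ 2 := by
    have : C * Q x ≤ C * R ^ 2 := mul_le_mul_of_nonneg_left hx (by linarith)
    have h3 : 0 ≤ (C - 1) * C * R ^ 2 := by
      have : 0 ≤ C - 1 := by linarith
      positivity
    nlinarith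
  exact abs_le_of_sq_le_sq' h2 (by positivity) |>.2

variable {n : ℕ}

lemma kern_supp {C : ℝ} (hC : 1 ≤ C) {y : E} {Q : E → ℝ} (h : Rad A C y Q) (s ε : ℝ) {R : ℝ}
    (hR : 0 < R) : tsupport (fun x => ff n s ε R (Q x)) ⊆ {x | Q x ≤ R ^ 2} := by
  apply closure_minimal _ (isClosed_le h.smooth.continuous continuous_const)
  intro x hx
  by_contra hn
  simp only [Set.mem_ofPred_eq, not_le] at hn
  exact hx (ff_zero n s ε hR hn.le)

lemma kern_sub {C : ℝ} (hC : 1 ≤ C) {y : E} {Q : E → ℝ} (h : Rad A C y Q) {R : ℝ}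
    (hR : 0 < R) : {x | Q x ≤ R ^ 2} ⊆ closedBall y (C * R) := by
  intro x hx
  rw [mem_closedBall, dist_eq_norm]
  exact h.sub_ball A hC hR hx

lemma kern_cpt {C : ℝ} (hC : 1 ≤ C) {y : E} {Q : E → ℝ} (h : Rad A C y Q) (s ε : ℝ) {R : ℝ}
    (hR : 0 < R) : HasCompactSupport (fun x => ff n s ε R (Q x)) :=
  HasCompactSupport.of_support_subset_isCompact (isCompact_closedBall y (C * R))
    (subset_closure.trans ((kern_supp A hC h s ε hR).trans (kern_sub A hC h hR)))

lemma kern_smooth {C : ℝ} {y : E} {Q : E → ℝ} (h : Rad A C y Q) (s R : ℝ) {ε : ℝ}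
    (hε : 0 < ε) : ContDiff ℝ (⊤ : ℕ∞) (fun x => ff n s ε R (Q x)) :=
  (ff_smooth n s R hε).comp h.smooth

lemma kern_zero {C : ℝ} (hcard : Fintype.card ι = 2 * n) (hC : 1 ≤ C) {y : E} {Q : E → ℝ} (h : Rad A C y Q) (s R : ℝ) {ε : ℝ}
    (hε : 0 < ε) {x : E} (hx1 : ‖x - y‖ ≤ 1) (hx : Q x = 0) :
    A.L (fun x => ff n s ε R (Q x)) x = 0 := by
  have := h.est _ ((ff_smooth n s R hε).of_le two_le_infty) x hx1
  have hp0 : pp n s ε R 0 = 0 := pp_zero_left n s R hε (by positivity)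
  rw [hx, ff_deriv n s R hε] at this
  simpa [hp0] using this

lemma kern_upper {C M : ℝ} (hM : 0 < M) (hMb : ∀ t, deriv chi t ≤ M)
    (hcard : Fintype.card ι = 2 * n) (hC : 1 ≤ C) {y : E} {Q : E → ℝ} (h : Rad A C y Q)
    {ε R : ℝ} (hε : 0 < ε) (hR : 0 < R) (hεR : ε ^ 2 ≤ R ^ 2 / 2) (hCR : C * (n + 1) * R ≤ 1 / 4) (x : E) :
    A.L (fun x => ff n 1 ε R (Q x)) x ≤ - 3 * kk n ε (Q x)
      + (closedBall y (C * R)).indicator (fun _ => 9 * (2 ^ n * M * (R ^ (2 * n))⁻¹)) x := by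
  have hpos : 0 ≤ 9 * (2 ^ n * M * (R ^ (2 * n))⁻¹) := by positivity
  have hR2 : 0 < R ^ 2 := by positivity
  by_cases hx : Q x ≤ R ^ 2
  · have hb := kern_sub A hC h hR hx
    rw [Set.indicator_of_mem hb]
    have hx1 : ‖x - y‖ ≤ 1 := by
      have := h.sub_ball A hC hR hx
      have h2 : 0 ≤ C * R * n := by positivity
      nlinarith
    rcases (h.nonneg A hC x).eq_or_lt with h0 | h0
    · rw [kern_zero A hcard hC h 1 R hε hx1 h0.symm, ← h0, kk_zero_left n hε (by positivity)]
      simpa using hpos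
    · refine prof_upper n hM hMb hε hR hεR (by linarith : 0 ≤ C) hCR h0 hx ?_
      have := h.est _ ((ff_smooth n 1 R hε).of_le two_le_infty) x hx1
      rw [hcard] at this
      push_cast at this
      exact this
  · push Not at hx
    rw [L_eq_zero_of_notMem A, kk_zero_right n hε (by linarith)]
    · have := Set.indicator_nonneg (s := closedBall y (C * R)) (f := fun _ : E => 9 * (2 ^ n * M * (R ^ (2 * n))⁻¹)) (fun _ _ => hpos) x
      simpa using this
    · intro hm
      have := kern_supp A hC h 1 ε hR hm
      simp only [Set.mem_ofPred_eq] at this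
      linarith

lemma kern_lower {C : ℝ} (hn : 1 ≤ n)
    (hcard : Fintype.card ι = 2 * n) (hC : 1 ≤ C) {y : E} {Q : E → ℝ} (h : Rad A C y Q)
    {ε R : ℝ} (hε : 0 < ε) (hR : 0 < R) (hεR : ε ^ 2 ≤ R ^ 2 / 2) (hCR : C * (n + 1) * R ≤ 1 / 4) (x : E) :
    - 5 * kk n ε (Q x) + {x | ε ^ 2 ≤ Q x ∧ Q x ≤ R ^ 2 / 2}.indicator (fun _ => 1 / 2 * (R ^ (2 * n))⁻¹) x
      ≤ A.L (fun x => ff n (-1/2) ε R (Q x)) x := by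
  have hR2 : 0 < R ^ 2 := by positivity
  have hε2 : 0 < ε ^ 2 := by positivity
  by_cases hx : Q x ≤ R ^ 2
  · have hb := kern_sub A hC h hR hx
    have hx1 : ‖x - y‖ ≤ 1 := by
      have := h.sub_ball A hC hR hx
      have h2 : 0 ≤ C * R * n := by positivity
      nlinarith
    rcases (h.nonneg A hC x).eq_or_lt with h0 | h0
    · rw [kern_zero A hcard hC h _ R hε hx1 h0.symm, Set.indicator_of_notMem, ← h0,
        kk_zero_left n hε (by positivity)]
      · simp
      · simp only [Set.mem_ofPred_eq, ← h0]; intro h; linarith [h.1]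
    · have := h.est _ ((ff_smooth n (-1/2) R hε).of_le two_le_infty) x hx1
      rw [hcard] at this
      push_cast at this
      obtain ⟨p1, p2⟩ := prof_lower n hn hε hR hεR (by linarith : 0 ≤ C) hCR h0 hx this
      by_cases hm : x ∈ {x | ε ^ 2 ≤ Q x ∧ Q x ≤ R ^ 2 / 2}
      · rw [Set.indicator_of_mem hm, kk_zero_right n hε hm.1]
        have := p2 hm.1 hm.2
        linarith
      · rw [Set.indicator_of_notMem hm]; linarith
  · push Not at hx
    rw [L_eq_zero_of_notMem A, kk_zero_right n hε (by linarith), Set.indicator_of_notMem]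
    · simp
    · simp only [Set.mem_ofPred_eq]; intro h; linarith [h.2]
    · intro hm
      have := kern_supp A hC h _ ε hR hm
      simp only [Set.mem_ofPred_eq] at this
      linarith

lemma kk_measurable (n : ℕ) (ε : ℝ) : Measurable (kk n ε) := by
  unfold kk
  have := chi_deriv_continuous.measurable
  have h2 : Measurable fun q : ℝ => deriv chi (q / ε ^ 2) := this.comp (measurable_id.div_const _)
  exact (measurable_id.mul (measurable_id.pow_const n).inv).mul (h2.div_const _)

variable {μ}

lemma kk_integrable {C : ℝ} (hC : 1 ≤ C) {y : E} {Q : E → ℝ} (h : Rad A C y Q) (n : ℕ) {ε : ℝ}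
    (hε : 0 < ε) {v : E → ℝ} (hv : Integrable v μ) : Integrable (fun x => v x * kk n ε (Q x)) μ := by
  obtain ⟨M, hM, hMb⟩ := exists_chi_bound
  refine Integrable.mul_bdd (c := 2 ^ n * M * (ε ^ (2 * n))⁻¹) hv
    ((kk_measurable n ε).comp h.smooth.continuous.measurable).aestronglyMeasurable ?_
  refine Eventually.of_forall fun x => ?_
  rw [Real.norm_eq_abs, abs_of_nonneg (kk_nonneg n ε (h.nonneg A hC x))]
  exact kk_bound hM hMb n hε

lemma M1_int {C M : ℝ} (hM : 0 < M) (hMb : ∀ t, deriv chi t ≤ M)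
    (hcard : Fintype.card ι = 2 * n) (hC : 1 ≤ C) {y : E} {Q : E → ℝ} (h : Rad A C y Q)
    {ε R : ℝ} (hε : 0 < ε) (hR : 0 < R) (hεR : ε ^ 2 ≤ R ^ 2 / 2) (hCR : C * (n + 1) * R ≤ 1 / 4)
    {Ω : Set E} {v : E → ℝ} (hv : DS μ A Ω v) (hvi : Integrable v μ) (hv0 : ∀ x, 0 ≤ v x)
    (hΩ : closedBall y (C * R) ⊆ Ω) :
    3 * ∫ x, v x * kk n ε (Q x) ∂μ ≤ 9 * (2 ^ n * M * (R ^ (2 * n))⁻¹) * ∫ x in closedBall y (C * R), v x ∂μ := by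
  set c := 9 * (2 ^ n * M * (R ^ (2 * n))⁻¹) with hc
  have hs := (kern_supp (n := n) A hC h 1 ε hR).trans ((kern_sub A hC h hR).trans hΩ)
  have h1 := hv.2 _ (kern_smooth (n := n) A h 1 R hε) (kern_cpt A hC h 1 ε hR) hs
    (fun x => ff_nonneg n (by norm_num) hε hR)
  have i1 := integrable_mul_L A hv.1 (kern_smooth (n := n) A h 1 R hε) (kern_cpt A hC h 1 ε hR) hs
  have i2 := kk_integrable A hC h n hε hvi
  have i3 : Integrable ((closedBall y (C * R)).indicator v) μ := hvi.indicator measurableSet_closedBall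
  have h2 : ∫ x, v x * A.L (fun x => ff n 1 ε R (Q x)) x ∂μ ≤
      ∫ x, (- 3 * (v x * kk n ε (Q x)) + c * (closedBall y (C * R)).indicator v x) ∂μ := by
    refine integral_mono i1 ((i2.const_mul _).add (i3.const_mul _)) fun x => ?_
    have := mul_le_mul_of_nonneg_left (kern_upper A hM hMb hcard hC h hε hR hεR hCR x) (hv0 x)
    refine this.trans (le_of_eq ?_)
    simp only [← hc]
    by_cases hx : x ∈ closedBall y (C * R)
    · simp only [Set.indicator_of_mem hx]; ring
    · simp only [Set.indicator_of_notMem hx]; ring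
  rw [integral_add (i2.const_mul _) (i3.const_mul _), integral_const_mul, integral_const_mul,
    integral_indicator measurableSet_closedBall] at h2
  linarith

lemma M2_int {C : ℝ} (hn : 1 ≤ n)
    (hcard : Fintype.card ι = 2 * n) (hC : 1 ≤ C) {y : E} {Q : E → ℝ} (h : Rad A C y Q)
    {ε R : ℝ} (hε : 0 < ε) (hR : 0 < R) (hεR : ε ^ 2 ≤ R ^ 2 / 2) (hCR : C * (n + 1) * R ≤ 1 / 4)
    {Ω : Set E} {w : E → ℝ} (hw : DS μ A Ω (fun x => - w x)) (hwi : Integrable w μ) (hw0 : ∀ x, 0 ≤ w x)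
    (hΩ : closedBall y (C * R) ⊆ Ω) :
    1 / 2 * (R ^ (2 * n))⁻¹ * ∫ x in {x | ε ^ 2 ≤ Q x ∧ Q x ≤ R ^ 2 / 2}, w x ∂μ
      ≤ 5 * ∫ x, w x * kk n ε (Q x) ∂μ := by
  set c := 1 / 2 * (R ^ (2 * n))⁻¹ with hc
  set S := {x | ε ^ 2 ≤ Q x ∧ Q x ≤ R ^ 2 / 2} with hS
  have hSm : MeasurableSet S :=
    ((isClosed_le continuous_const h.smooth.continuous).inter
      (isClosed_le h.smooth.continuous continuous_const)).measurableSet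
  have hs := (kern_supp (n := n) A hC h (-1/2) ε hR).trans ((kern_sub A hC h hR).trans hΩ)
  have h1 := hw.2 _ (kern_smooth (n := n) A h (-1/2) R hε) (kern_cpt A hC h (-1/2) ε hR) hs
    (fun x => ff_nonneg n (by norm_num) hε hR)
  have i1 := integrable_mul_L A hw.1 (kern_smooth (n := n) A h (-1/2) R hε) (kern_cpt A hC h (-1/2) ε hR) hs
  have i2 := kk_integrable A hC h n hε hwi
  have i3 : Integrable (S.indicator w) μ := hwi.indicator hSm
  have h2 : ∫ x, - w x * A.L (fun x => ff n (-1/2) ε R (Q x)) x ∂μ ≤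
      ∫ x, (5 * (w x * kk n ε (Q x)) + -c * S.indicator w x) ∂μ := by
    refine integral_mono i1 ((i2.const_mul _).add (i3.const_mul _)) fun x => ?_
    have := mul_le_mul_of_nonneg_left (kern_lower A hn hcard hC h hε hR hεR hCR x) (hw0 x)
    have h3 : - w x * A.L (fun x => ff n (-1/2) ε R (Q x)) x ≤
      - (w x * (-5 * kk n ε (Q x) + S.indicator (fun _ => c) x)) := by
      rw [neg_mul]; exact neg_le_neg this
    refine h3.trans (le_of_eq ?_)
    by_cases hx : x ∈ S
    · simp only [Set.indicator_of_mem hx]; ring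
    · simp only [Set.indicator_of_notMem hx]; ring
  rw [integral_add (i2.const_mul _) (i3.const_mul _), integral_const_mul, integral_const_mul,
    integral_indicator hSm] at h2
  linarith

end Kern

end ASub

end



noncomputable section

namespace ASub

set_option linter.unusedSectionVars false

section Leb

variable {ι : Type*} [Fintype ι] [DecidableEq ι] {E : Type*} [NormedAddCommGroup E] [NormedSpace ℝ E]
  [FiniteDimensional ℝ E] [MeasurableSpace E] [BorelSpace E] (μ : Measure E) [μ.IsAddHaarMeasure]
  {e : ι → E} (A : Ell e) {n : ℕ}

/-- Lebesgue point property -/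
def LP (C : ℝ) (v : E → ℝ) (y : E) : Prop :=
  Tendsto (fun ε : ℝ => ⨍ x in closedBall y (C * ε), |v x - v y| ∂μ) (𝓝[>] 0) (𝓝 0)

lemma ae_LP {C : ℝ} (hC : 1 ≤ C) {v : E → ℝ} (hv : Integrable v μ) : ∀ᵐ y ∂μ, LP μ C v y := by
  filter_upwards [IsUnifLocDoublingMeasure.ae_tendsto_average_norm_sub (μ := μ) hv.locallyIntegrable 1] with y hy
  have := hy (l := 𝓝[>] (0:ℝ)) (fun _ => y) (fun ε => C * ε) ?_ ?_
  · unfold LP; simpa only [Real.norm_eq_abs] using this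
  · rw [tendsto_nhdsWithin_iff]
    constructor
    · have : Tendsto (fun ε : ℝ => C * ε) (𝓝 0) (𝓝 (C * 0)) := (continuous_const.mul continuous_id).tendsto 0
      rw [mul_zero] at this
      exact this.mono_left nhdsWithin_le_nhds
    · filter_upwards [self_mem_nhdsWithin] with ε hε
      have hε2 : (0:ℝ) < ε := hε
      exact mul_pos (by linarith : (0:ℝ) < C) hε2
  · filter_upwards [self_mem_nhdsWithin] with ε hε
    apply mem_closedBall_self
    have : (0:ℝ) < ε := hε
    positivity

lemma vol_ball (hfr : Module.finrank ℝ E = 2 * n) (y : E) {r : ℝ} (hr : 0 ≤ r) :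
    μ.real (closedBall y r) = r ^ (2 * n) * μ.real (closedBall 0 1) := by
  rw [Measure.addHaar_real_closedBall' μ y hr, hfr]

lemma vball_pos : 0 < μ.real (closedBall (0:E) 1) :=
  ENNReal.toReal_pos (measure_closedBall_pos μ 0 one_pos).ne' measure_closedBall_lt_top.ne

variable {μ}

lemma int_eq_avg {s : Set E} (hs : 0 < μ.real s) (f : E → ℝ) :
    ∫ x in s, f x ∂μ = μ.real s * ⨍ x in s, f x ∂μ := by
  rw [setAverage_eq, smul_eq_mul]
  field_simp

lemma kk_off {C : ℝ} (hC : 1 ≤ C) {y : E} {Q : E → ℝ} (h : Rad A C y Q) {ε : ℝ} (hε : 0 < ε)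
    {x : E} (hx : x ∉ closedBall y (C * ε)) : kk n ε (Q x) = 0 := by
  apply kk_zero_right n hε
  by_contra hn
  push Not at hn
  exact hx (kern_sub A hC h hε hn.le)

lemma kk_conv {C M : ℝ} (hM : 0 < M) (hMb : ∀ t, deriv chi t ≤ M) (hfr : Module.finrank ℝ E = 2 * n)
    (hC : 1 ≤ C) {y : E} {Q : E → ℝ} (h : Rad A C y Q) {ε : ℝ} (hε : 0 < ε) {v : E → ℝ}
    (hv : Integrable v μ) :
    |∫ x, v x * kk n ε (Q x) ∂μ - v y * ∫ x in closedBall y (C * ε), kk n ε (Q x) ∂μ|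
      ≤ 2 ^ n * M * C ^ (2 * n) * μ.real (closedBall (0:E) 1)
        * ⨍ x in closedBall y (C * ε), |v x - v y| ∂μ := by
  have hV := vball_pos μ (E := E)
  set B := closedBall y (C * ε) with hB
  have hC0 : 0 < C := by linarith
  have hBv : μ.real B = (C * ε) ^ (2 * n) * μ.real (closedBall (0:E) 1) := vol_ball μ hfr y (by positivity)
  have hBpos : 0 < μ.real B := by rw [hBv]; positivity
  have h1 : ∫ x, v x * kk n ε (Q x) ∂μ = ∫ x in B, v x * kk n ε (Q x) ∂μ := by
    symm
    apply setIntegral_eq_integral_of_forall_compl_eq_zero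
    intro x hx
    rw [kk_off A hC h hε hx, mul_zero]
  have i1 : IntegrableOn (fun x => v x * kk n ε (Q x)) B μ := (kk_integrable A hC h n hε hv).integrableOn
  have i0 : IntegrableOn (fun x => (1:ℝ)) B μ := integrableOn_const measure_closedBall_lt_top.ne
  have i2 : IntegrableOn (fun x => kk n ε (Q x)) B μ := by
    have : Integrable (B.indicator fun _ => (1:ℝ)) μ := i0.integrable_indicator measurableSet_closedBall
    have := (kk_integrable A hC h n hε this).integrableOn (s := B)
    refine this.congr_fun (fun x hx => ?_) measurableSet_closedBall
    simp [Set.indicator_of_mem hx]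
  have i3 : IntegrableOn (fun x => v x - v y) B μ :=
    hv.integrableOn.sub (integrableOn_const measure_closedBall_lt_top.ne)
  rw [h1, ← integral_const_mul, ← integral_sub i1 (i2.const_mul _)]
  have h2 : |∫ x in B, (v x * kk n ε (Q x) - v y * kk n ε (Q x)) ∂μ|
      ≤ ∫ x in B, (2 ^ n * M * (ε ^ (2 * n))⁻¹) * |v x - v y| ∂μ := by
    refine abs_integral_le_integral_abs.trans ?_
    refine integral_mono_of_nonneg (Eventually.of_forall fun x => abs_nonneg _) (i3.abs.const_mul _)
      (Eventually.of_forall fun x => ?_)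
    simp only
    rw [← sub_mul, abs_mul, mul_comm, abs_of_nonneg (kk_nonneg n ε (h.nonneg A hC x))]
    exact mul_le_mul_of_nonneg_right (kk_bound hM hMb n hε) (abs_nonneg _)
  refine h2.trans (le_of_eq ?_)
  rw [integral_const_mul, int_eq_avg hBpos, hBv, mul_pow]
  field_simp

lemma kk_upper {C M : ℝ} (hM : 0 < M) (hMb : ∀ t, deriv chi t ≤ M) (hfr : Module.finrank ℝ E = 2 * n)
    (hC : 1 ≤ C) {y : E} {Q : E → ℝ} (h : Rad A C y Q) {ε : ℝ} (hε : 0 < ε) :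
    ∫ x in closedBall y (C * ε), kk n ε (Q x) ∂μ ≤ 2 ^ n * M * C ^ (2 * n) * μ.real (closedBall (0:E) 1) := by
  have hC0 : 0 < C := by linarith
  have h2 : ∫ x in closedBall y (C * ε), kk n ε (Q x) ∂μ ≤
      ∫ x in closedBall y (C * ε), (2 ^ n * M * (ε ^ (2 * n))⁻¹) ∂μ := by
    refine integral_mono_of_nonneg (Eventually.of_forall fun x => kk_nonneg n ε (h.nonneg A hC x))
      (integrableOn_const measure_closedBall_lt_top.ne) (Eventually.of_forall fun x => kk_bound hM hMb n hε)
  refine h2.trans (le_of_eq ?_)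
  rw [setIntegral_const, smul_eq_mul, vol_ball μ hfr y (by positivity), mul_pow]
  field_simp

lemma ring_sub {C : ℝ} (hC : 1 ≤ C) {y : E} {Q : E → ℝ} (h : Rad A C y Q) {ε R : ℝ} (hε : 0 < ε) (hR : 0 < R) :
    closedBall y (R / (2 * C)) \ closedBall y (C * ε) ⊆ {x | ε ^ 2 ≤ Q x ∧ Q x ≤ R ^ 2 / 2} := by
  intro x hx
  have hC0 : 0 < C := by linarith
  constructor
  · by_contra hn
    push Not at hn
    exact hx.2 (kern_sub A hC h hε hn.le)
  · have h1 := h.upper x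
    have h2 : ‖x - y‖ ≤ R / (2 * C) := by rw [← dist_eq_norm]; exact hx.1
    have h3 : ‖x - y‖ ^ 2 ≤ (R / (2 * C)) ^ 2 := pow_le_pow_left₀ (norm_nonneg _) h2 2
    have h4 : C * (R / (2 * C)) ^ 2 ≤ R ^ 2 / 2 := by
      rw [div_pow, mul_div_assoc', div_le_div_iff₀ (by positivity) (by norm_num)]
      have : 0 ≤ R ^ 2 * C * (C - 1) := by
        have : 0 ≤ C - 1 := by linarith
        positivity
      nlinarith [sq_nonneg R, mul_nonneg (sq_nonneg R) hC0.le]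
    exact h1.trans ((mul_le_mul_of_nonneg_left h3 hC0.le).trans h4)

lemma ring_int {C : ℝ} (hC : 1 ≤ C) {y : E} {Q : E → ℝ} (h : Rad A C y Q) {ε R : ℝ} (hε : 0 < ε) (hR : 0 < R)
    {w : E → ℝ} (hwi : Integrable w μ) (hw0 : ∀ x, 0 ≤ w x) :
    ∫ x in closedBall y (R / (2 * C)), w x ∂μ - ∫ x in closedBall y (C * ε), w x ∂μ ≤
      ∫ x in {x | ε ^ 2 ≤ Q x ∧ Q x ≤ R ^ 2 / 2}, w x ∂μ := by
  have h1 : ∫ x in closedBall y (R / (2 * C)) \ closedBall y (C * ε), w x ∂μ ≤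
      ∫ x in {x | ε ^ 2 ≤ Q x ∧ Q x ≤ R ^ 2 / 2}, w x ∂μ :=
    setIntegral_mono_set hwi.integrableOn (Eventually.of_forall hw0)
      (ring_sub A hC h hε hR).eventuallyLE
  have h2 : ∫ x in closedBall y (R / (2 * C)), w x ∂μ ≤
      ∫ x in (closedBall y (R / (2 * C)) \ closedBall y (C * ε)) ∪ closedBall y (C * ε), w x ∂μ :=
    setIntegral_mono_set hwi.integrableOn (Eventually.of_forall hw0)
      (HasSubset.Subset.eventuallyLE (by rw [Set.diff_union_self]; exact Set.subset_union_left))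
  rw [setIntegral_union Set.disjoint_sdiff_left measurableSet_closedBall hwi.integrableOn hwi.integrableOn] at h2
  linarith

lemma kk_lower {C : ℝ} (hn : 1 ≤ n) (hcard : Fintype.card ι = 2 * n)
    (hfr : Module.finrank ℝ E = 2 * n)
    (hC : 1 ≤ C) {y : E} {Q : E → ℝ} (h : Rad A C y Q) {ε R : ℝ} (hε : 0 < ε) (hR : 0 < R)
    (hCR : C * (n + 1) * R ≤ 1 / 4) (hεR : ε ≤ R / (4 * C ^ 2)) :
    μ.real (closedBall (0:E) 1) * ((2 * C) ^ (2 * n))⁻¹ / 20 ≤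
      ∫ x in closedBall y (C * ε), kk n ε (Q x) ∂μ := by
  have hV := vball_pos μ (E := E)
  have hC0 : 0 < C := by linarith
  have hC2 : 1 ≤ C ^ 2 := one_le_pow₀ hC
  have hεR' : ε ≤ R / 4 := by
    refine hεR.trans ?_
    gcongr
    linarith
  have hεR2 : ε ^ 2 ≤ R ^ 2 / 2 := by nlinarith
  set Ω := closedBall y (C * R) with hΩ
  set w : E → ℝ := Ω.indicator fun _ => 1 with hw
  have hwi : Integrable w μ :=
    (integrableOn_const (C := (1:ℝ)) measure_closedBall_lt_top.ne).integrable_indicator measurableSet_closedBall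
  have hw0 : ∀ x, 0 ≤ w x := fun x => Set.indicator_nonneg (fun _ _ => zero_le_one) x
  have hDS : DS μ A Ω (fun x => - w x) := by
    refine (DS.const (-1) : DS μ A Ω (fun _ => -1)).congr_ae measurableSet_closedBall (Eventually.of_forall fun x hx => ?_)
    simp [hw, Set.indicator_of_mem hx]
  have k1 := M2_int A hn hcard hC h hε hR hεR2 hCR hDS hwi hw0 subset_rfl
  have k2 := ring_int A hC h hε hR hwi hw0
  have hb1 : closedBall y (R / (2 * C)) ⊆ Ω := by
    apply closedBall_subset_closedBall
    rw [div_le_iff₀ (by positivity)]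
    nlinarith
  have hb2 : closedBall y (C * ε) ⊆ Ω := by
    apply closedBall_subset_closedBall
    gcongr; linarith
  have val : ∀ s : Set E, MeasurableSet s → s ⊆ Ω → ∫ x in s, w x ∂μ = μ.real s := by
    intro s hs hsub
    have : ∫ x in s, w x ∂μ = ∫ x in s, (1:ℝ) ∂μ :=
      setIntegral_congr_fun hs fun x hx => by simp [hw, Set.indicator_of_mem (hsub hx)]
    rw [this]; simp
  rw [val _ measurableSet_closedBall hb1, val _ measurableSet_closedBall hb2,
    vol_ball μ hfr y (by positivity), vol_ball μ hfr y (by positivity)] at k2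
  have k3 : ∫ x, w x * kk n ε (Q x) ∂μ = ∫ x in closedBall y (C * ε), kk n ε (Q x) ∂μ := by
    rw [← integral_indicator measurableSet_closedBall]
    congr 1; funext x
    by_cases hx : x ∈ closedBall y (C * ε)
    · simp [hw, Set.indicator_of_mem hx, Set.indicator_of_mem (hb2 hx)]
    · simp [kk_off A hC h hε hx, Set.indicator_of_notMem hx]
  rw [k3] at k1
  have k4 : (C * ε) ^ (2 * n) ≤ 1 / 2 * (R / (2 * C)) ^ (2 * n) := by
    have a1 : C * ε ≤ 1 / 2 * (R / (2 * C)) := by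
      have : C * ε ≤ C * (R / (4 * C ^ 2)) := by gcongr
      refine this.trans (le_of_eq ?_)
      field_simp; norm_num
    have a2 : (C * ε) ^ (2 * n) ≤ (1 / 2 * (R / (2 * C))) ^ (2 * n) := by gcongr
    rw [mul_pow (1/2 : ℝ)] at a2
    refine a2.trans ?_
    gcongr
    calc (1 / 2 : ℝ) ^ (2 * n) ≤ (1 / 2) ^ 1 := pow_le_pow_of_le_one (by norm_num) (by norm_num) (by omega)
      _ = 1 / 2 := by norm_num
  set V := μ.real (closedBall (0:E) 1)
  have k5 : 1 / 2 * (R / (2 * C)) ^ (2 * n) * V ≤ (R / (2 * C)) ^ (2 * n) * V - (C * ε) ^ (2 * n) * V := by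
    nlinarith
  have k6 := mul_le_mul_of_nonneg_left (k5.trans k2) (by positivity : 0 ≤ 1 / 2 * (R ^ (2 * n))⁻¹)
  have k7 : 1 / 2 * (R ^ (2 * n))⁻¹ * (1 / 2 * (R / (2 * C)) ^ (2 * n) * V) = 5 * (V * ((2 * C) ^ (2 * n))⁻¹ / 20) := by
    rw [div_pow]; field_simp; norm_num
  rw [k7] at k6
  linarith

lemma eps_ev {c : ℝ} (hc : 0 < c) : ∀ᶠ ε : ℝ in 𝓝[>] 0, 0 < ε ∧ ε ≤ c := by
  filter_upwards [Ioc_mem_nhdsGT hc] with ε hε using hε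

lemma M1_pt {C M : ℝ} (hn : 1 ≤ n) (hM : 0 < M) (hMb : ∀ t, deriv chi t ≤ M)
    (hcard : Fintype.card ι = 2 * n) (hfr : Module.finrank ℝ E = 2 * n)
    (hC : 1 ≤ C) {y : E} {Q : E → ℝ} (h : Rad A C y Q)
    {R : ℝ} (hR : 0 < R) (hCR : C * (n + 1) * R ≤ 1 / 4)
    {Ω : Set E} {v : E → ℝ} (hv : DS μ A Ω v) (hvi : Integrable v μ) (hv0 : ∀ x, 0 ≤ v x)
    (hΩ : closedBall y (C * R) ⊆ Ω) (hLP : LP μ C v y) :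
    3 * (v y * (μ.real (closedBall (0:E) 1) * ((2 * C) ^ (2 * n))⁻¹ / 20)) ≤
      9 * (2 ^ n * M * (R ^ (2 * n))⁻¹) * ∫ x in closedBall y (C * R), v x ∂μ := by
  set U := 2 ^ n * M * C ^ (2 * n) * μ.real (closedBall (0:E) 1)
  set c0 := μ.real (closedBall (0:E) 1) * ((2 * C) ^ (2 * n))⁻¹ / 20
  set J := 9 * (2 ^ n * M * (R ^ (2 * n))⁻¹) * ∫ x in closedBall y (C * R), v x ∂μ
  have hC0 : 0 < C := by linarith
  have hC2 : 1 ≤ C ^ 2 := one_le_pow₀ hC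
  have hlim : Tendsto (fun ε : ℝ => 3 * (v y * c0 - U * ⨍ x in closedBall y (C * ε), |v x - v y| ∂μ))
      (𝓝[>] 0) (𝓝 (3 * (v y * c0 - U * 0))) := by
    unfold LP at hLP
    exact (tendsto_const_nhds.sub (hLP.const_mul U)).const_mul 3
  rw [mul_zero, sub_zero] at hlim
  refine le_of_tendsto hlim ?_
  filter_upwards [eps_ev (by positivity : 0 < R / (4 * C ^ 2))] with ε hε
  have hεR' : ε ≤ R / 4 := by
    refine hε.2.trans ?_
    gcongr
    linarith
  have hεR2 : ε ^ 2 ≤ R ^ 2 / 2 := by nlinarith [hε.1]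
  have k1 := M1_int A hM hMb hcard hC h hε.1 hR hεR2 hCR hv hvi hv0 hΩ
  have k2 := kk_conv A hM hMb hfr hC h hε.1 hvi
  have k3 := kk_lower (μ := μ) A hn hcard hfr hC h hε.1 hR hCR hε.2
  have k4 : v y * c0 ≤ v y * _ := mul_le_mul_of_nonneg_left k3 (hv0 y)
  have k5 : -(U * _) ≤ _ := (abs_le.1 k2).1
  have k1' : _ ≤ J := k1
  linarith

lemma M2_pt {C M : ℝ} (hn : 1 ≤ n) (hM : 0 < M) (hMb : ∀ t, deriv chi t ≤ M)
    (hcard : Fintype.card ι = 2 * n) (hfr : Module.finrank ℝ E = 2 * n)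
    (hC : 1 ≤ C) {y : E} {Q : E → ℝ} (h : Rad A C y Q)
    {R : ℝ} (hR : 0 < R) (hCR : C * (n + 1) * R ≤ 1 / 4)
    {Ω : Set E} {w : E → ℝ} (hw : DS μ A Ω (fun x => - w x)) (hwi : Integrable w μ) (hw0 : ∀ x, 0 ≤ w x)
    (hΩ : closedBall y (C * R) ⊆ Ω) (hLP : LP μ C w y) :
    1 / 2 * (R ^ (2 * n))⁻¹ * ∫ x in closedBall y (R / (2 * C)), w x ∂μ ≤
      5 * ((2 ^ n * M * C ^ (2 * n) * μ.real (closedBall (0:E) 1)) * w y) := by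
  have hV := vball_pos μ (E := E)
  set V := μ.real (closedBall (0:E) 1) with hVdef
  set U := 2 ^ n * M * C ^ (2 * n) * V with hU
  set c := 1 / 2 * (R ^ (2 * n))⁻¹ with hc
  have hc0 : 0 ≤ c := by positivity
  have hC0 : 0 < C := by linarith
  have hC2 : 1 ≤ C ^ 2 := one_le_pow₀ hC
  set J := ∫ x in closedBall y (R / (2 * C)), w x ∂μ
  unfold LP at hLP
  have hpow : Tendsto (fun ε : ℝ => (C * ε) ^ (2 * n) * V) (𝓝[>] 0) (𝓝 0) := by
    have : Tendsto (fun ε : ℝ => (C * ε) ^ (2 * n) * V) (𝓝 0) (𝓝 ((C * 0) ^ (2 * n) * V)) :=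
      Continuous.tendsto (by fun_prop) 0
    rw [mul_zero, zero_pow (by omega), zero_mul] at this
    exact this.mono_left nhdsWithin_le_nhds
  have hlimL : Tendsto (fun ε : ℝ => c * (J - (C * ε) ^ (2 * n) * V *
      (w y + ⨍ x in closedBall y (C * ε), |w x - w y| ∂μ)))
      (𝓝[>] 0) (𝓝 (c * (J - 0 * (w y + 0)))) :=
    (tendsto_const_nhds.sub (hpow.mul (tendsto_const_nhds.add hLP))).const_mul c
  have hlimR : Tendsto (fun ε : ℝ => 5 * (U * w y + U * ⨍ x in closedBall y (C * ε), |w x - w y| ∂μ))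
      (𝓝[>] 0) (𝓝 (5 * (U * w y + U * 0))) :=
    (tendsto_const_nhds.add (hLP.const_mul U)).const_mul 5
  rw [zero_mul, sub_zero] at hlimL
  rw [mul_zero, add_zero] at hlimR
  refine le_of_tendsto_of_tendsto hlimL hlimR ?_
  filter_upwards [eps_ev (by positivity : 0 < R / (4 * C ^ 2))] with ε hε
  have hεR' : ε ≤ R / 4 := by
    refine hε.2.trans ?_
    gcongr
    linarith
  have hεR2 : ε ^ 2 ≤ R ^ 2 / 2 := by nlinarith [hε.1]
  have hε0 := hε.1
  have k1 := M2_int A hn hcard hC h hε.1 hR hεR2 hCR hw hwi hw0 hΩ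
  have k2 := kk_conv A hM hMb hfr hC h hε.1 hwi
  have k3 := kk_upper (μ := μ) A hM hMb hfr hC h hε.1
  have k4 : w y * _ ≤ w y * U := mul_le_mul_of_nonneg_left k3 (hw0 y)
  have k5 : _ ≤ U * _ := (abs_le.1 k2).2
  have k1' : c * _ ≤ _ := k1
  have k6 := ring_int A hC h hε.1 hR hwi hw0
  have hBv : μ.real (closedBall y (C * ε)) = (C * ε) ^ (2 * n) * V := vol_ball μ hfr y (by positivity)
  have hBpos : 0 < μ.real (closedBall y (C * ε)) := by rw [hBv]; positivity
  have k7 : ∫ x in closedBall y (C * ε), w x ∂μ ≤ (C * ε) ^ (2 * n) * V *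
      (w y + ⨍ x in closedBall y (C * ε), |w x - w y| ∂μ) := by
    rw [← hBv, mul_add, ← int_eq_avg hBpos]
    have i3 : IntegrableOn (fun x => |w x - w y|) (closedBall y (C * ε)) μ :=
      (hwi.integrableOn.sub (integrableOn_const measure_closedBall_lt_top.ne)).abs
    have i4 : IntegrableOn (fun x => w y) (closedBall y (C * ε)) μ := integrableOn_const measure_closedBall_lt_top.ne
    have : ∫ x in closedBall y (C * ε), w x ∂μ ≤ ∫ x in closedBall y (C * ε), (w y + |w x - w y|) ∂μ :=
      integral_mono hwi.integrableOn (i4.add i3) fun x => by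
        have := le_abs_self (w x - w y)
        simp only []; linarith
    rw [integral_add i4 i3, setIntegral_const, smul_eq_mul] at this
    exact this
  have k8 : c * (J - (C * ε) ^ (2 * n) * V * (w y + ⨍ x in closedBall y (C * ε), |w x - w y| ∂μ)) ≤
      c * ∫ x in {x | ε ^ 2 ≤ Q x ∧ Q x ≤ R ^ 2 / 2}, w x ∂μ :=
    mul_le_mul_of_nonneg_left (by linarith) hc0
  linarith

end Leb

end ASub

end



noncomputable section

namespace ASub

set_option linter.unusedSectionVars false

section Core

variable {ι : Type*} [Fintype ι] [DecidableEq ι] {E : Type*} [NormedAddCommGroup E] [NormedSpace ℝ E]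
  [FiniteDimensional ℝ E] [MeasurableSpace E] [BorelSpace E] (μ : Measure E) [μ.IsAddHaarMeasure]
  {e : ι → E} (A : Ell e) {n : ℕ} (ℓ : ι → E →L[ℝ] ℝ)

theorem core (hn : 1 ≤ n) (hcard : Fintype.card ι = 2 * n) (hfr : Module.finrank ℝ E = 2 * n)
    (hℓ : ∀ i j, ℓ i (e j) = if i = j then 1 else 0)
    (hco : ∀ w : E, w = ∑ i, ℓ i w • e i) (z₀ : E) :
    ∃ Γ > (0:ℝ), ∃ r₁ > (0:ℝ), ∃ κ > (0:ℝ), ∀ r, 0 < r → r ≤ r₁ → ∀ (w v : E → ℝ) (t η : ℝ), 0 < t →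
      DS μ A (closedBall z₀ r) (fun x => - w x) → IntegrableOn w (closedBall z₀ r) μ →
      (∀ x ∈ closedBall z₀ r, 0 ≤ w x) →
      (∀ s > (0:ℝ), μ {y | y ∈ ball z₀ s ∧ w y ≤ 2 * η} ≠ 0) →
      DS μ A (closedBall z₀ r) v → IntegrableOn v (closedBall z₀ r) μ →
      (∀ x ∈ closedBall z₀ r, 0 ≤ v x) →
      (∀ᵐ x ∂μ, x ∈ closedBall z₀ r → t * v x ≤ w x) →
      ∀ᵐ x ∂μ, x ∈ ball z₀ (κ * r) → t * v x ≤ Γ * η := by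
  obtain ⟨C, hC, hrad⟩ := exists_rad A ℓ hℓ hco (isCompact_closedBall z₀ 1)
  obtain ⟨M, hM, hMb⟩ := exists_chi_bound
  have hC0 : 0 < C := by linarith
  have hC2 : 1 ≤ C ^ 2 := one_le_pow₀ hC
  have hV := vball_pos μ (E := E)
  set V := μ.real (closedBall (0:E) 1) with hVd
  set c1 := V * ((2 * C) ^ (2 * n))⁻¹ / 20 with hc1
  have hc1p : 0 < c1 := by positivity
  set U := 2 ^ n * M * C ^ (2 * n) * V with hU
  have hUp : 0 < U := by positivity
  set Γ := 60 * 2 ^ n * M * (8 * C ^ 2) ^ (2 * n) * U / c1 with hΓ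
  refine ⟨Γ, by positivity, min 1 (1 / (4 * (n + 1))), by positivity, 1 / (16 * C ^ 2), by positivity, ?_⟩
  intro r hr hr1 w v t η ht hw hwi hw0 hfreq hv hvi hv0 hvw
  have hr1' : r ≤ 1 := hr1.trans (min_le_left _ _)
  have hr2' : r * (4 * (n + 1)) ≤ 1 := by
    have := hr1.trans (min_le_right _ _)
    rwa [le_div_iff₀ (by positivity)] at this
  set Ω := closedBall z₀ r with hΩ
  set R := r / (2 * C) with hRd
  have hR : 0 < R := by positivity
  have hCR' : C * R = r / 2 := by rw [hRd]; field_simp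
  have hCR : C * (n + 1) * R ≤ 1 / 4 := by
    have : C * (n + 1) * R = (C * R) * (n + 1) := by ring
    rw [this, hCR']; nlinarith
  set s := R / (8 * C) with hs
  have hs0 : 0 < s := by positivity
  have hsr : s = 1 / (16 * C ^ 2) * r := by rw [hs, hRd]; field_simp; norm_num
  have hs2 : s ≤ r / 2 := by
    rw [hsr, div_mul_eq_mul_div, div_le_div_iff₀ (by positivity) (by norm_num)]
    nlinarith
  set R' := R / (8 * C ^ 2) with hR'd
  have hR' : 0 < R' := by positivity
  have hCR1 : C * R' = s := by rw [hR'd, hs]; field_simp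
  have hR'R : R' ≤ R := by
    rw [hR'd]; apply div_le_self hR.le; linarith
  have hCR2 : C * (n + 1) * R' ≤ 1 / 4 := by
    refine le_trans ?_ hCR
    gcongr
  set w' := Ω.indicator w with hw'
  set v' := Ω.indicator v with hv'
  have hwi' : Integrable w' μ := hwi.integrable_indicator measurableSet_closedBall
  have hvi' : Integrable v' μ := hvi.integrable_indicator measurableSet_closedBall
  have hw0' : ∀ x, 0 ≤ w' x := fun x => Set.indicator_nonneg hw0 x
  have hv0' : ∀ x, 0 ≤ v' x := fun x => Set.indicator_nonneg hv0 x
  have hDw : DS μ A Ω (fun x => - w' x) :=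
    hw.congr_ae measurableSet_closedBall (Eventually.of_forall fun x hx => by
      simp [hw', Set.indicator_of_mem hx])
  have hDv : DS μ A Ω v' :=
    hv.congr_ae measurableSet_closedBall (Eventually.of_forall fun x hx => by
      simp [hv', Set.indicator_of_mem hx])
  have hvw' : ∀ᵐ x ∂μ, t * v' x ≤ w' x := by
    filter_upwards [hvw] with x hx
    by_cases h : x ∈ Ω
    · simpa [hw', hv', Set.indicator_of_mem h] using hx h
    · simp [hw', hv', Set.indicator_of_notMem h]
  -- choose y
  obtain ⟨y, ⟨hy1, hy2⟩, hyLP⟩ : ∃ y, (y ∈ ball z₀ s ∧ w y ≤ 2 * η) ∧ LP μ C w' y := by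
    by_contra hcon
    push Not at hcon
    refine hfreq s hs0 (measure_mono_null ?_ (ae_LP μ hC hwi'))
    intro y hy
    exact hcon y hy
  have hyd : dist y z₀ < s := hy1
  have hyΩ : y ∈ Ω := mem_closedBall.2 (by linarith)
  have hwy : w' y ≤ 2 * η := by rw [hw', Set.indicator_of_mem hyΩ]; exact hy2
  obtain ⟨Q, hQ⟩ := hrad y (mem_closedBall.2 (by linarith))
  have hsub : closedBall y (C * R) ⊆ Ω := closedBall_subset_closedBall' (by rw [hCR']; linarith)
  have k1 := M2_pt A hn hM hMb hcard hfr hC hQ hR hCR hDw hwi' hw0' hsub hyLP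
  have k1' : 1 / 2 * (R ^ (2 * n))⁻¹ * ∫ x in closedBall y (R / (2 * C)), w' x ∂μ ≤ 5 * (U * w' y) := k1
  have k2 : ∫ x in closedBall y (R / (2 * C)), w' x ∂μ ≤ 20 * U * R ^ (2 * n) * η := by
    have a1 : U * w' y ≤ U * (2 * η) := by gcongr
    have hRp : 0 < R ^ (2 * n) := by positivity
    have a2 : 1 / 2 * (R ^ (2 * n))⁻¹ * ∫ x in closedBall y (R / (2 * C)), w' x ∂μ ≤ 10 * U * η := by linarith
    have a3 := mul_le_mul_of_nonneg_left a2 (by positivity : 0 ≤ 2 * R ^ (2 * n))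
    have a4 : 2 * R ^ (2 * n) * (1 / 2 * (R ^ (2 * n))⁻¹ * ∫ x in closedBall y (R / (2 * C)), w' x ∂μ)
      = ∫ x in closedBall y (R / (2 * C)), w' x ∂μ := by field_simp
    rw [a4] at a3
    linarith
  have hball : ∀ x ∈ ball z₀ s, closedBall x (C * R') ⊆ closedBall y (R / (2 * C)) := by
    intro x hx
    apply closedBall_subset_closedBall'
    have h1 : dist x z₀ < s := hx
    have h2 := dist_triangle_right x y z₀
    have h3 : R / (2 * C) = 4 * s := by rw [hs]; field_simp; norm_num
    rw [hCR1, h3]; linarith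
  filter_upwards [ae_LP μ hC hvi'] with x hxLP hx
  rw [← hsr] at hx
  have hxd : dist x z₀ < s := hx
  have hxΩ : x ∈ Ω := mem_closedBall.2 (by linarith)
  obtain ⟨Q', hQ'⟩ := hrad x (mem_closedBall.2 (by linarith))
  have hsub' : closedBall x (C * R') ⊆ Ω := closedBall_subset_closedBall' (by rw [hCR1]; linarith)
  have k3 := M1_pt A hn hM hMb hcard hfr hC hQ' hR' hCR2 hDv hvi' hv0' hsub' hxLP
  have k3' : 3 * (v' x * c1) ≤ 9 * (2 ^ n * M * (R' ^ (2 * n))⁻¹) * ∫ z in closedBall x (C * R'), v' z ∂μ := k3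
  have k4 : t * ∫ z in closedBall x (C * R'), v' z ∂μ ≤ ∫ z in closedBall y (R / (2 * C)), w' z ∂μ := by
    rw [← integral_const_mul]
    calc ∫ z in closedBall x (C * R'), t * v' z ∂μ ≤ ∫ z in closedBall x (C * R'), w' z ∂μ :=
          integral_mono_ae (hvi'.integrableOn.const_mul t) hwi'.integrableOn (ae_restrict_of_ae hvw')
      _ ≤ _ := setIntegral_mono_set hwi'.integrableOn (Eventually.of_forall hw0')
          (LE.le.eventuallyLE (hball x hx))
  have k5 := mul_le_mul_of_nonneg_left k3' ht.le
  have k6 := mul_le_mul_of_nonneg_left (k4.trans k2) (by positivity : 0 ≤ 9 * (2 ^ n * M * (R' ^ (2 * n))⁻¹))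
  have hvx : v' x = v x := by rw [hv', Set.indicator_of_mem hxΩ]
  rw [hvx] at k5
  have k7 : 9 * (2 ^ n * M * (R' ^ (2 * n))⁻¹) * (20 * U * R ^ (2 * n) * η) = 3 * c1 * (Γ * η) := by
    have hRp : 0 < R ^ (2 * n) := by positivity
    have hPp : 0 < (8 * C ^ 2) ^ (2 * n) := by positivity
    have q1 : R' ^ (2 * n) = R ^ (2 * n) / (8 * C ^ 2) ^ (2 * n) := by rw [hR'd, div_pow]
    rw [hΓ, q1]
    clear_value U c1
    generalize R ^ (2 * n) = S at hRp
    generalize (8 * C ^ 2) ^ (2 * n) = P at hPp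
    generalize (2:ℝ) ^ n = T
    field_simp
    ring
  rw [k7] at k6
  have k8 : 3 * c1 * (t * v x) ≤ 3 * c1 * (Γ * η) := by linarith
  exact le_of_mul_le_mul_left k8 (by positivity)

end Core

end ASub

end



noncomputable section

namespace ASub

set_option linter.unusedSectionVars false

section Bridge

variable {n : ℕ}

/-- real basis of `ℂⁿ` -/
def ee (n : ℕ) : Fin n ⊕ Fin n → Cn n
  | Sum.inl j => Pi.single j 1
  | Sum.inr j => Pi.single j Complex.I

/-- dual basis -/
def ell (n : ℕ) : Fin n ⊕ Fin n → Cn n →L[ℝ] ℝ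
  | Sum.inl j => Complex.reCLM.comp (ContinuousLinearMap.proj j)
  | Sum.inr j => Complex.imCLM.comp (ContinuousLinearMap.proj j)

lemma ell_ee (i j : Fin n ⊕ Fin n) : ell n i (ee n j) = if i = j then 1 else 0 := by
  rcases i with i | i <;> rcases j with j | j <;>
    by_cases h : i = j <;> simp [ell, ee, Pi.single_apply, h]

lemma ell_co (w : Cn n) : w = ∑ i, ell n i w • ee n i := by
  funext k
  simp only [Fintype.sum_sum_type, ell, ee, Pi.add_apply, Finset.sum_apply, Pi.smul_apply,
    Pi.single_apply]
  simp [Complex.re_add_im]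

lemma finrank_Cn : Module.finrank ℝ (Cn n) = 2 * n := by
  rw [Module.finrank_pi_fintype]
  simp [Complex.finrank_real_complex, mul_comm]

lemma card_idx : Fintype.card (Fin n ⊕ Fin n) = 2 * n := by
  simp; ring

lemma fderiv_re {f : Cn n → ℂ} {z : Cn n} (hf : DifferentiableAt ℝ f z) (v : Cn n) :
    (fderiv ℝ f z v).re = pd v (fun x => (f x).re) z := by
  have := (Complex.reCLM.hasFDerivAt.comp z hf.hasFDerivAt).fderiv
  unfold pd
  have h2 : (fun x => (f x).re) = Complex.reCLM ∘ f := rfl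
  rw [h2, this]; rfl

lemma fderiv_im {f : Cn n → ℂ} {z : Cn n} (hf : DifferentiableAt ℝ f z) (v : Cn n) :
    (fderiv ℝ f z v).im = pd v (fun x => (f x).im) z := by
  have := (Complex.imCLM.hasFDerivAt.comp z hf.hasFDerivAt).fderiv
  unfold pd
  have h2 : (fun x => (f x).im) = Complex.imCLM ∘ f := rfl
  rw [h2, this]; rfl

lemma contDiff_re {f : Cn n → ℂ} {m : WithTop ℕ∞} (hf : ContDiff ℝ m f) : ContDiff ℝ m (fun x => (f x).re) :=
  Complex.reCLM.contDiff.comp hf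

lemma contDiff_im {f : Cn n → ℂ} {m : WithTop ℕ∞} (hf : ContDiff ℝ m f) : ContDiff ℝ m (fun x => (f x).im) :=
  Complex.imCLM.contDiff.comp hf

/-- coefficient functions of the real form -/
def acoef (A : AlphaForm n) : Fin n ⊕ Fin n → Fin n ⊕ Fin n → Cn n → ℝ
  | Sum.inl k, Sum.inl j => fun z => 1 / 4 * (A.coeff k j z).re
  | Sum.inr k, Sum.inr j => fun z => 1 / 4 * (A.coeff k j z).re
  | Sum.inr k, Sum.inl j => fun z => 1 / 4 * (A.coeff k j z).im
  | Sum.inl k, Sum.inr j => fun z => - (1 / 4) * (A.coeff k j z).im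

lemma pd_cmul {f : Cn n → ℝ} {x : Cn n} (c : ℝ) (v : Cn n) (hf : DifferentiableAt ℝ f x) :
    pd v (fun y => c * f y) x = c * pd v f x := by
  rw [pd_mul (f := fun _ => c) (by fun_prop) hf, pd_const]; ring

lemma closed_re (A : AlphaForm n) (k : Fin n) (z : Cn n) :
    ∑ j, (pd (Pi.single j 1) (fun x => (A.coeff j k x).re) z
      + pd (Pi.single j Complex.I) (fun x => (A.coeff j k x).im) z) = 0 := by
  have h := congrArg Complex.re (A.closed k z)
  rw [Complex.re_sum] at h
  have h2 : ∀ j, (wdz j (A.coeff j k) z).re = 1 / 2 * (pd (Pi.single j 1) (fun x => (A.coeff j k x).re) z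
      + pd (Pi.single j Complex.I) (fun x => (A.coeff j k x).im) z) := by
    intro j
    have hd := (A.contDiff j k).differentiable (by simp) z
    rw [← fderiv_re hd, ← fderiv_im hd]
    simp [wdz]; ring
  simp_rw [h2, ← Finset.mul_sum] at h
  simpa using h

lemma closed_im (A : AlphaForm n) (k : Fin n) (z : Cn n) :
    ∑ j, (pd (Pi.single j 1) (fun x => (A.coeff j k x).im) z
      - pd (Pi.single j Complex.I) (fun x => (A.coeff j k x).re) z) = 0 := by
  have h := congrArg Complex.im (A.closed k z)
  rw [Complex.im_sum] at h
  have h2 : ∀ j, (wdz j (A.coeff j k) z).im = 1 / 2 * (pd (Pi.single j 1) (fun x => (A.coeff j k x).im) z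
      - pd (Pi.single j Complex.I) (fun x => (A.coeff j k x).re) z) := by
    intro j
    have hd := (A.contDiff j k).differentiable (by simp) z
    rw [← fderiv_re hd, ← fderiv_im hd]
    simp [wdz]; ring
  simp_rw [h2, ← Finset.mul_sum] at h
  simpa using h

lemma herm_re (A : AlphaForm n) (j k : Fin n) (z : Cn n) : (A.coeff k j z).re = (A.coeff j k z).re := by
  rw [A.hermitian j k]; simp

lemma herm_im (A : AlphaForm n) (j k : Fin n) (z : Cn n) : (A.coeff k j z).im = -(A.coeff j k z).im := by
  rw [A.hermitian j k]; simp

/-- real elliptic operator attached to the form -/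
def ellOf (A : AlphaForm n) : Ell (ee n) where
  a := acoef A
  smooth := by
    rintro (i | i) (j | j)
    · exact contDiff_const.mul (contDiff_re (A.contDiff i j))
    · exact contDiff_const.mul (contDiff_im (A.contDiff i j))
    · exact contDiff_const.mul (contDiff_im (A.contDiff i j))
    · exact contDiff_const.mul (contDiff_re (A.contDiff i j))
  symm := by
    rintro (i | i) (j | j) z <;> simp only [acoef]
    · rw [herm_re]
    · rw [herm_im]; ring
    · rw [herm_im]; ring
    · rw [herm_re]
  pos := by
    intro z ξ hξ
    set ζ : Fin n → ℂ := fun k => ⟨ξ (Sum.inl k), - ξ (Sum.inr k)⟩ with hζ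
    have hζ0 : ζ ≠ 0 := by
      intro h
      apply hξ
      funext i
      rcases i with k | k
      · have := congrArg Complex.re (congrFun h k); simpa [hζ] using this
      · have := congrArg Complex.im (congrFun h k); simpa [hζ] using this
    have hp := A.strictlyPositive z ζ hζ0
    have : ∑ i, ∑ j, acoef A i j z * ξ i * ξ j
        = 1 / 4 * (∑ j, ∑ k, A.coeff j k z * ζ j * starRingEnd ℂ (ζ k)).re := by
      simp only [Fintype.sum_sum_type, acoef, Complex.re_sum, ← Finset.sum_add_distrib, Finset.mul_sum]
      refine Finset.sum_congr rfl fun i _ => Finset.sum_congr rfl fun j _ => ?_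
      simp [hζ]; ring
    rw [this]; positivity
  divfree := by
    have hre : ∀ j k z, DifferentiableAt ℝ (fun x => (A.coeff j k x).re) z := fun j k z =>
      (contDiff_re (A.contDiff j k)).differentiable (by simp) z
    have him : ∀ j k z, DifferentiableAt ℝ (fun x => (A.coeff j k x).im) z := fun j k z =>
      (contDiff_im (A.contDiff j k)).differentiable (by simp) z
    rintro (j | j) z <;>
      simp only [Fintype.sum_sum_type, acoef, ee, ← Finset.sum_add_distrib]
    · simp_rw [pd_cmul _ _ (hre _ _ _), pd_cmul _ _ (him _ _ _), ← mul_add, ← Finset.mul_sum]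
      rw [closed_re]; simp
    · simp_rw [pd_cmul _ _ (hre _ _ _), pd_cmul _ _ (him _ _ _)]
      have := closed_im A j z
      calc _ = ∑ i, (-(1/4)) * (pd (Pi.single i 1) (fun x => (A.coeff i j x).im) z
              - pd (Pi.single i Complex.I) (fun x => (A.coeff i j x).re) z) :=
            Finset.sum_congr rfl fun i _ => by ring
        _ = 0 := by rw [← Finset.mul_sum, this, mul_zero]

lemma wdz_real {ω : Cn n → ℝ} (hω : ContDiff ℝ 2 ω) (j : Fin n) (z : Cn n) :
    wdz j (fun w => (ω w : ℂ)) z = ⟨1 / 2 * pd (Pi.single j 1) ω z, -(1 / 2) * pd (Pi.single j Complex.I) ω z⟩ := by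
  have hd : DifferentiableAt ℝ (fun w => (ω w : ℂ)) z :=
    (Complex.ofRealCLM.contDiff.comp hω).differentiable (by norm_num) z
  have h1 : ∀ v, fderiv ℝ (fun w => (ω w : ℂ)) z v = (pd v ω z : ℂ) := by
    intro v
    apply Complex.ext
    · rw [fderiv_re hd]; simp
    · rw [fderiv_im hd]; simp [pd_const]
  unfold wdz
  rw [h1, h1]
  apply Complex.ext <;> simp <;> ring

lemma alphaOpR_eq (A : AlphaForm n) {ω : Cn n → ℝ} (hω : ContDiff ℝ 2 ω) (z : Cn n) :
    alphaOpR A ω z = (ellOf A).L ω z := by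
  have hp : ∀ v, ContDiff ℝ 1 (pd v ω) := fun v => pd_contDiff hω (by norm_num [one_add_one_eq_two]) v
  have hpd : ∀ v, DifferentiableAt ℝ (pd v ω) z := fun v => (hp v).differentiable (by simp) z
  have hg : ∀ j, wdz j (fun w => (ω w : ℂ)) = fun z =>
      (⟨1 / 2 * pd (Pi.single j 1) ω z, -(1 / 2) * pd (Pi.single j Complex.I) ω z⟩ : ℂ) := fun j =>
    funext fun z => wdz_real hω j z
  have hgd : ∀ j, DifferentiableAt ℝ (fun z =>
      (⟨1 / 2 * pd (Pi.single j 1) ω z, -(1 / 2) * pd (Pi.single j Complex.I) ω z⟩ : ℂ)) z := by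
    intro j
    have : (fun z => (⟨1 / 2 * pd (Pi.single j 1) ω z, -(1 / 2) * pd (Pi.single j Complex.I) ω z⟩ : ℂ))
      = fun z => Complex.ofRealCLM (1 / 2 * pd (Pi.single j 1) ω z) +
          Complex.ofRealCLM (-(1 / 2) * pd (Pi.single j Complex.I) ω z) * Complex.I := by
      funext z
      apply Complex.ext <;> simp
    rw [this]
    have h1 := hpd (Pi.single j 1)
    have h2 := hpd (Pi.single j Complex.I)
    fun_prop
  have hf : ∀ j v, fderiv ℝ (fun z =>
      (⟨1 / 2 * pd (Pi.single j 1) ω z, -(1 / 2) * pd (Pi.single j Complex.I) ω z⟩ : ℂ)) z v =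
      ⟨1 / 2 * pd v (pd (Pi.single j 1) ω) z, -(1 / 2) * pd v (pd (Pi.single j Complex.I) ω) z⟩ := by
    intro j v
    apply Complex.ext
    · rw [fderiv_re (hgd j)]; exact pd_cmul _ _ (hpd _)
    · rw [fderiv_im (hgd j)]; exact pd_cmul _ _ (hpd _)
  unfold alphaOpR alphaOp Ell.L
  simp only [Fintype.sum_sum_type, ← Finset.sum_add_distrib, Complex.re_sum]
  rw [Finset.sum_comm]
  refine Finset.sum_congr rfl fun k _ => Finset.sum_congr rfl fun j _ => ?_
  rw [hg]
  unfold wdzbar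
  rw [hf, hf]
  simp only [ellOf, acoef, ee]
  rw [herm_re A j k, herm_im A j k]
  simp
  ring

lemma DS_of_ash (A : AlphaForm n) {D : Set (Cn n)} {u : Cn n → ℝ} (hu : IsAlphaSubharmonic A D u) :
    DS volume (ellOf A) D u := by
  obtain ⟨-, -, -, h4, h5⟩ := hu
  simp only [EReal.toReal_coe] at h4 h5
  refine ⟨h4, fun ω h1 h2 h3 h0 => ?_⟩
  have := h5 ω h1 h2 h3 h0
  rw [setIntegral_eq_integral_of_forall_compl_eq_zero] at this
  · simpa only [alphaOpR_eq A (h1.of_le two_le_infty)] using this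
  · intro x hx
    rw [alphaOpR_eq A (h1.of_le two_le_infty), L_eq_zero_of_notMem _ (fun h => hx (h3 h)), mul_zero]

lemma ash_of_DS (A : AlphaForm n) {D : Set (Cn n)} {u : Cn n → ℝ} (hu : DS volume (ellOf A) D u)
    (husc : UpperSemicontinuousOn u D)
    (hs : ∀ z₀ ∈ D, ∀ S : Set (Cn n), (∃ N ∈ 𝓝 z₀, volume (N \ S) = 0) →
      limsup (fun z => (u z : EReal)) (𝓝[S] z₀) = u z₀) : IsAlphaSubharmonic A D u := by
  refine ⟨fun z _ => EReal.coe_ne_top _, ?_, hs, ?_, ?_⟩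
  · intro z hz c hc
    induction c with
    | bot => simp at hc
    | coe c =>
      have hc' : u z < c := EReal.coe_lt_coe_iff.1 hc
      exact (husc z hz c hc').mono fun x hx => EReal.coe_lt_coe_iff.2 hx
    | top => exact Eventually.of_forall fun x => EReal.coe_lt_top _
  · simpa only [EReal.toReal_coe] using hu.1
  · intro ω h1 h2 h3 h0
    rw [setIntegral_eq_integral_of_forall_compl_eq_zero]
    · simpa only [EReal.toReal_coe, alphaOpR_eq A (h1.of_le two_le_infty)] using hu.2 ω h1 h2 h3 h0
    · intro x hx
      rw [alphaOpR_eq A (h1.of_le two_le_infty), L_eq_zero_of_notMem _ (fun h => hx (h3 h)), mul_zero]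

end Bridge

end ASub

end



noncomputable section

namespace ASub

set_option linter.unusedSectionVars false

section Reg

variable {n : ℕ}

lemma usc_of_ash {A : AlphaForm n} {D : Set (Cn n)} {u : Cn n → ℝ} (hu : IsAlphaSubharmonic A D u) :
    UpperSemicontinuousOn u D := by
  intro z hz c hc
  exact (hu.2.1 z hz (c : EReal) (EReal.coe_lt_coe_iff.2 hc)).mono fun x hx => EReal.coe_lt_coe_iff.1 hx

lemma ash_le_of_ae {A : AlphaForm n} {D : Set (Cn n)} {u : Cn n → ℝ} (hu : IsAlphaSubharmonic A D u)
    {z : Cn n} (hz : z ∈ D) {N : Set (Cn n)} (hN : N ∈ 𝓝 z) {c : ℝ}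
    (h : ∀ᵐ x ∂(volume : Measure (Cn n)), x ∈ N → u x ≤ c) : u z ≤ c := by
  have h1 := hu.2.2.1 z hz {x | u x ≤ c} ⟨N, hN, ?_⟩
  · have h2 : limsup (fun z => (u z : EReal)) (𝓝[{x | u x ≤ c}] z) ≤ c := by
      refine limsup_le_of_le (h := ?_)
      filter_upwards [self_mem_nhdsWithin] with x hx
      exact EReal.coe_le_coe_iff.2 hx
    rw [h1] at h2
    exact EReal.coe_le_coe_iff.1 h2
  · refine measure_mono_null ?_ h
    intro x hx hcon
    exact hx.2 (hcon hx.1)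

lemma ash_freq {A : AlphaForm n} {D : Set (Cn n)} {u : Cn n → ℝ} (hu : IsAlphaSubharmonic A D u)
    {z : Cn n} (hz : z ∈ D) {a : ℝ} (ha : a < u z) {s : ℝ} (hs : 0 < s) :
    (volume : Measure (Cn n)) {y | y ∈ ball z s ∧ a < u y} ≠ 0 := by
  intro h0
  refine absurd (ash_le_of_ae hu hz (ball_mem_nhds z hs) (c := a) ?_) (not_le.2 ha)
  refine measure_mono_null ?_ h0
  intro x hx
  simp only [Set.mem_compl_iff, Set.mem_ofPred_eq] at hx
  push Not at hx
  exact hx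

/-- essential upper bounds near a point -/
def EB (W : Cn n → ℝ) (z : Cn n) : Set ℝ :=
  {c | ∃ s > (0:ℝ), ∀ᵐ x ∂(volume : Measure (Cn n)), x ∈ ball z s → W x ≤ c}

/-- essential upper regularization -/
def hat (W : Cn n → ℝ) (z : Cn n) : ℝ := sInf (EB W z)

lemma EB_up {W : Cn n → ℝ} {z : Cn n} {c d : ℝ} (h : c ∈ EB W z) (hcd : c ≤ d) : d ∈ EB W z := by
  obtain ⟨s, hs, h⟩ := h
  exact ⟨s, hs, h.mono fun x hx hxs => (hx hxs).trans hcd⟩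

section
variable {D : Set (Cn n)} (hD : IsOpen D) {W : Cn n → ℝ} {M : ℝ}
  (h0 : ∀ z ∈ D, W z ≤ 0) (hM : ∀ z ∈ D, -M ≤ W z)
include hD hM

lemma EB_lower {z : Cn n} (hz : z ∈ D) {c : ℝ} (hc : c ∈ EB W z) : -M ≤ c := by
  obtain ⟨s, hs, h⟩ := hc
  have hN : ball z s ∩ D ∈ 𝓝 z := inter_mem (ball_mem_nhds z hs) (hD.mem_nhds hz)
  by_contra hcon
  push Not at hcon
  have hpos : 0 < (volume : Measure (Cn n)) (ball z s ∩ D) := Measure.measure_pos_of_mem_nhds volume hN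
  refine hpos.ne' (measure_mono_null ?_ h)
  intro x hx hx2
  have := hx2 hx.1
  have := hM x hx.2
  linarith

lemma EB_bdd {z : Cn n} (hz : z ∈ D) : BddBelow (EB W z) := ⟨-M, fun _ hc => EB_lower hD hM hz hc⟩

lemma hat_le {z : Cn n} (hz : z ∈ D) {c : ℝ} (hc : c ∈ EB W z) : hat W z ≤ c :=
  csInf_le (EB_bdd hD hM hz) hc

include h0 in
lemma EB_zero {z : Cn n} (hz : z ∈ D) : (0:ℝ) ∈ EB W z := by
  obtain ⟨s, hs, hsub⟩ := Metric.isOpen_iff.1 hD z hz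
  exact ⟨s, hs, Eventually.of_forall fun x hx => h0 x (hsub hx)⟩

include h0 in
lemma hat_lower {z : Cn n} (hz : z ∈ D) : -M ≤ hat W z :=
  le_csInf ⟨0, EB_zero hD h0 hM hz⟩ fun _ hc => EB_lower hD hM hz hc

include h0 in
lemma mem_EB {z : Cn n} (hz : z ∈ D) {c : ℝ} (hc : hat W z < c) : c ∈ EB W z := by
  obtain ⟨d, hd, hdc⟩ := exists_lt_of_csInf_lt ⟨0, EB_zero hD h0 hM hz⟩ hc
  exact EB_up hd hdc.le

lemma hat_le_self (hW : UpperSemicontinuousOn W D) {z : Cn n} (hz : z ∈ D) : hat W z ≤ W z := by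
  refine le_of_forall_gt fun c hc => ?_
  obtain ⟨d, hd, hdc⟩ := exists_between hc
  have h1 := hW z hz d hd
  rw [hD.nhdsWithin_eq hz] at h1
  obtain ⟨s, hs, h2⟩ := Metric.eventually_nhds_iff_ball.1 h1
  exact lt_of_le_of_lt (hat_le hD hM hz ⟨s, hs, Eventually.of_forall fun x hx => (h2 x hx).le⟩) hdc

include h0 in
lemma hat_usc : UpperSemicontinuousOn (hat W) D := by
  intro z hz c hc
  obtain ⟨d, hd, hdc⟩ := exists_between hc
  obtain ⟨s, hs, h⟩ := mem_EB hD h0 hM hz hd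
  rw [hD.nhdsWithin_eq hz]
  filter_upwards [ball_mem_nhds z hs, hD.mem_nhds hz] with x hx hxD
  refine lt_of_le_of_lt (hat_le hD hM hxD ⟨s - dist x z, sub_pos.2 hx, ?_⟩) hdc
  filter_upwards [h] with y hy hys
  exact hy (ball_subset_ball' (by linarith) hys)

include h0 in
lemma hat_ae (hW : UpperSemicontinuousOn W D) :
    ∀ᵐ x ∂(volume : Measure (Cn n)), x ∈ D → hat W x = W x := by
  have hq : ∀ q : ℚ, ∀ᵐ x ∂(volume : Measure (Cn n)), ¬ ((q:ℝ) ∈ EB W x ∧ (q:ℝ) < W x) := by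
    intro q
    rw [ae_iff]
    simp only [not_not]
    refine measure_null_of_locally_null _ fun x hx => ?_
    obtain ⟨⟨s, hs, h⟩, -⟩ := hx
    refine ⟨{y | (q:ℝ) < W y ∧ y ∈ ball x s}, ?_, measure_mono_null ?_ h⟩
    · filter_upwards [self_mem_nhdsWithin, mem_nhdsWithin_of_mem_nhds (ball_mem_nhds x hs)] with y hy hys
      exact ⟨hy.2, hys⟩
    · intro y hy hy2
      exact absurd (hy2 hy.2) (not_le.2 hy.1)
  filter_upwards [ae_all_iff.2 hq] with x hx hxD
  refine le_antisymm (hat_le_self hD hM hW hxD) ?_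
  by_contra hcon
  push Not at hcon
  obtain ⟨q, hq1, hq2⟩ := exists_rat_btwn hcon
  exact hx q ⟨mem_EB hD h0 hM hxD hq1, hq2⟩

include h0 in
lemma hat_ash (A : AlphaForm n) (hW : UpperSemicontinuousOn W D) (hDS : DS volume (ellOf A) D W) :
    IsAlphaSubharmonic A D (hat W) := by
  have hae := hat_ae hD h0 hM hW
  refine ash_of_DS A (hDS.congr_ae hD.measurableSet (hae.mono fun x hx hxD => (hx hxD).symm))
    (hat_usc hD h0 hM) ?_
  rintro z hz S ⟨N, hN, hNS⟩
  apply le_antisymm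
  · refine le_of_forall_gt_imp_ge_of_dense fun c hc => ?_
    refine limsup_le_of_le (h := ?_)
    induction c with
    | bot => simp at hc
    | top => exact Eventually.of_forall fun x => le_top
    | coe c =>
      have h1 := hat_usc hD h0 hM z hz c (EReal.coe_lt_coe_iff.1 hc)
      rw [hD.nhdsWithin_eq hz] at h1
      filter_upwards [mem_nhdsWithin_of_mem_nhds h1] with x hx
      exact EReal.coe_le_coe_iff.2 (le_of_lt hx)
  · by_contra hcon
    push Not at hcon
    obtain ⟨c, hc1, hc2⟩ := EReal.lt_iff_exists_real_btwn.1 hcon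
    have h1 := eventually_lt_of_limsup_lt hc1
    rw [eventually_nhdsWithin_iff] at h1
    have h2 : ∀ᶠ x in 𝓝 z, (x ∈ S → ((hat W x : ℝ) : EReal) < c) ∧ x ∈ D ∧ x ∈ N :=
      by
      filter_upwards [h1, hD.mem_nhds hz, hN] with x a b c using ⟨a, b, c⟩
    obtain ⟨s, hs, h3⟩ := Metric.eventually_nhds_iff_ball.1 h2
    refine absurd (hat_le hD hM hz (c := c) ⟨s, hs, ?_⟩) (not_le.2 (EReal.coe_lt_coe_iff.1 hc2))
    have hNS' : ∀ᵐ x ∂(volume : Measure (Cn n)), ¬ (x ∈ N ∧ x ∉ S) := by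
      rw [ae_iff]; simp only [not_not]; exact hNS
    filter_upwards [hNS', hae] with x hx1 hx2 hxs
    obtain ⟨q1, q2, q3⟩ := h3 x hxs
    rw [← hx2 q2]
    have hxS : x ∈ S := by
      by_contra hxS
      exact hx1 ⟨q3, hxS⟩
    exact (EReal.coe_lt_coe_iff.1 (q1 hxS)).le
end

/-! quadratic facts -/

lemma sqNorm_eq (z : Cn n) : sqNorm z = ∑ i, ell n i z * ell n i z := by
  simp only [sqNorm, Fintype.sum_sum_type, ell, ← Finset.sum_add_distrib]
  rfl

lemma pd_clm (ℓ : Cn n →L[ℝ] ℝ) (v x : Cn n) : pd v (fun y => ℓ y) x = ℓ v := by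
  simp [pd, ContinuousLinearMap.fderiv]

lemma sqNorm_contDiff : ContDiff ℝ 2 (sqNorm : Cn n → ℝ) := by
  have : (sqNorm : Cn n → ℝ) = fun z => ∑ i, ell n i z * ell n i z := funext sqNorm_eq
  rw [this]
  exact ContDiff.sum fun i _ => (ell n i).contDiff.mul (ell n i).contDiff

lemma pd_sqNorm (v x : Cn n) : pd v sqNorm x = ∑ i, (2 * ell n i v) * ell n i x := by
  have : (sqNorm : Cn n → ℝ) = fun z => ∑ i, ell n i z * ell n i z := funext sqNorm_eq
  rw [this, pd_sum (f := fun i z => ell n i z * ell n i z) _ (fun i _ => by fun_prop)]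
  refine Finset.sum_congr rfl fun i _ => ?_
  rw [pd_mul (f := fun z => ell n i z) (g := fun z => ell n i z) (by fun_prop) (by fun_prop), pd_clm]
  ring

lemma DS_clm (A : AlphaForm n) (D : Set (Cn n)) (ℓ : Cn n →L[ℝ] ℝ) :
    DS volume (ellOf A) D (fun z => ℓ z) := by
  refine DS.of_C2 ℓ.contDiff fun x _ => le_of_eq ?_
  have : ∀ v : Cn n, pd v (fun y => ℓ y) = fun _ => ℓ v := fun v => funext fun x => pd_clm ℓ v x
  simp [Ell.L, this, pd_const]

lemma DS_sqNorm (A : AlphaForm n) (D : Set (Cn n)) : DS volume (ellOf A) D sqNorm := by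
  refine DS.of_C2 sqNorm_contDiff fun x _ => ?_
  unfold Ell.L
  have h1 : ∀ i j, pd (ee n i) (pd (ee n j) sqNorm) x = if i = j then 2 else 0 := by
    intro i j
    have : pd (ee n j) sqNorm = fun x => (2:ℝ) * ell n j x := by
      funext x
      rw [pd_sqNorm]
      rw [Finset.sum_eq_single j]
      · rw [ell_ee]; simp
      · intro b _ hb; rw [ell_ee]; simp [hb]
      · simp
    rw [this, pd_cmul _ _ (by fun_prop), pd_clm, ell_ee]
    by_cases h : i = j <;> simp [h, eq_comm]
  simp_rw [h1]
  simp only [mul_ite, mul_zero, Finset.sum_ite_eq, Finset.mem_univ, if_true]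
  refine Finset.sum_nonneg fun i _ => ?_
  have hp := (ellOf A).pos x (Pi.single i 1) (by simp)
  simp [Pi.single_apply] at hp
  linarith

lemma sqNorm_nonneg (z : Cn n) : 0 ≤ sqNorm z := Finset.sum_nonneg fun i _ => Complex.normSq_nonneg _

lemma norm_sq_le_sqNorm (z : Cn n) : ‖z‖ ^ 2 ≤ sqNorm z := by
  have h : ‖z‖ ≤ Real.sqrt (sqNorm z) := by
    rw [pi_norm_le_iff_of_nonneg (Real.sqrt_nonneg _)]
    intro i
    apply Real.le_sqrt_of_sq_le
    rw [← Complex.normSq_eq_norm_sq]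
    exact Finset.single_le_sum (f := fun i => Complex.normSq (z i)) (fun i _ => Complex.normSq_nonneg _) (Finset.mem_univ i)
  calc ‖z‖ ^ 2 ≤ (Real.sqrt (sqNorm z)) ^ 2 := pow_le_pow_left₀ (norm_nonneg _) h 2
    _ = _ := Real.sq_sqrt (sqNorm_nonneg z)

lemma DS_aff (A : AlphaForm n) (D : Set (Cn n)) (z₀ : Cn n) :
    DS volume (ellOf A) D (fun z => sqNorm z - sqNorm (z - z₀)) := by
  have h1 := (DS_clm A D (∑ i, (2 * ell n i z₀) • ell n i)).add (DS.const (A := ellOf A) (- sqNorm z₀))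
  convert h1 using 2 with z
  simp only [sqNorm_eq, ContinuousLinearMap.sum_apply, ContinuousLinearMap.smul_apply, smul_eq_mul, map_sub]
  rw [← Finset.sum_sub_distrib, ← sub_eq_add_neg, ← Finset.sum_sub_distrib]
  refine Finset.sum_congr rfl fun i _ => ?_
  ring

lemma sqNorm_continuous : Continuous (sqNorm : Cn n → ℝ) := sqNorm_contDiff.continuous

/-! extremal functions -/
section Om
variable {A : AlphaForm n} {E D : Set (Cn n)} {ψ : Cn n → ℝ}

lemma U_bdd {z : Cn n} (hz : z ∈ D) : BddAbove ((fun u : Cn n → ℝ => u z) '' Uclass A E D ψ) := by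
  refine ⟨0, ?_⟩
  rintro _ ⟨u, hu, rfl⟩
  exact (hu.2.2 z hz).le

lemma le_omegaW {z : Cn n} (hz : z ∈ D) {u : Cn n → ℝ} (hu : u ∈ Uclass A E D ψ) : u z ≤ omegaW A E D ψ z :=
  le_csSup (U_bdd hz) ⟨u, hu, rfl⟩

lemma omegaW_le (hne : (Uclass A E D ψ).Nonempty) {z : Cn n} {c : ℝ}
    (h : ∀ u ∈ Uclass A E D ψ, u z ≤ c) : omegaW A E D ψ z ≤ c := by
  refine csSup_le (hne.image _) ?_
  rintro _ ⟨u, hu, rfl⟩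
  exact h u hu

lemma Uclass_mono {E' : Set (Cn n)} (h : E ⊆ E') : Uclass A E' D ψ ⊆ Uclass A E D ψ :=
  fun _ hu => ⟨hu.1, fun z hz => hu.2.1 z (h hz), hu.2.2⟩

end Om

end Reg

end ASub

end



noncomputable section

namespace ASub

set_option linter.unusedSectionVars false

section Main

variable {n : ℕ}

/-- The estimate near `z₀`, uniformly in `u`. -/
lemma local_bound (hn : 1 ≤ n) (A : AlphaForm n) {D : Set (Cn n)} (hD : IsOpen D) (z₀ : Cn n) (hz₀ : z₀ ∈ D)
    {φ : Cn n → ℝ} (hφ : DS volume (ellOf A) D φ) (hφu : UpperSemicontinuousOn φ D) {c0 : ℝ}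
    (hφ0 : φ z₀ = c0)
    (hfreq : ∀ η > (0:ℝ), ∀ s > (0:ℝ), (volume : Measure (Cn n)) {y | y ∈ ball z₀ s ∧ c0 - η ≤ φ y} ≠ 0)
    {t : ℝ} (ht : 0 < t) (ht1 : t < 1) :
    ∃ Γ > (0:ℝ), ∀ η > (0:ℝ), c0 + η ≤ 0 → ∀ ρ > (0:ℝ), ∃ s > (0:ℝ), ball z₀ s ⊆ D ∧
      ∀ u : Cn n → ℝ, IsAlphaSubharmonic A D u → (∀ z ∈ D, u z < 0) →
        (∀ᵐ x ∂(volume : Measure (Cn n)), x ∈ ball z₀ ρ → t * u x + (1 - t) * φ x ≤ c0 + t * η) →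
        ∀ x ∈ ball z₀ s, u x ≤ c0 + η + Γ * η := by
  obtain ⟨Γ, hΓ, r₁, hr₁, κ, hκ, hcore⟩ :=
    core (volume : Measure (Cn n)) (ellOf A) (ell n) hn card_idx finrank_Cn ell_ee ell_co z₀
  refine ⟨Γ / t, by positivity, fun η hη hη0 ρ hρ => ?_⟩
  have h1 := hφu z₀ hz₀ (c0 + η) (show φ z₀ < c0 + η by rw [hφ0]; linarith)
  rw [hD.nhdsWithin_eq hz₀] at h1
  have h2 : ∀ᶠ x in 𝓝 z₀, φ x < c0 + η ∧ x ∈ D ∧ x ∈ ball z₀ ρ := by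
    filter_upwards [h1, hD.mem_nhds hz₀, ball_mem_nhds z₀ hρ] with x a b c using ⟨a, b, c⟩
  obtain ⟨ϱ, hϱ, h3⟩ := Metric.eventually_nhds_iff_ball.1 h2
  set r := min r₁ (ϱ / 2) with hr
  have hr0 : 0 < r := by positivity
  have hrϱ : closedBall z₀ r ⊆ ball z₀ ϱ :=
    closedBall_subset_ball (lt_of_le_of_lt (min_le_right _ _) (by linarith))
  refine ⟨min (κ * r) ϱ, by positivity, fun x hx => (h3 x (ball_subset_ball (min_le_right _ _) hx)).2.1, ?_⟩
  intro u hu hu0 hae x hx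
  have hrD : closedBall z₀ r ⊆ D := fun x hx => (h3 x (hrϱ hx)).2.1
  have hK : IsCompact (closedBall z₀ r) := isCompact_closedBall _ _
  have hDu := DS_of_ash A hu
  have hvDS : DS volume (ellOf A) D (fun x => max (u x) (c0 + η) + (-(c0 + η))) :=
    (kato volume (ellOf A) hD hDu (DS.const (c0 + η)) (fun x hx => (hu0 x hx).le) (fun _ _ => hη0)
      (M := -(c0 + η)) (fun _ _ => by linarith)).add (DS.const _)
  have hwDS : DS volume (ellOf A) D (fun x => - (c0 + η - φ x)) := by
    have := hφ.add (DS.const (A := ellOf A) (-(c0 + η)))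
    convert this using 2; ring
  have hwi : LocallyIntegrableOn (fun x => c0 + η - φ x) D volume := by
    have h5 := hwDS.1.neg
    have h6 : (fun x => c0 + η - φ x) = -(fun x => - (c0 + η - φ x)) := by
      funext x; simp
    rw [h6]; exact h5
  have hres := hcore r hr0 (min_le_left _ _) (fun x => c0 + η - φ x)
    (fun x => max (u x) (c0 + η) + (-(c0 + η))) t η ht (hwDS.mono_set hrD)
    (hwi.integrableOn_compact_subset hrD hK)
    (fun x hx => by have := (h3 x (hrϱ hx)).1; linarith)
    (fun s hs => by
      have := hfreq η hη s hs
      convert this using 5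
      constructor <;> intro h <;> linarith)
    (hvDS.mono_set hrD) (hvDS.1.integrableOn_compact_subset hrD hK)
    (fun x _ => by have := le_max_right (u x) (c0 + η); linarith)
    (by
      filter_upwards [hae] with x hx hxr
      have q := h3 x (hrϱ hxr)
      have q1 := hx q.2.2
      have q2 := q.1
      rcases le_total (u x) (c0 + η) with h | h
      · rw [max_eq_right h]; simp; linarith
      · rw [max_eq_left h]
        have : 0 ≤ t * (c0 + η - φ x) := mul_nonneg ht.le (by linarith)
        nlinarith)
  have hx' : x ∈ ball z₀ (κ * r) := ball_subset_ball (min_le_left _ _) hx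
  refine ash_le_of_ae hu (h3 x (ball_subset_ball (min_le_right _ _) hx)).2.1 (isOpen_ball.mem_nhds hx') ?_
  filter_upwards [hres] with y hy hyb
  have q := hy hyb
  have q2 : u y - (c0 + η) ≤ max (u y) (c0 + η) + (-(c0 + η)) := by
    have := le_max_left (u y) (c0 + η); linarith
  have q3 : t * (u y - (c0 + η)) ≤ Γ * η := (mul_le_mul_of_nonneg_left q2 ht.le).trans q
  have q4 : u y - (c0 + η) ≤ Γ * η / t := by
    rw [le_div_iff₀ ht]; linarith
  have : Γ / t * η = Γ * η / t := by ring
  rw [this]; linarith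

lemma star_le {f : Cn n → ℝ} {z : Cn n} {a c : ℝ} (ha : ∀ᶠ x in 𝓝 z, a ≤ f x) (hc : ∀ᶠ x in 𝓝 z, f x ≤ c) :
    limsup f (𝓝 z) ≤ c :=
  limsup_le_of_le (isCoboundedUnder_le_of_eventually_le (𝓝 z) ha) hc

theorem main (hn : 1 ≤ n) (A : AlphaForm n)
    (D K : Set (Cn n)) (hDo : IsOpen D) (hDb : Bornology.IsBounded D) (hK : IsCompact K) (hKD : K ⊆ D)
    (ψ : Cn n → ℝ) (hψc : ContinuousOn ψ K)
    (hsup : ∃ c < (0 : ℝ), ∀ z ∈ K, ψ z ≤ c)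
    (hext : ∃ Dp : Set (Cn n), IsOpen Dp ∧ closure D ⊆ Dp ∧
      ∃ ψt : Cn n → ℝ, IsStrictlyAlphaSubharmonic A Dp ψt ∧
        (∀ z ∈ K, ψt z = ψ z) ∧ ∀ z ∈ D, ψt z < 0)
    (z₀ : Cn n) (hz₀ : z₀ ∈ K) (hreg : omegaWStar A K D ψ z₀ = ψ z₀)
    (B : Set (Cn n)) (hB : B ∈ 𝓝 z₀) : omegaWStar A (K ∩ closure B) D ψ z₀ = ψ z₀ := by
  obtain ⟨Dp, -, hDDp, ψt, hstr, hψK, hψneg⟩ := hext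
  obtain ⟨csup, hcsup, hψsup⟩ := hsup
  have hcl : IsCompact (closure D) := hDb.isCompact_closure
  obtain ⟨ε, hε, hθ⟩ := hstr D hDo hcl hDDp
  have hz₀D := hKD hz₀
  have hDS_θ := DS_of_ash A hθ
  have husc_θ := usc_of_ash hθ
  obtain ⟨S, hS⟩ : ∃ S, ∀ z ∈ D, sqNorm z ≤ S := by
    obtain ⟨S, hS⟩ := hcl.bddAbove_image (sqNorm_continuous (n := n)).continuousOn
    exact ⟨S, fun z hz => hS ⟨z, subset_closure hz, rfl⟩⟩
  have hS0 : 0 ≤ S := (sqNorm_nonneg z₀).trans (hS z₀ hz₀D)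
  obtain ⟨m, hm⟩ : ∃ m, ∀ z ∈ K, m ≤ ψ z := by
    obtain ⟨m, hm⟩ := hK.bddBelow_image hψc
    exact ⟨m, fun z hz => hm ⟨z, hz, rfl⟩⟩
  have hm0 : m < 0 := lt_of_le_of_lt ((hm z₀ hz₀).trans (hψsup z₀ hz₀)) hcsup
  set M := ε * S - m + 1 with hMd
  have hεS : 0 ≤ ε * S := by positivity
  have hM : 0 < M := by linarith
  set θ : Cn n → ℝ := fun z => ψt z - ε * sqNorm z with hθd
  set θM : Cn n → ℝ := fun z => max (θ z) (-M) with hθM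
  have hθneg : ∀ z ∈ D, θ z < 0 := fun z hz => by
    have h1 := hψneg z hz
    have h2 := mul_nonneg hε.le (sqNorm_nonneg z)
    simp only [hθd]; linarith
  have hDS_θM : DS volume (ellOf A) D θM :=
    kato volume (ellOf A) hDo hDS_θ (DS.const (-M)) (fun z hz => (hθneg z hz).le) (fun _ _ => by linarith)
      (M := M) (fun _ _ => le_rfl)
  have husc_θM : UpperSemicontinuousOn θM D := husc_θ.sup upperSemicontinuousOn_const
  set ψ' : Cn n → ℝ := fun z => θM z + ε * sqNorm z with hψ'
  have hψ'DS : DS volume (ellOf A) D ψ' := hDS_θM.add ((DS_sqNorm A D).const_mul hε.le)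
  have hψ'usc : UpperSemicontinuousOn ψ' D :=
    husc_θM.add (continuous_const.mul sqNorm_continuous).continuousOn.upperSemicontinuousOn
  have hψ'lo : ∀ z, -M ≤ ψ' z := fun z => by
    have h1 : -M ≤ θM z := le_max_right _ _
    have h2 := mul_nonneg hε.le (sqNorm_nonneg z)
    simp only [hψ']; linarith
  have hψ'neg : ∀ z ∈ D, ψ' z < 0 := fun z hz => by
    have h1 := hψneg z hz
    have h2 : ε * sqNorm z ≤ ε * S := mul_le_mul_of_nonneg_left (hS z hz) hε.le
    have h3 : θM z < - (ε * sqNorm z) := max_lt (by simp only [hθd]; linarith) (by linarith)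
    simp only [hψ']; linarith
  have hψ'K : ∀ z ∈ K, ψ' z = ψ z := fun z hz => by
    have h2 : ε * sqNorm z ≤ ε * S := mul_le_mul_of_nonneg_left (hS z (hKD hz)) hε.le
    have h1 : θM z = θ z := max_eq_left (by
      have := hm z hz
      simp only [hθd, hψK z hz]; linarith)
    simp only [hψ', h1, hθd, hψK z hz]; ring
  set g : Cn n → ℝ := fun z => ε * (sqNorm z - sqNorm (z - z₀)) with hg
  have hgc : Continuous g :=
    continuous_const.mul (sqNorm_continuous.sub (sqNorm_continuous.comp (continuous_id.sub continuous_const)))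
  set φ : Cn n → ℝ := fun z => θM z + g z with hφ
  have hφDS : DS volume (ellOf A) D φ := hDS_θM.add ((DS_aff A D z₀).const_mul hε.le)
  have hφusc : UpperSemicontinuousOn φ D := husc_θM.add hgc.continuousOn.upperSemicontinuousOn
  have hφψ : ∀ z, φ z = ψ' z - ε * sqNorm (z - z₀) := fun z => by simp only [hφ, hg, hψ']; ring
  have hsq0 : sqNorm (0 : Cn n) = 0 := by simp [sqNorm]
  have hφ0 : φ z₀ = ψ z₀ := by rw [hφψ, sub_self, hsq0, hψ'K z₀ hz₀]; ring
  have hφle : ∀ z, φ z ≤ ψ' z := fun z => by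
    have h2 := mul_nonneg hε.le (sqNorm_nonneg (z - z₀))
    rw [hφψ]; linarith
  set c0 := ψ z₀ with hc0
  have hc0neg : c0 < 0 := lt_of_le_of_lt (hψsup z₀ hz₀) hcsup
  -- frequency
  have hfreq : ∀ η > (0:ℝ), ∀ s > (0:ℝ), (volume : Measure (Cn n)) {y | y ∈ ball z₀ s ∧ c0 - η ≤ φ y} ≠ 0 := by
    intro η hη s hs
    have hev : ∀ᶠ y in 𝓝 z₀, g z₀ - η / 2 < g y := hgc.continuousAt.eventually_const_lt (by linarith)
    obtain ⟨s', hs', h1⟩ := Metric.eventually_nhds_iff_ball.1 hev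
    have h2 := ash_freq hθ hz₀D (a := θ z₀ - η / 2) (by simp only [hθd]; linarith) (lt_min hs hs')
    intro h0
    refine h2 (measure_mono_null ?_ h0)
    intro y hy
    refine ⟨ball_subset_ball (min_le_left _ _) hy.1, ?_⟩
    have k1 := h1 y (ball_subset_ball (min_le_right _ _) hy.1)
    have k2 : θ z₀ - η / 2 < θ y := hy.2
    have k3 : θ y ≤ θM y := le_max_left _ _
    have k4 : θ z₀ + g z₀ = c0 := by
      simp only [hθd, hg, sub_self, hsq0, hψK z₀ hz₀]; ring
    simp only [hφ]; linarith
  -- members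
  have hatmem : ∀ W : Cn n → ℝ, UpperSemicontinuousOn W D → DS volume (ellOf A) D W → (∀ z ∈ D, W z < 0) →
      (∀ z ∈ D, -M ≤ W z) → (∀ z ∈ K, W z ≤ ψ z) → hat W ∈ Uclass A K D ψ := by
    intro W h1 h2 h3 h4 h5
    refine ⟨hat_ash hDo (fun z hz => (h3 z hz).le) h4 A h1 h2, ?_, ?_⟩
    · intro z hz
      exact (hat_le_self hDo h4 h1 (hKD hz)).trans (h5 z hz)
    · intro z hz
      exact lt_of_le_of_lt (hat_le_self hDo h4 h1 hz) (h3 z hz)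
  have hψ'mem : hat ψ' ∈ Uclass A K D ψ :=
    hatmem ψ' hψ'usc hψ'DS hψ'neg (fun z _ => hψ'lo z) (fun z hz => (hψ'K z hz).le)
  have hψ'hat : ∀ z ∈ D, -M ≤ hat ψ' z := fun z hz =>
    hat_lower hDo (fun z hz => (hψ'neg z hz).le) (fun z _ => hψ'lo z) hz
  have hKB : K ∩ closure B ⊆ K := Set.inter_subset_left
  have hneK : (Uclass A K D ψ).Nonempty := ⟨_, hψ'mem⟩
  have hmemB := Uclass_mono (A := A) (D := D) (ψ := ψ) hKB hψ'mem
  have hneB : (Uclass A (K ∩ closure B) D ψ).Nonempty := ⟨_, hmemB⟩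
  have hDn : D ∈ 𝓝 z₀ := hDo.mem_nhds hz₀D
  have hloK : ∀ᶠ z in 𝓝 z₀, -M ≤ omegaW A K D ψ z := by
    filter_upwards [hDn] with z hz
    exact (hψ'hat z hz).trans (le_omegaW hz hψ'mem)
  have hloB : ∀ᶠ z in 𝓝 z₀, -M ≤ omegaW A (K ∩ closure B) D ψ z := by
    filter_upwards [hDn] with z hz
    exact (hψ'hat z hz).trans (le_omegaW hz hmemB)
  have hupK : ∀ᶠ z in 𝓝 z₀, omegaW A K D ψ z ≤ 0 := by
    filter_upwards [hDn] with z hz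
    exact omegaW_le hneK fun u hu => (hu.2.2 z hz).le
  have hupB : ∀ᶠ z in 𝓝 z₀, omegaW A (K ∩ closure B) D ψ z ≤ 0 := by
    filter_upwards [hDn] with z hz
    exact omegaW_le hneB fun u hu => (hu.2.2 z hz).le
  apply le_antisymm
  swap
  · rw [← hreg]
    refine limsup_le_limsup ?_ (isCoboundedUnder_le_of_eventually_le (𝓝 z₀) hloK)
      (isBoundedUnder_of_eventually_le hupB)
    filter_upwards [hDn] with z hz
    exact omegaW_le hneK fun u hu => le_omegaW hz (Uclass_mono hKB hu)
  -- the upper bound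
  obtain ⟨r, hr, hrB⟩ := Metric.mem_nhds_iff.1 hB
  set q := ε * r ^ 2 with hq
  have hq0 : 0 < q := by positivity
  set t := q / (M + q) with htd
  have ht : 0 < t := by positivity
  have ht1 : t < 1 := by rw [htd, div_lt_one (by positivity)]; linarith
  have htq : t * M = (1 - t) * q := by rw [htd]; field_simp; ring
  obtain ⟨Γ, hΓ, hloc⟩ := local_bound hn A hDo z₀ hz₀D hφDS hφusc hφ0 hfreq ht ht1
  have key : ∀ η > (0:ℝ), c0 + η ≤ 0 → omegaWStar A (K ∩ closure B) D ψ z₀ ≤ c0 + η + Γ * η := by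
    intro η hη hη0
    have hlt : omegaWStar A K D ψ z₀ < c0 + t * η := by
      rw [hreg]; have := mul_pos ht hη; linarith
    have hev : ∀ᶠ z in 𝓝 z₀, omegaW A K D ψ z < c0 + t * η :=
      eventually_lt_of_limsup_lt hlt (isBoundedUnder_of_eventually_le hupK)
    have hev2 : ∀ᶠ z in 𝓝 z₀, omegaW A K D ψ z < c0 + t * η ∧ z ∈ D := by
      filter_upwards [hev, hDn] with z a b using ⟨a, b⟩
    obtain ⟨ρ, hρ, hb⟩ := Metric.eventually_nhds_iff_ball.1 hev2
    obtain ⟨s, hs, hsD, hbd⟩ := hloc η hη hη0 ρ hρ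
    refine star_le hloB ?_
    filter_upwards [ball_mem_nhds z₀ hs] with x hx
    refine omegaW_le hneB fun u hu => ?_
    refine hbd u hu.1 hu.2.2 ?_ x hx
    -- auxiliary competitor
    have hDSu := DS_of_ash A hu.1
    have husu := usc_of_ash hu.1
    have ht1' : 0 ≤ 1 - t := by linarith
    set Sf : Cn n → ℝ := fun z => t * u z + (1 - t) * φ z with hSf
    have hSDS : DS volume (ellOf A) D Sf := (hDSu.const_mul ht.le).add (hφDS.const_mul ht1')
    have usc_mul : ∀ {f : Cn n → ℝ} {c : ℝ}, 0 < c → UpperSemicontinuousOn f D →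
        UpperSemicontinuousOn (fun z => c * f z) D := by
      intro f c hc hf z hz a ha
      have ha' : c * f z < a := ha
      have h1 : f z < a / c := by rw [lt_div_iff₀ hc]; linarith
      refine (hf z hz _ h1).mono fun x hx => ?_
      have hx' : f x < a / c := hx
      rw [lt_div_iff₀ hc] at hx'
      show c * f x < a
      linarith
    have hSusc : UpperSemicontinuousOn Sf D := (usc_mul ht husu).add (usc_mul (by linarith) hφusc)
    have hSneg : ∀ z ∈ D, Sf z < 0 := fun z hz => by
      have h1 := mul_neg_of_pos_of_neg ht (hu.2.2 z hz)
      have h2 := mul_nonpos_of_nonneg_of_nonpos ht1' ((hφle z).trans (hψ'neg z hz).le)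
      simp only [hSf]; linarith
    have hSK : ∀ z ∈ K, Sf z ≤ ψ z := by
      intro z hz
      have h0 := hψ'K z hz
      by_cases hzB : z ∈ closure B
      · have h1 := mul_le_mul_of_nonneg_left (hu.2.1 z ⟨hz, hzB⟩) ht.le
        have h2 := mul_le_mul_of_nonneg_left (hφle z) ht1'
        rw [h0] at h2
        simp only [hSf]; linarith
      · have h1 := mul_neg_of_pos_of_neg ht (hu.2.2 z (hKD hz))
        have h3 : r ≤ ‖z - z₀‖ := by
          by_contra hcon
          push Not at hcon
          exact hzB (subset_closure (hrB (by rw [mem_ball, dist_eq_norm]; exact hcon)))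
        have h4 : q ≤ ε * sqNorm (z - z₀) := by
          refine mul_le_mul_of_nonneg_left ?_ hε.le
          exact (pow_le_pow_left₀ hr.le h3 2).trans (norm_sq_le_sqNorm _)
        have h5 : φ z ≤ ψ z - q := by rw [hφψ, h0]; linarith
        have h6 := mul_le_mul_of_nonneg_left h5 ht1'
        have h7 : -M ≤ ψ z := by have := hm z hz; linarith
        have h8 := mul_le_mul_of_nonneg_left h7 ht.le
        simp only [hSf]; linarith
    set W : Cn n → ℝ := fun z => max (Sf z) (ψ' z) with hW
    have hWDS : DS volume (ellOf A) D W :=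
      kato volume (ellOf A) hDo hSDS hψ'DS (fun z hz => (hSneg z hz).le) (fun z hz => (hψ'neg z hz).le)
        (fun z _ => hψ'lo z)
    have hWusc : UpperSemicontinuousOn W D := hSusc.sup hψ'usc
    have hWneg : ∀ z ∈ D, W z < 0 := fun z hz => max_lt (hSneg z hz) (hψ'neg z hz)
    have hWlo : ∀ z ∈ D, -M ≤ W z := fun z _ => (hψ'lo z).trans (le_max_right _ _)
    have hWmem : hat W ∈ Uclass A K D ψ :=
      hatmem W hWusc hWDS hWneg hWlo (fun z hz => max_le (hSK z hz) (hψ'K z hz).le)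
    filter_upwards [hat_ae hDo (fun z hz => (hWneg z hz).le) hWlo hWusc] with y hy hyb
    obtain ⟨b1, b2⟩ := hb y hyb
    have b3 := le_omegaW b2 hWmem
    rw [hy b2] at b3
    have b4 : Sf y ≤ W y := le_max_left _ _
    simp only [hSf] at b4
    linarith
  by_contra hcon
  push Not at hcon
  set δ := omegaWStar A (K ∩ closure B) D ψ z₀ - c0 with hδ
  have hδ0 : 0 < δ := by linarith
  set η := min (-c0) (δ / (2 * (1 + Γ))) with hη
  have hη0 : 0 < η := lt_min (by linarith) (by positivity)
  have k1 := key η hη0 (by have := min_le_left (-c0) (δ / (2 * (1 + Γ))); linarith)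
  have k2 : η * (2 * (1 + Γ)) ≤ δ := by
    rw [← le_div_iff₀ (by positivity)]; exact min_le_right _ _
  nlinarith

end Main

end ASub

end


/-- If `ψ ∈ C(K)`, `sup_K ψ < 0`, admits a negative strictly
`α`-subharmonic extension to a neighborhood `D⁺` of `closure D`, then a point `z₀ ∈ K`
is locally `(α,ψ)`-regular iff it is `(α,ψ)`-regular. -/
theorem locally_weighted_regular_iff_weighted_regular {n : ℕ} (A : AlphaForm n)
    (D K : Set (Cn n)) (hD : IsAlphaRegularDomain A D) (hK : IsCompact K) (hKD : K ⊆ D)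
    (ψ : Cn n → ℝ) (hψc : ContinuousOn ψ K)
    (hsup : ∃ c < (0 : ℝ), ∀ z ∈ K, ψ z ≤ c)
    (hext : ∃ Dp : Set (Cn n), IsOpen Dp ∧ closure D ⊆ Dp ∧
      ∃ ψt : Cn n → ℝ, IsStrictlyAlphaSubharmonic A Dp ψt ∧
        (∀ z ∈ K, ψt z = ψ z) ∧ ∀ z ∈ D, ψt z < 0)
    (z₀ : Cn n) (hz₀ : z₀ ∈ K) :
    (∀ B : Set (Cn n), B ∈ 𝓝 z₀ → omegaWStar A (K ∩ closure B) D ψ z₀ = ψ z₀) ↔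
      omegaWStar A K D ψ z₀ = ψ z₀ := by
  constructor
  · intro h
    have := h Set.univ univ_mem
    simpa using this
  · intro h B hB
    rcases Nat.eq_zero_or_pos n with hn | hn
    · subst hn
      have hKB : K ∩ closure B = K := by
        refine Set.inter_eq_left.2 fun x _ => ?_
        rw [Subsingleton.elim x z₀]
        exact subset_closure (mem_of_mem_nhds hB)
      rw [hKB]; exact h
    · exact ASub.main hn A D K hD.1 hD.2.2.1 hK hKD ψ hψc hsup hext z₀ hz₀ h B hB
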